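/- arXiv:2307.04741 — 2 statements merged into one kernel-verified Lean document; each statement's English description precedes it below -/
import Mathlib

section
/- Let G be a finite abelian group with |G| coprime to 6. Then lim_{n→∞} (1/(3^{n+1} n^{2n})) · ∑_K det(B_n[K])² · |Sur(cok(B_n[K]), G)| = 1, where the sum is over all n-element subsets K of [n]³ with det(B_n[K]) ≠ 0, and Sur(A, G) denotes the set of surjective group homomorphisms from A to G. (This says that the expected number of surjections from cok(A_n) to G tends to 1 for the determinantal random matrix A_n biased by det².) -/
open scoped Classical

noncomputable section

namespace CLPaper

/-- The matrix `B_n`: rows indexed by `[n]³`, columns by `[n]`;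
the row of `(x₁,x₂,x₃)` is `e_{x₁} + e_{x₂} + e_{x₃}`. -/
def B (n : ℕ) : Matrix (Fin n × Fin n × Fin n) (Fin n) ℤ :=
  fun x j => (if x.1 = j then 1 else 0) + (if x.2.1 = j then 1 else 0) +
    (if x.2.2 = j then 1 else 0)

/-- `det (B_n[K])` for an `n`-element subset `K` of `[n]³` (rows enumerated by a fixed
bijection; the quantities we consider do not depend on this choice), `0` otherwise. -/
def subdet (n : ℕ) (K : Finset (Fin n × Fin n × Fin n)) : ℤ :=
  if h : K.card = n then
    ((B n).submatrix
      (fun i : Fin n => ((K.equivFin.symm (Fin.cast h.symm i)) : Fin n × Fin n × Fin n))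
      id).det
  else 0

/-- The cokernel `ℤ^n / (row span of the rows of `B_n` indexed by `K`)`. -/
def cokK (n : ℕ) (K : Finset (Fin n × Fin n × Fin n)) : Type :=
  (Fin n → ℤ) ⧸ Submodule.span ℤ ((fun x => B n x) '' (K : Set (Fin n × Fin n × Fin n)))

instance (n : ℕ) (K : Finset (Fin n × Fin n × Fin n)) : AddCommGroup (cokK n K) :=
  inferInstanceAs (AddCommGroup ((Fin n → ℤ) ⧸ Submodule.span ℤ _))

/-- The `p`-Sylow subgroup of an abelian group: the subgroup of elements annihilated
by a power of `p`. -/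
def sylow (p : ℕ) (A : Type*) [AddCommGroup A] : AddSubgroup A where
  carrier := {x | ∃ k : ℕ, p ^ k • x = 0}
  zero_mem' := ⟨0, by simp⟩
  add_mem' := by
    rintro x y ⟨k, hk⟩ ⟨l, hl⟩
    refine ⟨k + l, ?_⟩
    rw [smul_add, pow_add, mul_comm, mul_smul, hk, smul_zero, mul_comm, mul_smul, hl,
      smul_zero, add_zero]
  neg_mem' := by
    rintro x ⟨k, hk⟩
    exact ⟨k, by rw [smul_neg, hk, neg_zero]⟩

/-- Number of surjective homomorphisms from `A` to `G`. -/
def numSur (A G : Type*) [AddCommGroup A] [AddCommGroup G] : ℕ :=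
  Nat.card {f : A →+ G // Function.Surjective f}

end CLPaper

open CLPaper Filter

set_option linter.unusedSectionVars false
set_option linter.unusedVariables false

lemma det_sum_expand (n : ℕ) (s : Finset (Fin n × Fin n × Fin n)) :
    Matrix.det (Matrix.of fun i j : Fin n => ∑ x ∈ s, B n x i * B n x j) =
    ∑ φ ∈ Fintype.piFinset (fun _ : Fin n => s),
      (∏ i, B n (φ i) i) * ((B n).submatrix φ id).det := by
  have h := (Matrix.detRowAlternating (R := ℤ) (n := Fin n)).toMultilinearMap.map_sum_finset
    (fun i (x : Fin n × Fin n × Fin n) => (B n x i) • (B n x)) (fun _ => s)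
  have h1 : Matrix.det (Matrix.of fun i j : Fin n => ∑ x ∈ s, B n x i * B n x j) =
      (Matrix.detRowAlternating (R := ℤ) (n := Fin n)).toMultilinearMap
      (fun i => ∑ x ∈ s, (B n x i) • (B n x)) := by
    change _ = Matrix.det _
    congr 1
    ext i j
    simp [Finset.sum_apply]
  rw [h1, h]
  refine Finset.sum_congr rfl fun φ _ => ?_
  rw [MultilinearMap.map_smul_univ]
  rfl

lemma cb (n : ℕ) (s : Finset (Fin n × Fin n × Fin n)) :
    ∑ K ∈ Finset.univ.filter (fun K : Finset (Fin n × Fin n × Fin n) => K.card = n ∧ K ⊆ s),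
      (subdet n K) ^ 2 =
    Matrix.det (Matrix.of fun i j : Fin n => ∑ x ∈ s, B n x i * B n x j) := by
  rw [det_sum_expand]
  have h0 : ∑ φ ∈ Fintype.piFinset (fun _ : Fin n => s),
      (∏ i, B n (φ i) i) * ((B n).submatrix φ id).det =
      ∑ φ ∈ (Fintype.piFinset (fun _ : Fin n => s)).filter Function.Injective,
      (∏ i, B n (φ i) i) * ((B n).submatrix φ id).det := by
    symm
    refine Finset.sum_subset (Finset.filter_subset _ _) ?_
    intro φ hφ hn
    have : ¬ Function.Injective φ := by
      intro hi; exact hn (Finset.mem_filter.2 ⟨hφ, hi⟩)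
    rw [Function.Injective] at this
    push Not at this
    obtain ⟨i, j, hij, hne⟩ := this
    rw [Matrix.det_zero_of_row_eq hne, mul_zero]
    ext k; simp [hij]
  rw [h0]
  rw [← Finset.sum_fiberwise_of_maps_to (s := (Fintype.piFinset (fun _ : Fin n => s)).filter Function.Injective) (g := fun φ => Finset.univ.image φ) (t := Finset.univ.filter (fun K : Finset (Fin n × Fin n × Fin n) => K.card = n ∧ K ⊆ s))]
  · refine Finset.sum_congr rfl fun K hK => ?_
    obtain ⟨hc, hKs⟩ := (Finset.mem_filter.1 hK).2
    let e : Fin n → Fin n × Fin n × Fin n := fun i => (K.equivFin.symm (Fin.cast hc.symm i))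
    have hsub : subdet n K = ((B n).submatrix e id).det := by
      rw [subdet, dif_pos hc]
    have he : Function.Injective e := by
      intro i j hij
      have := K.equivFin.symm.injective (Subtype.ext hij)
      simpa using this
    have heK : ∀ i, e i ∈ K := fun i => (K.equivFin.symm _).2
    have hesurj : ∀ x ∈ K, ∃ i, e i = x := by
      intro x hx
      refine ⟨Fin.cast hc (K.equivFin ⟨x, hx⟩), ?_⟩
      simp [e]
    rw [hsub, sq]
    nth_rw 1 [Matrix.det_apply']
    rw [Finset.sum_mul]
    refine Finset.sum_bij (fun σ _ => e ∘ σ) ?_ ?_ ?_ ?_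
    · intro σ _
      simp only [Finset.mem_filter, Fintype.mem_piFinset]
      refine ⟨⟨fun i => hKs (heK _), he.comp σ.injective⟩, ?_⟩
      ext x
      simp only [Finset.mem_image, Finset.mem_univ, true_and, Function.comp]
      constructor
      · rintro ⟨i, rfl⟩; exact heK _
      · intro hx
        obtain ⟨i, hi⟩ := hesurj x hx
        exact ⟨σ.symm i, by simpa using hi⟩
    · intro σ _ τ _ h
      ext i
      have := congrFun h i
      exact congrArg _ (he this)
    · intro φ hφ
      simp only [Finset.mem_filter, Fintype.mem_piFinset] at hφ
      obtain ⟨⟨h1, h2⟩, h3⟩ := hφ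
      have : ∀ i, ∃ j, e j = φ i := fun i => hesurj _ (by rw [← h3]; simp)
      choose τ hτ using this
      have hinj : Function.Injective τ := by
        intro i j hij
        apply h2
        rw [← hτ, ← hτ, hij]
      refine ⟨Equiv.ofBijective τ (Finite.injective_iff_bijective.1 hinj), Finset.mem_univ _, ?_⟩
      ext1 i
      simp [hτ]
    · intro σ _
      have : ((B n).submatrix (e ∘ σ) id) = ((B n).submatrix e id).submatrix σ id := rfl
      rw [this, Matrix.det_permute]
      simp only [Matrix.submatrix_apply, id, Function.comp]
      ring
  · intro φ hφ
    simp only [Finset.mem_filter, Fintype.mem_piFinset, Finset.mem_univ, true_and] at hφ ⊢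
    refine ⟨?_, ?_⟩
    · rw [Finset.card_image_of_injective _ hφ.2]; simp
    · intro x hx
      simp only [Finset.mem_image, Finset.mem_univ, true_and] at hx
      obtain ⟨i, rfl⟩ := hx
      exact hφ.1 i


def Gen {G : Type} [AddCommGroup G] {n : ℕ} (q : Fin n → G) : Prop :=
  Function.Surjective (fun v : Fin n → ℤ => ∑ i, v i • q i)

def rel {G : Type} [AddCommGroup G] {n : ℕ} (q : Fin n → G) (x : Fin n × Fin n × Fin n) : Prop :=
  q x.1 + q x.2.1 + q x.2.2 = 0

lemma sum_B_smul {G : Type} [AddCommGroup G] {n : ℕ} (q : Fin n → G)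
    (x : Fin n × Fin n × Fin n) : ∑ i, B n x i • q i = q x.1 + q x.2.1 + q x.2.2 := by
  simp only [B, add_smul, Finset.sum_add_distrib, ite_smul, one_smul, zero_smul,
    Finset.sum_ite_eq, Finset.mem_univ, if_true]

lemma numSur_eq {G : Type} [AddCommGroup G] [Fintype G] (n : ℕ)
    (K : Finset (Fin n × Fin n × Fin n)) :
    numSur (cokK n K) G =
      (Finset.univ.filter (fun q : Fin n → G => Gen q ∧ ∀ x ∈ K, rel q x)).card := by
  rw [numSur, ← Fintype.card_subtype, ← Nat.card_eq_fintype_card]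
  set S : Submodule ℤ (Fin n → ℤ) :=
    Submodule.span ℤ ((fun x => B n x) '' (K : Set (Fin n × Fin n × Fin n))) with hS
  let mk : (Fin n → ℤ) →+ cokK n K := (Submodule.mkQ S).toAddMonoidHom
  have hmk : Function.Surjective mk := Submodule.mkQ_surjective S
  have hmk0 : ∀ x ∈ K, mk (B n x) = 0 := by
    intro x hx
    change Submodule.Quotient.mk (p := S) (B n x) = 0
    rw [Submodule.Quotient.mk_eq_zero]
    exact Submodule.subset_span ⟨x, hx, rfl⟩
  have hexp : ∀ (f : cokK n K →+ G) (v : Fin n → ℤ),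
      f (mk v) = ∑ i, v i • f (mk (Pi.single i 1)) := by
    intro f v
    have : v = ∑ i, v i • (Pi.single i 1 : Fin n → ℤ) := by
      ext j; simp [Finset.sum_apply, Pi.single_apply]
    conv_lhs => rw [this]
    simp only [map_sum, map_zsmul]
  refine Nat.card_eq_of_bijective (fun f => ⟨fun i => f.1 (mk (Pi.single i 1)), ?_, ?_⟩) ⟨?_, ?_⟩
  · intro g
    obtain ⟨c, hc⟩ := f.2 g
    obtain ⟨v, rfl⟩ := hmk c
    exact ⟨v, by rw [← hc, hexp f.1 v]⟩
  · intro x hx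
    have := hexp f.1 (B n x)
    rw [hmk0 x hx, map_zero, sum_B_smul] at this
    exact this.symm
  · intro f g hfg
    apply Subtype.ext
    ext c
    obtain ⟨v, rfl⟩ := hmk c
    rw [hexp f.1, hexp g.1]
    have h2 := Subtype.ext_iff.1 hfg
    refine Finset.sum_congr rfl fun i _ => ?_
    exact congrArg _ (congrFun h2 i)
  · rintro ⟨q, hq1, hq2⟩
    let L : (Fin n → ℤ) →ₗ[ℤ] G := Fintype.linearCombination ℤ q
    have hL : ∀ v, L v = ∑ i, v i • q i := fun v => by simp [L, Fintype.linearCombination_apply]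
    have hle : S ≤ LinearMap.ker L := by
      rw [hS, Submodule.span_le]
      rintro _ ⟨x, hx, rfl⟩
      rw [SetLike.mem_coe, LinearMap.mem_ker, hL, sum_B_smul]
      exact hq2 x hx
    let f : cokK n K →+ G := (S.liftQ L hle).toAddMonoidHom
    have hf : ∀ v, f (mk v) = L v := fun v => Submodule.liftQ_apply S L (h := hle) v
    refine ⟨⟨f, ?_⟩, ?_⟩
    · intro g
      obtain ⟨v, hv⟩ := hq1 g
      exact ⟨mk v, by rw [hf, hL]; exact hv⟩
    · apply Subtype.ext
      funext i
      change f (mk (Pi.single i 1)) = q i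
      rw [hf, hL]
      simp [Pi.single_apply]

def Mq {G : Type} [AddCommGroup G] {n : ℕ} (q : Fin n → G) : Matrix (Fin n) (Fin n) ℤ :=
  Matrix.of fun i j : Fin n => ∑ x ∈ Finset.univ.filter (rel q), B n x i * B n x j

lemma reduction {G : Type} [AddCommGroup G] [Fintype G] (n : ℕ) :
    ∑ K ∈ Finset.univ.filter
              (fun K : Finset (Fin n × Fin n × Fin n) => K.card = n ∧ subdet n K ≠ 0),
            (subdet n K : ℝ) ^ 2 * (numSur (cokK n K) G : ℝ) =
    ∑ q ∈ Finset.univ.filter (fun q : Fin n → G => Gen q), ((Mq q).det : ℝ) := by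
  have h1 : ∀ q : Fin n → G, ((Mq q).det : ℝ) =
    ∑ K ∈ Finset.univ.filter (fun K : Finset (Fin n × Fin n × Fin n) => K.card = n),
      if ∀ x ∈ K, rel q x then (subdet n K : ℝ) ^ 2 else 0 := by
    intro q
    rw [Mq, ← cb, ← Finset.sum_filter, Finset.filter_filter]
    push_cast
    refine Finset.sum_congr ?_ fun _ _ => rfl
    ext K
    simp [Finset.subset_iff]
  simp only [h1]
  rw [Finset.sum_comm, ← Finset.filter_filter]
  rw [Finset.sum_filter_of_ne]
  · refine Finset.sum_congr rfl fun K _ => ?_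
    rw [numSur_eq, ← Finset.sum_filter, Finset.sum_const, Finset.filter_filter, nsmul_eq_mul,
      mul_comm]
  · intro K _ h h0
    apply h
    simp [h0]

lemma gen_exists {G : Type} [AddCommGroup G] {n : ℕ} {q : Fin n → G} (hq : Gen q)
    (H : AddSubgroup G) (hH : H ≠ ⊤) : ∃ i, q i ∉ H := by
  by_contra! h
  apply hH
  rw [eq_top_iff]
  intro g _
  obtain ⟨v, rfl⟩ := hq g
  exact H.sum_mem fun i _ => H.zsmul_mem (h i) _

lemma gen_of_surj {G : Type} [AddCommGroup G] {n : ℕ} {q : Fin n → G}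
    (hq : Function.Surjective q) : Gen q := by
  intro g
  obtain ⟨i, rfl⟩ := hq g
  exact ⟨Pi.single i 1, by simp [Pi.single_apply]⟩


def cnt {G : Type} {n : ℕ} (q : Fin n → G) (a : G) : ℕ :=
  (Finset.univ.filter (fun i => q i = a)).card

def nu {G : Type} {n : ℕ} (q : Fin n → G) (a : G) : ℝ := (cnt q a : ℝ) / n

def cv {G : Type} [AddCommGroup G] [Fintype G] (ν : G → ℝ) (a : G) : ℝ := ∑ b, ν b * ν (-a - b)

def PP {G : Type} [AddCommGroup G] [Fintype G] (ν : G → ℝ) : Matrix G G ℝ :=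
  Matrix.of fun a b => if ν a = 0 then 0 else ν (-a - b) * ν b / cv ν a

def dd {G : Type} [AddCommGroup G] [Fintype G] (ν : G → ℝ) : ℝ :=
  Matrix.det (1 + (2 : ℝ) • PP ν)

section
variable {G : Type} [AddCommGroup G] [Fintype G] {n : ℕ}

lemma nu_nonneg (q : Fin n → G) (a : G) : 0 ≤ nu q a := by unfold nu; positivity

lemma cnt_eq (hn : 0 < n) (q : Fin n → G) (a : G) : (cnt q a : ℝ) = n * nu q a := by
  unfold nu; field_simp

lemma sum_q (q : Fin n → G) (g : G → ℝ) :
    ∑ i, g (q i) = ∑ a, (cnt q a : ℝ) * g a := by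
  rw [← Finset.sum_fiberwise (s := Finset.univ) (g := q)]
  refine Finset.sum_congr rfl fun a _ => ?_
  rw [Finset.sum_congr rfl (g := fun _ => g a)]
  · simp [cnt]
  · intro i hi
    rw [(Finset.mem_filter.1 hi).2]

lemma sum_cnt (q : Fin n → G) : ∑ a, cnt q a = n := by
  have := sum_q q (fun _ => 1)
  simp at this
  exact_mod_cast this.symm

lemma sum_nu (hn : 0 < n) (q : Fin n → G) : ∑ a, nu q a = 1 := by
  unfold nu
  rw [← Finset.sum_div, ← Nat.cast_sum, sum_cnt]
  field_simp

lemma sum_ind (q : Fin n → G) (a : G) :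
    ∑ i, (if q i = a then (1 : ℝ) else 0) = cnt q a := by
  simp [cnt]

lemma sum_pairs (q : Fin n → G) (hn : 0 < n) (a : G) :
    ∑ y, ∑ z, (if a + q y + q z = 0 then (1 : ℝ) else 0) = n ^ 2 * cv (nu q) a := by
  have h1 : ∀ y, ∑ z, (if a + q y + q z = 0 then (1 : ℝ) else 0) = cnt q (-a - q y) := by
    intro y
    rw [← sum_ind]
    refine Finset.sum_congr rfl fun z _ => ?_
    have : a + q y + q z = 0 ↔ q z = -a - q y := by
      rw [add_eq_zero_iff_eq_neg']
      constructor <;> intro h <;> rw [h] <;> abel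
    simp only [this]
  simp only [h1]
  rw [sum_q q (fun b => (cnt q (-a - b) : ℝ)), cv, Finset.mul_sum]
  refine Finset.sum_congr rfl fun b _ => ?_
  rw [cnt_eq hn, cnt_eq hn]; ring

lemma Mq_entry (hn : 0 < n) (q : Fin n → G) (i j : Fin n) :
    ((Mq q i j : ℤ) : ℝ) = 3 * (n : ℝ) ^ 2 * ((if i = j then cv (nu q) (q i) else 0) +
      2 / n * nu q (-q i - q j)) := by
  have e0 : ∀ a b c : G, a + b + c = 0 ↔ c = - a - b := by
    intro a b c
    rw [add_eq_zero_iff_eq_neg']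
    constructor <;> intro h <;> rw [h] <;> abel
  have hs : ∀ i j, ∑ z, (if q i + q j + q z = 0 then (1 : ℝ) else 0) = n * nu q (-q i - q j) := by
    intro i j
    rw [← cnt_eq hn, ← sum_ind]
    simp only [e0]
  have hp := sum_pairs q hn (q i)
  have hR : (n : ℝ) ≠ 0 := by positivity
  unfold Mq
  simp only [Matrix.of_apply]
  push_cast
  rw [Finset.sum_filter]
  have key : ∀ x : Fin n × Fin n × Fin n,
     (if rel q x then (B n x i : ℝ) * (B n x j : ℝ) else 0) =
      ((if x.1 = i then 1 else 0) + (if x.2.1 = i then 1 else 0) + (if x.2.2 = i then 1 else 0)) *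
      ((if x.1 = j then 1 else 0) + (if x.2.1 = j then 1 else 0) + (if x.2.2 = j then 1 else 0)) *
      (if q x.1 + q x.2.1 + q x.2.2 = 0 then (1 : ℝ) else 0) := by
    intro x
    unfold B rel
    push_cast
    split_ifs <;> ring
  simp only [key, Fintype.sum_prod_type]
  simp only [add_mul, mul_add, Finset.sum_add_distrib]
  have r1 : ∀ a b c : G, a + b + c = 0 ↔ b + a + c = 0 := by
    intro a b c; rw [add_comm a b]
  have r2 : ∀ a b c : G, a + b + c = 0 ↔ b + c + a = 0 := by
    intro a b c; rw [add_comm (b + c), add_assoc]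
  have r3 : ∀ a b c : G, a + b + c = 0 ↔ a + c + b = 0 := by
    intro a b c; rw [add_right_comm]
  -- nine sums
  have D1 : ∑ x, ∑ y, ∑ z, (if x = i then 1 else 0) * (if x = j then 1 else 0) *
      (if q x + q y + q z = 0 then (1 : ℝ) else 0) =
      if i = j then (n : ℝ) ^ 2 * cv (nu q) (q i) else 0 := by
    rw [Finset.sum_eq_single i]
    · rw [← hp]; by_cases h : i = j <;> simp [h]
    · intro b _ hb; simp [hb]
    · simp
  have O1 : ∀ i j, ∑ x, ∑ y, ∑ z, (if x = i then 1 else 0) * (if y = j then 1 else 0) *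
      (if q x + q y + q z = 0 then (1 : ℝ) else 0) = n * nu q (-q i - q j) := by
    intro i j
    rw [← hs, Finset.sum_eq_single i, Finset.sum_eq_single j]
    · simp
    · intro b _ hb; simp [hb]
    · simp
    · intro b _ hb; simp [hb]
    · simp
  have sy : nu q (-q j - q i) = nu q (-q i - q j) := by congr 1; abel
  have perm1 : ∀ f : Fin n → Fin n → Fin n → ℝ, ∑ x, ∑ y, ∑ z, f x y z = ∑ y, ∑ x, ∑ z, f x y z :=
    fun f => Finset.sum_comm
  have perm2 : ∀ f : Fin n → Fin n → Fin n → ℝ, ∑ x, ∑ y, ∑ z, f x y z = ∑ x, ∑ z, ∑ y, f x y z :=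
    fun f => Finset.sum_congr rfl fun x _ => Finset.sum_comm
  have D2 : ∑ x, ∑ y, ∑ z, (if y = i then 1 else 0) * (if y = j then 1 else 0) *
      (if q x + q y + q z = 0 then (1 : ℝ) else 0) =
      if i = j then (n : ℝ) ^ 2 * cv (nu q) (q i) else 0 := by
    rw [← D1, perm1]
    refine Finset.sum_congr rfl fun x _ => Finset.sum_congr rfl fun y _ =>
      Finset.sum_congr rfl fun z _ => ?_
    simp only [r1 (q x) (q y) (q z)]
  have D3 : ∑ x, ∑ y, ∑ z, (if z = i then 1 else 0) * (if z = j then 1 else 0) *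
      (if q x + q y + q z = 0 then (1 : ℝ) else 0) =
      if i = j then (n : ℝ) ^ 2 * cv (nu q) (q i) else 0 := by
    rw [← D2, perm2]
    refine Finset.sum_congr rfl fun x _ => Finset.sum_congr rfl fun y _ =>
      Finset.sum_congr rfl fun z _ => ?_
    simp only [r3 (q x) (q y) (q z)]
  have O2 : ∀ i j, ∑ x, ∑ y, ∑ z, (if y = i then 1 else 0) * (if x = j then 1 else 0) *
      (if q x + q y + q z = 0 then (1 : ℝ) else 0) = n * nu q (-q i - q j) := by
    intro i j
    rw [← O1, perm1]
    refine Finset.sum_congr rfl fun x _ => Finset.sum_congr rfl fun y _ =>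
      Finset.sum_congr rfl fun z _ => ?_
    simp only [r1 (q x) (q y) (q z)]
  have O3 : ∀ i j, ∑ x, ∑ y, ∑ z, (if x = i then 1 else 0) * (if z = j then 1 else 0) *
      (if q x + q y + q z = 0 then (1 : ℝ) else 0) = n * nu q (-q i - q j) := by
    intro i j
    rw [← O1, perm2]
    refine Finset.sum_congr rfl fun x _ => Finset.sum_congr rfl fun y _ =>
      Finset.sum_congr rfl fun z _ => ?_
    simp only [r3 (q x) (q y) (q z)]
  have O4 : ∀ i j, ∑ x, ∑ y, ∑ z, (if y = i then 1 else 0) * (if z = j then 1 else 0) *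
      (if q x + q y + q z = 0 then (1 : ℝ) else 0) = n * nu q (-q i - q j) := by
    intro i j
    rw [← O3, perm1]
    refine Finset.sum_congr rfl fun x _ => Finset.sum_congr rfl fun y _ =>
      Finset.sum_congr rfl fun z _ => ?_
    simp only [r1 (q x) (q y) (q z)]
  have O5 : ∑ x, ∑ y, ∑ z, (if z = i then 1 else 0) * (if y = j then 1 else 0) *
      (if q x + q y + q z = 0 then (1 : ℝ) else 0) = n * nu q (-q j - q i) := by
    rw [← O4]
    refine Finset.sum_congr rfl fun x _ => Finset.sum_congr rfl fun y _ =>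
      Finset.sum_congr rfl fun z _ => ?_
    ring
  have O6 : ∑ x, ∑ y, ∑ z, (if z = i then 1 else 0) * (if x = j then 1 else 0) *
      (if q x + q y + q z = 0 then (1 : ℝ) else 0) = n * nu q (-q j - q i) := by
    rw [← O3]
    refine Finset.sum_congr rfl fun x _ => Finset.sum_congr rfl fun y _ =>
      Finset.sum_congr rfl fun z _ => ?_
    ring
  rw [D1, D2, D3, O1, O2, O3, O4, O5, O6, sy]
  split_ifs <;> field_simp <;> ring

lemma cv_nonneg {ν : G → ℝ} (h : ∀ a, 0 ≤ ν a) (a : G) : 0 ≤ cv ν a :=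
  Finset.sum_nonneg fun b _ => mul_nonneg (h _) (h _)

lemma le_cv {ν : G → ℝ} (h : ∀ a, 0 ≤ ν a) (a b : G) : ν b * ν (-a - b) ≤ cv ν a :=
  Finset.single_le_sum (f := fun b => ν b * ν (-a - b))
    (fun b _ => mul_nonneg (h _) (h _)) (Finset.mem_univ b)

lemma nu_pos (q : Fin n → G) (i : Fin n) : 0 < nu q (q i) := by
  have hn : 0 < n := i.pos
  unfold nu cnt
  have : 0 < (Finset.univ.filter (fun j => q j = q i)).card :=
    Finset.card_pos.2 ⟨i, by simp⟩
  positivity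

lemma exists_of_nu_pos (q : Fin n → G) (a : G) (h : nu q a ≠ 0) : ∃ i, q i = a := by
  by_contra! h2
  apply h
  unfold nu cnt
  rw [Finset.filter_false_of_mem (by simpa using h2)]
  simp

lemma det_formula (hn : 0 < n) (q : Fin n → G) :
    ((Mq q).det : ℝ) = (3 * (n : ℝ) ^ 2) ^ n * ((∏ i, cv (nu q) (q i)) * dd (nu q)) := by
  have hR : (n : ℝ) ≠ 0 := by positivity
  have h1 : ((Mq q).det : ℝ) = Matrix.det ((3 * (n : ℝ) ^ 2) • Matrix.of
      fun i j : Fin n => (if i = j then cv (nu q) (q i) else 0) + 2 / n * nu q (-q i - q j)) := by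
    have := (Int.castRingHom ℝ).map_det (Mq q)
    simp only [Int.coe_castRingHom] at this
    rw [this]
    congr 1
    ext i j
    simp only [RingHom.mapMatrix_apply, Matrix.map_apply, Int.coe_castRingHom, Matrix.smul_apply,
      Matrix.of_apply, smul_eq_mul]
    exact Mq_entry hn q i j
  rw [h1, Matrix.det_smul, Fintype.card_fin]
  congr 1
  by_cases hz : ∃ i, cv (nu q) (q i) = 0
  · obtain ⟨i, hi⟩ := hz
    rw [Finset.prod_eq_zero (Finset.mem_univ i) hi, zero_mul]
    apply Matrix.det_eq_zero_of_row_eq_zero i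
    intro j
    have h2 := le_cv (nu_nonneg q) (q i) (q j)
    rw [hi] at h2
    have h3 := nu_pos q j
    have h4 := nu_nonneg q (-q i - q j)
    have : nu q (-q i - q j) = 0 := by
      by_contra h5
      have := mul_pos h3 (lt_of_le_of_ne h4 (Ne.symm h5))
      linarith
    simp [hi, this]
  · push Not at hz
    let U : Matrix (Fin n) G ℝ := Matrix.of fun i a => if q i = a then 1 else 0
    let X : Matrix G G ℝ := Matrix.of fun a b =>
      if nu q a = 0 then 0 else 2 / n * nu q (-a - b) / cv (nu q) a
    have hUX : ∀ i b, (U * X) i b = X (q i) b := by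
      intro i b
      simp [U, Matrix.mul_apply]
    have hUXU : ∀ i j, (U * (X * U.transpose)) i j = X (q i) (q j) := by
      intro i j
      rw [← Matrix.mul_assoc, Matrix.mul_apply]
      simp only [hUX]
      simp [U]
    have hUU : U.transpose * U = Matrix.diagonal (fun a => n * nu q a) := by
      ext a b
      simp only [Matrix.mul_apply, Matrix.transpose_apply, U, Matrix.of_apply,
        Matrix.diagonal_apply]
      rw [← cnt_eq hn, ← sum_ind]
      split_ifs with hab
      · subst hab
        refine Finset.sum_congr rfl fun i _ => ?_
        split_ifs <;> simp
      · apply Finset.sum_eq_zero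
        intro i _
        by_cases h : q i = a
        · have : q i ≠ b := fun h' => hab (h.symm.trans h')
          simp [this]
        · simp [h]
    have h2 : (Matrix.of fun i j : Fin n =>
        (if i = j then cv (nu q) (q i) else 0) + 2 / n * nu q (-q i - q j)) =
        Matrix.diagonal (fun i => cv (nu q) (q i)) * (1 + U * (X * U.transpose)) := by
      ext i j
      rw [Matrix.diagonal_mul, Matrix.add_apply, hUXU, Matrix.one_apply]
      simp only [Matrix.of_apply, X]
      rw [if_neg (nu_pos q i).ne']
      have := hz i
      split_ifs <;> field_simp <;> ring
    rw [h2, Matrix.det_mul, Matrix.det_diagonal, Matrix.det_one_add_mul_comm, Matrix.mul_assoc, hUU,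
      dd]
    congr 3
    ext a b
    rw [Matrix.mul_diagonal]
    simp only [X, PP, Matrix.of_apply, Matrix.smul_apply, smul_eq_mul]
    split_ifs
    · simp
    · field_simp
end


section
variable {G : Type} [AddCommGroup G] [Fintype G]

def CG (G : Type) [Fintype G] : ℝ := (Fintype.card G).factorial * 3 ^ Fintype.card G

lemma CG_nonneg : 0 ≤ CG G := by unfold CG; positivity

lemma sum_refl (a : G) (f : G → ℝ) : ∑ b, f (-a - b) = ∑ b, f b :=
  Equiv.sum_comp (Equiv.subLeft (-a)) f

lemma sum_cv {ν : G → ℝ} (h1 : ∑ a, ν a = 1) : ∑ a, cv ν a = 1 := by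
  unfold cv
  rw [Finset.sum_comm]
  have : ∀ b, ∑ a, ν b * ν (-a - b) = ν b := by
    intro b
    rw [← Finset.mul_sum]
    have h2 : ∑ a, ν (-a - b) = ∑ a, ν (-b - a) :=
      Finset.sum_congr rfl fun a _ => by congr 1; abel
    rw [h2, sum_refl, h1, mul_one]
  simp only [this, h1]

lemma PP_nonneg {ν : G → ℝ} (h : ∀ a, 0 ≤ ν a) (a b : G) : 0 ≤ PP ν a b := by
  simp only [PP, Matrix.of_apply]
  split_ifs
  · exact le_rfl
  · exact div_nonneg (mul_nonneg (h _) (h _)) (cv_nonneg h a)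

lemma PP_le {ν : G → ℝ} (h : ∀ a, 0 ≤ ν a) (a b : G) : PP ν a b ≤ 1 := by
  simp only [PP, Matrix.of_apply]
  split_ifs
  · exact zero_le_one
  · apply div_le_one_of_le₀ _ (cv_nonneg h a)
    rw [mul_comm]
    exact le_cv h a b

lemma A_entry {ν : G → ℝ} (h : ∀ a, 0 ≤ ν a) (a b : G) :
    |(1 + (2 : ℝ) • PP ν) a b| ≤ 3 := by
  have h1 := PP_nonneg h a b
  have h2 := PP_le h a b
  rw [Matrix.add_apply, Matrix.smul_apply, smul_eq_mul, Matrix.one_apply]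
  rw [abs_le]
  split_ifs <;> constructor <;> linarith

lemma det_bd (A : Matrix G G ℝ) (h : ∀ a b, |A a b| ≤ 3) : |A.det| ≤ CG G := by
  have := Matrix.det_le (A := A) (abv := AbsoluteValue.abs) (x := 3) h
  simpa [CG, nsmul_eq_mul] using this

lemma dd_bd {ν : G → ℝ} (h : ∀ a, 0 ≤ ν a) : |dd ν| ≤ CG G := det_bd _ (A_entry h)

lemma exists_sign (hodd : Odd (Fintype.card G)) (H : AddSubgroup G) :
    ∃ σ : G → ℝ, (∀ a ∈ H, σ a = 0) ∧ (∀ a, |σ a| ≤ 1) ∧ (∀ a, a ∉ H → |σ a| = 1) ∧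
      (∀ a, σ (-a) = - σ a) ∧ (∀ a, ∀ b ∈ H, σ (a + b) = σ a) := by
  let r : G ⧸ H → ℝ := fun x => ((Fintype.equivFin (G ⧸ H) x : ℕ) : ℝ)
  have hr : Function.Injective r := by
    intro x y hxy
    have : ((Fintype.equivFin (G ⧸ H) x : ℕ) : ℝ) = (Fintype.equivFin (G ⧸ H) y : ℕ) := hxy
    have h2 := Fin.ext (Nat.cast_injective this)
    exact (Fintype.equivFin (G ⧸ H)).injective h2
  let σ : G → ℝ := fun a => Real.sign (r ((-a : G) : G ⧸ H) - r (a : G ⧸ H))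
  have hadd : ∀ a, ∀ b ∈ H, ((a + b : G) : G ⧸ H) = (a : G ⧸ H) := by
    intro a b hb
    rw [QuotientAddGroup.mk_add_of_mem _ hb]
  have habs : ∀ a, |σ a| ≤ 1 := by
    intro a
    rcases Real.sign_apply_eq (r ((-a : G) : G ⧸ H) - r (a : G ⧸ H)) with h | h | h <;>
      (simp only [σ, h]; norm_num)
  refine ⟨σ, ?_, habs, ?_, ?_, ?_⟩
  · intro a ha
    have h1 : (a : G ⧸ H) = 0 := (QuotientAddGroup.eq_zero_iff a).2 ha
    have h2 : ((-a : G) : G ⧸ H) = 0 := (QuotientAddGroup.eq_zero_iff _).2 (H.neg_mem ha)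
    simp only [σ, h1, h2, sub_self, Real.sign_zero]
  · intro a ha
    have hne : r ((-a : G) : G ⧸ H) - r (a : G ⧸ H) ≠ 0 := by
      intro h0
      have h1 := hr (sub_eq_zero.1 h0)
      have h2 : -(-a) + a ∈ H := QuotientAddGroup.eq.1 h1
      have h3 : (2 : ℕ) • a ∈ H := by
        have : -(-a) + a = (2 : ℕ) • a := by rw [two_nsmul, neg_neg]
        rwa [this] at h2
      apply ha
      obtain ⟨m, hm⟩ := hodd
      have h4 : Fintype.card G • a = 0 := card_nsmul_eq_zero
      rw [hm, add_smul, one_smul, mul_comm, mul_smul] at h4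
      have h5 : a = - (m • (2 : ℕ) • a) := by
        rw [eq_neg_iff_add_eq_zero, add_comm]; exact h4
      rw [h5]
      exact H.neg_mem (H.nsmul_mem h3 m)
    rcases Real.sign_apply_eq_of_ne_zero _ hne with h | h <;> (simp only [σ, h]; norm_num)
  · intro a
    simp only [σ, neg_neg]
    rw [← Real.sign_neg, neg_sub]
  · intro a b hb
    have h1 : ((-(a + b) : G) : G ⧸ H) = ((-a : G) : G ⧸ H) := by
      rw [neg_add]; exact hadd _ _ (H.neg_mem hb)
    simp only [σ, h1, hadd a b hb]

def off (H : AddSubgroup G) (ν : G → ℝ) : ℝ := ∑ a ∈ Finset.univ.filter (fun a => a ∉ H), ν a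

lemma off_nonneg (H : AddSubgroup G) {ν : G → ℝ} (h : ∀ a, 0 ≤ ν a) : 0 ≤ off H ν :=
  Finset.sum_nonneg fun _ _ => h _

lemma le_off (H : AddSubgroup G) {ν : G → ℝ} (h : ∀ a, 0 ≤ ν a) {a : G} (ha : a ∉ H) :
    ν a ≤ off H ν :=
  Finset.single_le_sum (f := ν) (fun b _ => h b) (Finset.mem_filter.2 ⟨Finset.mem_univ _, ha⟩)

lemma JJ_bound (H : AddSubgroup G) {ν : G → ℝ} (h : ∀ a, 0 ≤ ν a) (a : G) :
    ∑ b, (if b ∉ H ∧ -a - b ∉ H then ν b * ν (-a - b) else 0) ≤ off H ν ^ 2 := by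
  rw [sq]
  conv_rhs => rw [off, Finset.sum_mul, Finset.sum_filter]
  refine Finset.sum_le_sum fun b _ => ?_
  by_cases hb : b ∈ H
  · simp [hb]
  · by_cases hc : -a - b ∈ H
    · simp only [hb, hc, not_true, and_false, if_false, not_false_iff, if_true]
      exact mul_nonneg (h b) (off_nonneg H h)
    · simp only [hb, hc, and_self, not_false_iff, if_true]
      exact mul_le_mul_of_nonneg_left (le_off H h hc) (h b)

lemma dd_small (hodd : Odd (Fintype.card G)) (H : AddSubgroup G) {ν : G → ℝ}
    (h : ∀ a, 0 ≤ ν a) (hcv : ∀ a, ν a ≠ 0 → cv ν a ≠ 0) (a0 : G) (ha0 : a0 ∉ H)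
    (hνa0 : ν a0 ≠ 0) :
    |dd ν| ≤ CG G * ∑ a ∈ Finset.univ.filter (fun a => a ∉ H ∧ ν a ≠ 0),
      3 * off H ν ^ 2 / cv ν a := by
  obtain ⟨σ, h0, habs, hone, hneg, hadd⟩ := exists_sign hodd H
  set A : Matrix G G ℝ := 1 + (2 : ℝ) • PP ν with hA
  let τ : G → ℝ := fun a => if ν a = 0 then 0 else σ a
  have hs : ∀ a b, σ a + σ b + σ (-a - b) ≠ 0 → a ∉ H ∧ b ∉ H ∧ -a - b ∉ H := by
    intro a b hne
    refine ⟨?_, ?_, ?_⟩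
    · intro ha
      apply hne
      have : -a - b = -b + -a := by abel
      rw [h0 a ha, this, hadd _ _ (H.neg_mem ha), hneg]; ring
    · intro hb
      apply hne
      rw [h0 b hb, sub_eq_add_neg, hadd _ _ (H.neg_mem hb), hneg]; ring
    · intro hc
      apply hne
      have : b = -a + -(-a - b) := by abel
      have h2 : σ b = - σ a := by
        conv_lhs => rw [this]
        rw [hadd _ _ (H.neg_mem hc), hneg]
      rw [h0 _ hc, h2]; ring
  have hAτ0 : ∀ a, ν a = 0 → (A.mulVec τ) a = 0 := by
    intro a ha
    rw [hA, Matrix.add_mulVec, Matrix.one_mulVec, Matrix.smul_mulVec, Pi.add_apply, Pi.smul_apply]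
    have : (PP ν).mulVec τ a = 0 := by
      rw [Matrix.mulVec, dotProduct]
      apply Finset.sum_eq_zero
      intro b _
      simp [PP, ha]
    rw [this]
    simp [τ, ha]
  have hAτ : ∀ a, ν a ≠ 0 → (A.mulVec τ) a =
      (∑ b, ν b * ν (-a - b) * (σ a + σ b + σ (-a - b))) / cv ν a := by
    intro a ha
    have hc := hcv a ha
    rw [hA, Matrix.add_mulVec, Matrix.one_mulVec, Matrix.smul_mulVec, Pi.add_apply, Pi.smul_apply]
    have h1 : (PP ν).mulVec τ a = (∑ b, ν b * ν (-a - b) * σ b) / cv ν a := by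
      rw [Matrix.mulVec, dotProduct, Finset.sum_div]
      refine Finset.sum_congr rfl fun b _ => ?_
      simp only [PP, Matrix.of_apply, if_neg ha, τ]
      split_ifs with hb
      · simp [hb]
      · ring
    have h2 : ∑ b, ν b * ν (-a - b) * σ (-a - b) = ∑ b, ν b * ν (-a - b) * σ b := by
      rw [← sum_refl a]
      refine Finset.sum_congr rfl fun b _ => ?_
      have : -a - (-a - b) = b := by abel
      rw [this]; ring
    have h3 : ∑ b, ν b * ν (-a - b) * σ a = cv ν a * σ a := by
      rw [cv, Finset.sum_mul]
    simp only [mul_add, Finset.sum_add_distrib]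
    rw [h1, h2, h3, smul_eq_mul]
    simp only [τ, if_neg ha]
    field_simp
    ring
  have hbd : ∀ a, ν a ≠ 0 → |(A.mulVec τ) a| ≤ if a ∉ H then 3 * off H ν ^ 2 / cv ν a else 0 := by
    intro a ha
    have hcp : 0 < cv ν a := lt_of_le_of_ne (cv_nonneg h a) (Ne.symm (hcv a ha))
    rw [hAτ a ha, abs_div, abs_of_pos hcp]
    by_cases haH : a ∈ H
    · rw [Finset.sum_eq_zero]
      · simp [haH]
      · intro b _
        have : σ a + σ b + σ (-a - b) = 0 := by
          by_contra hne
          exact (hs a b hne).1 haH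
        rw [this, mul_zero]
    · rw [if_pos haH]
      gcongr
      refine (Finset.abs_sum_le_sum_abs _ _).trans ?_
      refine le_trans ?_ (mul_le_mul_of_nonneg_left (JJ_bound H h a) (by norm_num : (0:ℝ) ≤ 3))
      rw [Finset.mul_sum]
      refine Finset.sum_le_sum fun b _ => ?_
      by_cases hz : σ a + σ b + σ (-a - b) = 0
      · rw [hz, mul_zero, abs_zero]
        split_ifs
        · have := mul_nonneg (h b) (h (-a - b)); linarith
        · simp
      · rw [if_pos (hs a b hz).2, abs_mul, abs_of_nonneg (mul_nonneg (h b) (h (-a - b))), mul_comm]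
        apply mul_le_mul_of_nonneg_right _ (mul_nonneg (h b) (h (-a - b)))
        have e1 := habs a
        have e2 := habs b
        have e3 := habs (-a - b)
        calc |σ a + σ b + σ (-a - b)| ≤ |σ a| + |σ b| + |σ (-a - b)| := abs_add_three _ _ _
          _ ≤ 3 := by linarith
  have hadj : A.det * τ a0 = ∑ a, A.adjugate a0 a * (A.mulVec τ) a := by
    have h1 : A.adjugate.mulVec (A.mulVec τ) = A.det • τ := by
      rw [Matrix.mulVec_mulVec, Matrix.adjugate_mul, Matrix.smul_mulVec, Matrix.one_mulVec]
    have h2 := congrFun h1 a0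
    rw [Pi.smul_apply, smul_eq_mul] at h2
    rw [← h2]; rfl
  have hadjb : ∀ a, |A.adjugate a0 a| ≤ CG G := by
    intro a
    rw [Matrix.adjugate_apply]
    apply det_bd
    intro x y
    rw [Matrix.updateRow_apply]
    split_ifs
    · rw [Pi.single_apply]; split_ifs <;> norm_num
    · exact A_entry h x y
  have hτ : |τ a0| = 1 := by simp only [τ, if_neg hνa0]; exact hone a0 ha0
  have : |dd ν| = |A.det * τ a0| := by rw [abs_mul, hτ, mul_one]; rfl
  rw [this, hadj, Finset.mul_sum, Finset.sum_filter]
  refine (Finset.abs_sum_le_sum_abs _ _).trans ?_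
  refine Finset.sum_le_sum fun a _ => ?_
  rw [abs_mul]
  by_cases ha : ν a = 0
  · simp [hAτ0 a ha, ha]
  · have := hbd a ha
    by_cases haH : a ∈ H
    · simp only [haH, not_true, if_false] at this
      have h0 := le_antisymm this (abs_nonneg _)
      simp [haH, h0]
    · rw [if_pos haH] at this
      rw [if_pos ⟨haH, ha⟩]
      exact mul_le_mul (hadjb a) this (abs_nonneg _) CG_nonneg

lemma dd_unif : dd (fun _ : G => ((Fintype.card G : ℝ))⁻¹) = 3 := by
  have hg : (Fintype.card G : ℝ) ≠ 0 := by
    have : 0 < Fintype.card G := Fintype.card_pos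
    positivity
  unfold dd
  have : (2 : ℝ) • PP (fun _ : G => ((Fintype.card G : ℝ))⁻¹) =
      Matrix.replicateCol Unit (fun _ : G => (2 : ℝ)) *
      Matrix.replicateRow Unit (fun _ : G => ((Fintype.card G : ℝ))⁻¹) := by
    ext a b
    simp [PP, cv, Matrix.mul_apply, hg]
  rw [this, Matrix.det_one_add_replicateCol_mul_replicateRow]
  simp [dotProduct, hg]
  norm_num

lemma dd_cont : ContinuousAt (fun ν : G → ℝ => dd ν) (fun _ : G => ((Fintype.card G : ℝ))⁻¹) := by
  have hg : (Fintype.card G : ℝ) ≠ 0 := by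
    have : 0 < Fintype.card G := Fintype.card_pos
    positivity
  set u : G → ℝ := (fun _ : G => ((Fintype.card G : ℝ))⁻¹) with hu
  have h1 : (fun ν : G → ℝ => Matrix.det (1 + (2 : ℝ) •
      Matrix.of fun a b => ν (-a - b) * ν b / cv ν a)) =ᶠ[nhds u] fun ν => dd ν := by
    have h2 : ∀ᶠ ν : G → ℝ in nhds u, ∀ a, ν a ≠ 0 := by
      rw [Filter.eventually_all]
      intro a
      have hc : ContinuousAt (fun ν : G → ℝ => ν a) u := (continuous_apply a).continuousAt
      apply hc.eventually_ne
      simp [hu, hg]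
    filter_upwards [h2] with ν hν
    unfold dd PP
    simp only [hν, if_false]
  refine ContinuousAt.congr ?_ h1
  have hcd : Continuous (fun A : Matrix G G ℝ => A.det) := Continuous.matrix_det continuous_id
  refine (hcd.continuousAt).comp (f := fun ν : G → ℝ => (1 + (2 : ℝ) •
      Matrix.of fun a b => ν (-a - b) * ν b / cv ν a)) ?_
  refine continuousAt_pi.2 fun a => continuousAt_pi.2 fun b => ?_
  change ContinuousAt (fun ν : G → ℝ => (1 : Matrix G G ℝ) a b + 2 * (ν (-a - b) * ν b / cv ν a)) u
  refine continuousAt_const.add (continuousAt_const.mul ?_)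
  refine ContinuousAt.div ?_ ?_ ?_
  · fun_prop
  · unfold cv; fun_prop
  · simp [cv, hu, hg]

end


section
variable {G : Type} [AddCommGroup G] [Fintype G] {n : ℕ}

def Near (H : AddSubgroup G) (ν : G → ℝ) (ρ : ℝ) : Prop :=
  (∀ b ∈ H, |ν b - (Nat.card H : ℝ)⁻¹| ≤ ρ) ∧ ∀ b, b ∉ H → ν b ≤ ρ

lemma sum_split (H : AddSubgroup G) (f : G → ℝ) :
    ∑ a, f a = ∑ a ∈ Finset.univ.filter (fun a => a ∈ H), f a + off H f := by
  unfold off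
  exact (Finset.sum_filter_add_sum_filter_not _ _ _).symm

lemma card_filter_H (H : AddSubgroup G) :
    (Finset.univ.filter (fun a : G => a ∈ H)).card = Nat.card H := by
  rw [Nat.card_eq_fintype_card, Fintype.card_subtype]

lemma dichotomy (h3 : Nat.Coprime (Fintype.card G) 3) {ν : G → ℝ} (h : ∀ a, 0 ≤ ν a)
    (h1 : ∑ a, ν a = 1) {η : ℝ} (hη : 0 ≤ η) (g : ℝ) (hg : g = Fintype.card G)
    (hsmall : 2 * g * ((2 * g + 1) * η) ≤ 1 / (2 * g)) (hcv : ∀ a, ν a ≤ cv ν a + η) :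
    ∃ H : AddSubgroup G, Near H ν (8 * g ^ 3 * η) := by
  have hg1 : 1 ≤ g := by
    rw [hg]
    have : 0 < Fintype.card G := Fintype.card_pos
    exact_mod_cast this
  obtain ⟨a0, ha0⟩ := Finite.exists_max ν
  set m := ν a0 with hm
  have hmg : 1 / g ≤ m := by
    have : ∑ a, ν a ≤ ∑ a : G, m := Finset.sum_le_sum fun a _ => ha0 a
    rw [h1, Finset.sum_const, Finset.card_univ, nsmul_eq_mul, ← hg] at this
    rw [div_le_iff₀ (by linarith)]; linarith
  -- key estimate
  have key : ∀ a b, ∀ δ, m - ν a ≤ δ → ν b * (m - ν (-a - b)) ≤ δ + η := by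
    intro a b δ hδ
    have e1 : ∑ b, ν b * (m - ν (-a - b)) = m - cv ν a := by
      simp only [mul_sub, Finset.sum_sub_distrib]
      rw [← Finset.sum_mul, h1, one_mul, cv]
    have e2 : ν b * (m - ν (-a - b)) ≤ ∑ b, ν b * (m - ν (-a - b)) :=
      Finset.single_le_sum (f := fun b => ν b * (m - ν (-a - b)))
        (fun b _ => mul_nonneg (h b) (by linarith [ha0 (-a - b)])) (Finset.mem_univ b)
    have := hcv a
    linarith
  have key2 : ∀ a b, ∀ δ, m - ν a ≤ δ → 1 / (2 * g) ≤ ν b → m - ν (-a - b) ≤ 2 * g * (δ + η) := by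
    intro a b δ hδ hb
    have e1 := key a b δ hδ
    have e2 : 0 ≤ m - ν (-a - b) := by linarith [ha0 (-a - b)]
    have e3 : 1 / (2 * g) * (m - ν (-a - b)) ≤ δ + η :=
      (mul_le_mul_of_nonneg_right hb e2).trans e1
    rw [one_div, inv_mul_le_iff₀ (by linarith)] at e3
    exact e3
  have hgg : 1 / g = 1 / (2 * g) + 1 / (2 * g) := by field_simp; norm_num
  have hη2 : 2 * g * η ≤ 1 / (2 * g) := by
    refine le_trans ?_ hsmall
    have : η ≤ (2 * g + 1) * η := by nlinarith
    have h2g : 0 ≤ 2 * g := by linarith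
    exact mul_le_mul_of_nonneg_left this h2g
  let S : Set G := {a | 1 / (2 * g) ≤ ν a}
  have hS1 : ∀ b ∈ S, m - ν b ≤ 2 * g * η := by
    intro b hb
    have e1 := key2 a0 b 0 (by simp [hm]) hb
    rw [zero_add] at e1
    have e2 : -a0 - b ∈ S := by
      change 1 / (2 * g) ≤ ν (-a0 - b)
      linarith
    have e3 := key2 a0 (-a0 - b) 0 (by simp [hm]) e2
    have : -a0 - (-a0 - b) = b := by abel
    rw [this, zero_add] at e3
    exact e3
  have hS2 : ∀ a ∈ S, ∀ b ∈ S, -a - b ∈ S := by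
    intro a ha b hb
    have e1 := key2 a b _ (hS1 a ha) hb
    have e2 : 2 * g * η + η = (2 * g + 1) * η := by ring
    rw [e2] at e1
    change 1 / (2 * g) ≤ ν (-a - b)
    linarith
  have ha0S : a0 ∈ S := by
    change 1 / (2 * g) ≤ ν a0
    have : 0 ≤ 1 / (2 * g) := by positivity
    linarith
  have hS3 : ∀ a ∈ S, ∀ b ∈ S, ∀ c ∈ S, a + b - c ∈ S := by
    intro a ha b hb c hc
    have := hS2 _ (hS2 a ha b hb) c hc
    have e : -(-a - b) - c = a + b - c := by abel
    rwa [e] at this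
  let H0 : AddSubgroup G :=
    { carrier := {x | x + a0 ∈ S}
      zero_mem' := by simpa using ha0S
      add_mem' := by
        intro x y hx hy
        have := hS3 _ hx _ hy _ ha0S
        have e : x + a0 + (y + a0) - a0 = x + y + a0 := by abel
        rwa [e] at this
      neg_mem' := by
        intro x hx
        have := hS3 _ ha0S _ ha0S _ hx
        have e : a0 + a0 - (x + a0) = -x + a0 := by abel
        rwa [e] at this }
  have hH0 : ∀ x, x ∈ H0 ↔ x + a0 ∈ S := fun x => Iff.rfl
  have h3a : (3 : ℕ) • a0 ∈ H0 := by
    have e : -(-((3 : ℕ) • a0)) = (3 : ℕ) • a0 := neg_neg _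
    rw [← e]
    apply H0.neg_mem
    rw [hH0]
    have := hS2 _ ha0S _ ha0S
    have e : -((3 : ℕ) • a0) + a0 = -a0 - a0 := by
      rw [show (3 : ℕ) = 2 + 1 from rfl, add_smul, two_smul, one_smul]; abel
    rwa [e]
  have ha0H : a0 ∈ H0 := by
    have e : ((Fintype.card G : ℤ) * (Fintype.card G).gcdA 3 + 3 * (Fintype.card G).gcdB 3) = 1 := by
      have := Nat.gcd_eq_gcd_ab (Fintype.card G) 3
      rw [h3.gcd_eq_one] at this
      exact_mod_cast this.symm
    have e2 : a0 = ((Fintype.card G).gcdB 3) • ((3 : ℕ) • a0) := by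
      have hc : Fintype.card G • a0 = 0 := card_nsmul_eq_zero
      calc a0 = (1 : ℤ) • a0 := (one_zsmul _).symm
        _ = _ := by
          rw [← e, add_smul, mul_comm, mul_smul, mul_comm, mul_smul, natCast_zsmul, hc, smul_zero,
            zero_add]
          congr 1
          exact natCast_zsmul a0 3
    rw [e2]
    exact H0.zsmul_mem h3a _
  have hH : ∀ x, x ∈ H0 ↔ x ∈ S := by
    intro x
    constructor
    · intro hx
      have := H0.sub_mem hx ha0H
      rw [hH0] at this
      simpa using this
    · intro hx
      have : x - a0 ∈ H0 := by rw [hH0]; simpa using hx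
      simpa using H0.add_mem this ha0H
  have hoff : ∀ b, b ∉ H0 → ν b ≤ 2 * g * ((2 * g + 1) * η) := by
    intro b hb
    have h0S : (0 : G) ∈ S := (hH 0).1 H0.zero_mem
    have e1 := key 0 b _ (hS1 0 h0S)
    have hnb : -b ∉ H0 := fun h => hb (by simpa using H0.neg_mem h)
    have hnb2 : ν (-b) < 1 / (2 * g) := by
      by_contra hcon
      exact hnb ((hH _).2 (not_lt.1 hcon))
    rw [neg_zero, zero_sub] at e1
    have e3 : ν b * (1 / (2 * g)) ≤ 2 * g * η + η :=
      (mul_le_mul_of_nonneg_left (by linarith) (h b)).trans e1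
    rw [mul_one_div, div_le_iff₀ (by linarith)] at e3
    linarith
  refine ⟨H0, ?_, ?_⟩
  · intro b hb
    have hbS := (hH b).1 hb
    have hsp := sum_split H0 ν
    rw [h1] at hsp
    have hhpos : 0 < (Nat.card H0 : ℝ) := by
      have : 0 < Nat.card H0 := Nat.card_pos
      exact_mod_cast this
    have hhg : (Nat.card H0 : ℝ) ≤ g := by
      rw [hg, ← card_filter_H]
      exact_mod_cast Finset.card_le_univ _
    have hh1 : 1 ≤ (Nat.card H0 : ℝ) := by
      have : 0 < Nat.card H0 := Nat.card_pos
      exact_mod_cast this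
    have hoff0 := off_nonneg H0 h
    have hoff1 : off H0 ν ≤ g * (2 * g * ((2 * g + 1) * η)) := by
      unfold off
      refine (Finset.sum_le_card_nsmul _ _ _ (fun a ha => hoff a (Finset.mem_filter.1 ha).2)).trans ?_
      rw [nsmul_eq_mul]
      apply mul_le_mul_of_nonneg_right
      · rw [hg]; exact_mod_cast Finset.card_le_univ _
      · positivity
    have hs1 : ∑ a ∈ Finset.univ.filter (fun a => a ∈ H0), ν a ≤ (Nat.card H0 : ℝ) * m := by
      rw [← card_filter_H, ← nsmul_eq_mul]
      exact Finset.sum_le_card_nsmul _ _ _ fun a _ => ha0 a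
    have hs2 : (Nat.card H0 : ℝ) * (m - 2 * g * η) ≤
        ∑ a ∈ Finset.univ.filter (fun a => a ∈ H0), ν a := by
      rw [← card_filter_H, ← nsmul_eq_mul]
      refine Finset.card_nsmul_le_sum _ _ _ fun a ha => ?_
      have := hS1 a ((hH a).1 (Finset.mem_filter.1 ha).2)
      linarith
    have hb1 := hS1 b hbS
    have hb2 := ha0 b
    set c : ℝ := (Nat.card H0 : ℝ)
    have q1 : 2 * g * η ≤ 8 * g ^ 3 * η := by
      apply mul_le_mul_of_nonneg_right _ hη
      nlinarith [sq_nonneg g, mul_self_nonneg (g - 1)]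
    have q2 : g * (2 * g * ((2 * g + 1) * η)) + 2 * g * η ≤ 8 * g ^ 3 * η := by
      have : g * (2 * g * (2 * g + 1)) + 2 * g ≤ 8 * g ^ 3 := by
        nlinarith [sq_nonneg g, mul_self_nonneg (g - 1), mul_nonneg (by linarith : 0 ≤ g) (by linarith : 0 ≤ g - 1), mul_nonneg (mul_nonneg (by linarith : 0 ≤ g) (by linarith : 0 ≤ g)) (by linarith : 0 ≤ g - 1)]
      have := mul_le_mul_of_nonneg_right this hη
      linarith
    have hc1 : c * c⁻¹ = 1 := mul_inv_cancel₀ hhpos.ne'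
    have hci : 0 < c⁻¹ := inv_pos.2 hhpos
    rw [abs_le]
    constructor
    · -- m ≥ (1 - off)/c
      have e1 : (1 - off H0 ν) * c⁻¹ ≤ m := by
        rw [← div_eq_mul_inv, div_le_iff₀ hhpos]; linarith
      have e2 : off H0 ν * c⁻¹ ≤ off H0 ν := by
        apply mul_le_of_le_one_right hoff0
        exact inv_le_one_of_one_le₀ hh1
      nlinarith
    · have e1 : m - 2 * g * η ≤ c⁻¹ := by
        rw [← one_div, le_div_iff₀ hhpos]; linarith
      linarith
  · intro b hb
    refine (hoff b hb).trans ?_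
    have : 2 * g * (2 * g + 1) ≤ 8 * g ^ 3 := by
      nlinarith [sq_nonneg g, mul_nonneg (by linarith : 0 ≤ g) (by linarith : 0 ≤ g - 1), mul_nonneg (mul_nonneg (by linarith : 0 ≤ g) (by linarith : 0 ≤ g)) (by linarith : 0 ≤ g - 1)]
    have := mul_le_mul_of_nonneg_right this hη
    linarith

end


section
variable {G : Type} [AddCommGroup G] [Fintype G] {n : ℕ}

def FF (q : Fin n → G) : ℝ := ∏ i, cv (nu q) (q i)

lemma FF_nonneg (q : Fin n → G) : 0 ≤ FF q :=
  Finset.prod_nonneg fun i _ => cv_nonneg (nu_nonneg q) _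

lemma sum_prod_W (W : G → ℝ) : ∑ q : Fin n → G, ∏ i, W (q i) = (∑ a, W a) ^ n := by
  have := Finset.prod_univ_sum (ι := Fin n) (fun _ => (Finset.univ : Finset G)) (fun _ a => W a)
  simp only [Finset.prod_const, Finset.card_univ, Fintype.card_fin, Fintype.piFinset_univ] at this
  exact this.symm

lemma chern (S : Finset (Fin n → G)) (p w : G → ℝ) (hp : ∀ a, 0 ≤ p a) (hw : ∀ a, 0 ≤ w a)
    (Wc : ℝ) (hWc : 0 < Wc) (hS : ∀ q ∈ S, Wc ≤ ∏ i, w (q i)) :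
    ∑ q ∈ S, ∏ i, p (q i) ≤ (∑ a, p a * w a) ^ n / Wc := by
  rw [le_div_iff₀ hWc, ← sum_prod_W, Finset.sum_mul]
  calc ∑ q ∈ S, (∏ i, p (q i)) * Wc ≤ ∑ q ∈ S, ∏ i, (p (q i) * w (q i)) := by
        refine Finset.sum_le_sum fun q hq => ?_
        rw [Finset.prod_mul_distrib]
        exact mul_le_mul_of_nonneg_left (hS q hq) (Finset.prod_nonneg fun i _ => hp _)
    _ ≤ _ := Finset.sum_le_sum_of_subset_of_nonneg (Finset.subset_univ _)
        fun q _ _ => Finset.prod_nonneg fun i _ => mul_nonneg (hp _) (hw _)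

lemma prod_q (q : Fin n → G) (w : G → ℝ) : ∏ i, w (q i) = ∏ a, w a ^ cnt q a := by
  rw [← Finset.prod_fiberwise (s := Finset.univ) (g := q)]
  refine Finset.prod_congr rfl fun a _ => ?_
  rw [Finset.prod_congr rfl (g := fun _ => w a)]
  · simp [cnt]
  · intro i hi
    rw [(Finset.mem_filter.1 hi).2]

lemma nu_le_one (hn : 0 < n) (q : Fin n → G) (a : G) : nu q a ≤ 1 := by
  rw [← sum_nu hn q]
  exact Finset.single_le_sum (f := nu q) (fun b _ => nu_nonneg q b) (Finset.mem_univ a)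

lemma hoeff (hn : 0 < n) (S : Finset (Fin n → G)) (p : G → ℝ) (hp : ∀ a, 0 ≤ p a)
    (hp1 : ∑ a, p a = 1) (a : G) (x : ℝ) (hS : ∀ q ∈ S, nu q a = x) :
    ∑ q ∈ S, ∏ i, p (q i) ≤ Real.exp (-(n * (x - p a) ^ 2 / 4)) := by
  rcases S.eq_empty_or_nonempty with hE | ⟨q0, hq0⟩
  · rw [hE, Finset.sum_empty]; positivity
  have hx0 : 0 ≤ x := by rw [← hS q0 hq0]; exact nu_nonneg _ _
  have hx1 : x ≤ 1 := by rw [← hS q0 hq0]; exact nu_le_one hn _ _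
  have hpa : p a ≤ 1 := by
    rw [← hp1]
    exact Finset.single_le_sum (f := p) (fun b _ => hp b) (Finset.mem_univ a)
  set s : ℝ := (x - p a) / 2 with hs
  have hsabs : |s| ≤ 1 := by
    rw [abs_le]; constructor <;> linarith [hp a]
  have hexp : Real.exp s - 1 ≤ s + s ^ 2 := by
    have := (abs_le.1 (Real.abs_exp_sub_one_sub_id_le hsabs)).2
    linarith
  have h1 := chern S p (fun b => if b = a then Real.exp s else 1) hp
    (fun b => by split_ifs <;> positivity) (Real.exp (s * (n * x))) (Real.exp_pos _) (by
      intro q hq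
      rw [prod_q q (fun b => if b = a then Real.exp s else 1), Finset.prod_eq_single a]
      · rw [if_pos rfl, ← Real.exp_nat_mul, cnt_eq hn, hS q hq, mul_comm s]
      · intro b _ hb; simp [hb]
      · simp)
  refine h1.trans ?_
  have h2 : ∑ b, p b * (if b = a then Real.exp s else 1) = 1 + p a * (Real.exp s - 1) := by
    have : ∀ b, p b * (if b = a then Real.exp s else 1) =
        p b + (if b = a then p a * (Real.exp s - 1) else 0) := by
      intro b
      split_ifs with hb
      · rw [hb]; ring
      · ring
    simp only [this, Finset.sum_add_distrib, hp1, Finset.sum_ite_eq', Finset.mem_univ, if_true]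
  rw [h2]
  have h3 : 1 + p a * (Real.exp s - 1) ≤ Real.exp (p a * (Real.exp s - 1)) := by
    rw [add_comm]; exact Real.add_one_le_exp _
  have h4 : 0 ≤ 1 + p a * (Real.exp s - 1) := by
    nlinarith [mul_nonneg (hp a) (Real.exp_pos s).le]
  have h5 : (1 + p a * (Real.exp s - 1)) ^ n ≤ Real.exp (n * (p a * (Real.exp s - 1))) := by
    rw [Real.exp_nat_mul]
    exact pow_le_pow_left₀ h4 h3 n
  rw [div_le_iff₀ (Real.exp_pos _), ← Real.exp_add]
  refine h5.trans (Real.exp_le_exp.2 ?_)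
  have hnn : (0 : ℝ) ≤ n := by positivity
  have e1 : p a * (Real.exp s - 1) ≤ p a * s + s ^ 2 := by
    have := mul_le_mul_of_nonneg_left hexp (hp a)
    nlinarith [sq_nonneg s]
  have e2 : p a = x - 2 * s := by rw [hs]; ring
  have e3 : (x - p a) ^ 2 / 4 = s ^ 2 := by rw [hs]; ring
  have e4 : n * (x - p a) ^ 2 / 4 = n * s ^ 2 := by rw [← e3]; ring
  rw [e4]
  have e5 : p a * (Real.exp s - 1) ≤ -s ^ 2 + s * x := by
    refine e1.trans ?_
    rw [e2]; nlinarith [sq_nonneg s]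
  have := mul_le_mul_of_nonneg_left e5 hnn
  linarith

lemma type_sum (S : Finset (Fin n → G)) (f : (Fin n → G) → ℝ) (T : (Fin n → G) → G → ℕ) (L : ℕ)
    (hT : ∀ q ∈ S, ∀ a, T q a ≤ L) (X : ℝ)
    (hX : ∀ τ : G → ℕ, ∑ q ∈ S.filter (fun q => T q = τ), f q ≤ X) :
    ∑ q ∈ S, f q ≤ ((L : ℝ) + 1) ^ Fintype.card G * X := by
  rw [← Finset.sum_fiberwise_of_maps_to (s := S) (g := T)
    (t := Fintype.piFinset (fun _ : G => Finset.range (L + 1)))]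
  · refine (Finset.sum_le_card_nsmul _ _ X fun τ _ => hX τ).trans (le_of_eq ?_)
    rw [Fintype.card_piFinset]
    simp [nsmul_eq_mul]
  · intro q hq
    rw [Fintype.mem_piFinset]
    intro a
    rw [Finset.mem_range]
    have := hT q hq a
    omega

lemma cnt_le (q : Fin n → G) (a : G) : cnt q a ≤ n := by
  unfold cnt
  refine (Finset.card_le_univ _).trans ?_
  simp

lemma nu_congr {q q' : Fin n → G} (h : cnt q = cnt q') : nu q = nu q' := by
  funext a; unfold nu; rw [h]

/-- Sum of `FF` over a set of configurations each of which violates the fixed point equation. -/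
lemma bad1 (hn : 0 < n) (S : Finset (Fin n → G)) (η : ℝ) (hη : 0 ≤ η)
    (hS : ∀ q ∈ S, ∃ a, cv (nu q) a + η ≤ nu q a) :
    ∑ q ∈ S, FF q ≤ ((n : ℝ) + 1) ^ Fintype.card G * Real.exp (-(n * η ^ 2 / 4)) := by
  refine type_sum S FF cnt n (fun q _ a => cnt_le q a) _ ?_
  intro τ
  rcases (S.filter (fun q => cnt q = τ)).eq_empty_or_nonempty with hE | ⟨q0, hq0⟩
  · rw [hE, Finset.sum_empty]; positivity
  obtain ⟨hq0S, hq0τ⟩ := Finset.mem_filter.1 hq0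
  obtain ⟨a, ha⟩ := hS q0 hq0S
  have hν : ∀ q ∈ S.filter (fun q => cnt q = τ), nu q = nu q0 := fun q hq =>
    nu_congr ((Finset.mem_filter.1 hq).2.trans hq0τ.symm)
  have h1 := hoeff hn (S.filter (fun q => cnt q = τ)) (cv (nu q0)) (cv_nonneg (nu_nonneg q0))
    (sum_cv (sum_nu hn q0)) a (nu q0 a) (fun q hq => by rw [hν q hq])
  have h2 : ∑ q ∈ S.filter (fun q => cnt q = τ), FF q =
      ∑ q ∈ S.filter (fun q => cnt q = τ), ∏ i, cv (nu q0) (q i) :=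
    Finset.sum_congr rfl fun q hq => by rw [FF, hν q hq]
  rw [h2]
  refine h1.trans (Real.exp_le_exp.2 ?_)
  have : η ^ 2 ≤ (nu q0 a - cv (nu q0) a) ^ 2 := by
    apply pow_le_pow_left₀ hη; linarith
  have hnn : (0 : ℝ) ≤ n := by positivity
  have := mul_le_mul_of_nonneg_left this hnn
  linarith

/-- Concentration of the uniform measure. -/
lemma conc (hn : 0 < n) (S : Finset (Fin n → G)) (η : ℝ) (hη : 0 ≤ η)
    (hS : ∀ q ∈ S, ∃ a, η ≤ |nu q a - (Fintype.card G : ℝ)⁻¹|) :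
    (S.card : ℝ) * ((Fintype.card G : ℝ)⁻¹) ^ n ≤
      ((n : ℝ) + 1) ^ Fintype.card G * Real.exp (-(n * η ^ 2 / 4)) := by
  have hg : (Fintype.card G : ℝ) ≠ 0 := by
    have : 0 < Fintype.card G := Fintype.card_pos
    positivity
  have h0 := type_sum S (fun _ => ((Fintype.card G : ℝ)⁻¹) ^ n) cnt n (fun q _ a => cnt_le q a)
    (Real.exp (-(n * η ^ 2 / 4))) ?_
  · simpa [nsmul_eq_mul] using h0
  intro τ
  rcases (S.filter (fun q => cnt q = τ)).eq_empty_or_nonempty with hE | ⟨q0, hq0⟩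
  · rw [hE, Finset.sum_empty]; positivity
  obtain ⟨hq0S, hq0τ⟩ := Finset.mem_filter.1 hq0
  obtain ⟨a, ha⟩ := hS q0 hq0S
  have hν : ∀ q ∈ S.filter (fun q => cnt q = τ), nu q = nu q0 := fun q hq =>
    nu_congr ((Finset.mem_filter.1 hq).2.trans hq0τ.symm)
  have h1 := hoeff hn (S.filter (fun q => cnt q = τ)) (fun _ => (Fintype.card G : ℝ)⁻¹)
    (fun _ => by positivity) (by simp [hg]) a (nu q0 a) (fun q hq => by rw [hν q hq])
  simp only [Finset.prod_const, Finset.card_univ, Fintype.card_fin] at h1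
  refine h1.trans (Real.exp_le_exp.2 ?_)
  have : η ^ 2 ≤ (nu q0 a - (Fintype.card G : ℝ)⁻¹) ^ 2 := by
    rw [← sq_abs (nu q0 a - (Fintype.card G : ℝ)⁻¹)]
    exact pow_le_pow_left₀ hη ha 2
  have hnn : (0 : ℝ) ≤ n := by positivity
  have := mul_le_mul_of_nonneg_left this hnn
  linarith

def KK (H : AddSubgroup G) (q : Fin n → G) : ℕ :=
  ∑ a ∈ Finset.univ.filter (fun a => a ∉ H), cnt q a

lemma KK_eq (hn : 0 < n) (H : AddSubgroup G) (q : Fin n → G) :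
    (KK H q : ℝ) = n * off H (nu q) := by
  unfold KK off
  push_cast
  rw [Finset.mul_sum]
  exact Finset.sum_congr rfl fun a _ => cnt_eq hn q a

lemma sum_off_refl (H : AddSubgroup G) (f : G → ℝ) {b : G} (hb : b ∈ H) :
    ∑ a ∈ Finset.univ.filter (fun a => a ∉ H), f (-a - b) = off H f := by
  unfold off
  rw [Finset.sum_filter, Finset.sum_filter, ← sum_refl b (fun a => if a ∉ H then f a else 0)]
  refine Finset.sum_congr rfl fun a _ => ?_
  have h1 : -b - a = -a - b := by abel
  have h2 : -a - b ∈ H ↔ a ∈ H := by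
    constructor
    · intro h
      have := H.neg_mem (H.add_mem h hb)
      simpa using this
    · intro h
      exact H.sub_mem (H.neg_mem h) hb
  rw [h1]
  simp only [h2]

lemma cv_off (H : AddSubgroup G) (ν : G → ℝ) {a : G} (ha : a ∉ H) :
    cv ν a = 2 * ∑ b ∈ Finset.univ.filter (fun b => b ∈ H), ν b * ν (-a - b) +
      ∑ b, (if b ∉ H ∧ -a - b ∉ H then ν b * ν (-a - b) else 0) := by
  have h1 : ∑ b ∈ Finset.univ.filter (fun b => b ∈ H), ν b * ν (-a - b) =
      ∑ b, if -a - b ∈ H then ν b * ν (-a - b) else 0 := by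
    rw [Finset.sum_filter, ← sum_refl a]
    refine Finset.sum_congr rfl fun b _ => ?_
    have : -a - (-a - b) = b := by abel
    rw [this, mul_comm]
  rw [two_mul]
  nth_rw 2 [h1]
  rw [Finset.sum_filter, ← Finset.sum_add_distrib, ← Finset.sum_add_distrib, cv]
  refine Finset.sum_congr rfl fun b _ => ?_
  by_cases hb : b ∈ H
  · have : -a - b ∉ H := by
      intro h
      apply ha
      have := H.neg_mem (H.add_mem h hb)
      simpa using this
    simp [hb, this]
  · by_cases hc : -a - b ∈ H <;> simp [hb, hc]

lemma sum_off_HH (H : AddSubgroup G) (ν : G → ℝ) :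
    ∑ a ∈ Finset.univ.filter (fun a => a ∉ H),
      ∑ b ∈ Finset.univ.filter (fun b => b ∈ H), ν b * ν (-a - b) =
    (∑ b ∈ Finset.univ.filter (fun b => b ∈ H), ν b) * off H ν := by
  rw [Finset.sum_comm, Finset.sum_mul]
  refine Finset.sum_congr rfl fun b hb => ?_
  rw [← Finset.mul_sum, sum_off_refl H ν (Finset.mem_filter.1 hb).2]

lemma off_cv (H : AddSubgroup G) {ν : G → ℝ} (h : ∀ a, 0 ≤ ν a) (h1 : ∑ a, ν a = 1) :
    2 * off H ν * (1 - off H ν) ≤ off H (cv ν) := by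
  have e : ∑ b ∈ Finset.univ.filter (fun b => b ∈ H), ν b = 1 - off H ν := by
    have := sum_split H ν
    linarith
  have e2 := sum_off_HH H ν
  rw [e] at e2
  have : 2 * off H ν * (1 - off H ν) = ∑ a ∈ Finset.univ.filter (fun a => a ∉ H),
      2 * ∑ b ∈ Finset.univ.filter (fun b => b ∈ H), ν b * ν (-a - b) := by
    rw [← Finset.mul_sum, e2]; ring
  rw [this]
  conv_rhs => rw [off]
  refine Finset.sum_le_sum fun a ha => ?_
  rw [cv_off H ν (Finset.mem_filter.1 ha).2]
  have : 0 ≤ ∑ b, (if b ∉ H ∧ -a - b ∉ H then ν b * ν (-a - b) else 0) :=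
    Finset.sum_nonneg fun b _ => by
      split_ifs
      · exact mul_nonneg (h _) (h _)
      · exact le_rfl
  linarith

/-- Many outliers. -/
lemma bad2 (hn : 0 < n) (H : AddSubgroup G) (S : Finset (Fin n → G)) (L : ℝ)
    (hS : ∀ q ∈ S, off H (nu q) ≤ 1 / 10) (hS2 : ∀ q ∈ S, L ≤ KK H q) :
    ∑ q ∈ S, FF q ≤ ((n : ℝ) + 1) ^ Fintype.card G * Real.exp (-(L / 5)) := by
  refine type_sum S FF cnt n (fun q _ a => cnt_le q a) _ ?_
  intro τ
  rcases (S.filter (fun q => cnt q = τ)).eq_empty_or_nonempty with hE | ⟨q0, hq0⟩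
  · rw [hE, Finset.sum_empty]; positivity
  obtain ⟨hq0S, hq0τ⟩ := Finset.mem_filter.1 hq0
  have hc : ∀ q ∈ S.filter (fun q => cnt q = τ), cnt q = cnt q0 := fun q hq =>
    (Finset.mem_filter.1 hq).2.trans hq0τ.symm
  have hν : ∀ q ∈ S.filter (fun q => cnt q = τ), nu q = nu q0 := fun q hq =>
    nu_congr (hc q hq)
  have h2 : ∑ q ∈ S.filter (fun q => cnt q = τ), FF q =
      ∑ q ∈ S.filter (fun q => cnt q = τ), ∏ i, cv (nu q0) (q i) :=
    Finset.sum_congr rfl fun q hq => by rw [FF, hν q hq]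
  rw [h2]
  have hcv1 := sum_cv (sum_nu hn q0)
  have hcv0 := cv_nonneg (nu_nonneg q0)
  have h1 := chern (S.filter (fun q => cnt q = τ)) (cv (nu q0))
    (fun a => if a ∉ H then 1 / 2 else 1) hcv0 (fun a => by split_ifs <;> norm_num)
    (Real.exp (-(Real.log 2 * KK H q0))) (Real.exp_pos _) (by
      intro q hq
      rw [prod_q q (fun a => if a ∉ H then 1 / 2 else 1), hc q hq, mul_comm, ← mul_neg,
        Real.exp_nat_mul, Real.exp_neg, Real.exp_log (by norm_num), KK,
        ← Finset.prod_pow_eq_pow_sum, Finset.prod_filter]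
      apply le_of_eq
      refine Finset.prod_congr rfl fun a _ => ?_
      split_ifs <;> simp)
  refine h1.trans ?_
  set t := off H (nu q0) with ht
  have ht0 : 0 ≤ t := off_nonneg H (nu_nonneg q0)
  have ht1 : t ≤ 1 / 10 := hS q0 hq0S
  have h3 : ∑ a, cv (nu q0) a * (if a ∉ H then 1 / 2 else 1) = 1 - off H (cv (nu q0)) / 2 := by
    conv_rhs => rw [← hcv1, off, Finset.sum_filter, Finset.sum_div, ← Finset.sum_sub_distrib]
    refine Finset.sum_congr rfl fun a _ => ?_
    split_ifs <;> ring
  have h4 := off_cv H (nu_nonneg q0) (sum_nu hn q0)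
  have h5 : ∑ a, cv (nu q0) a * (if a ∉ H then 1 / 2 else 1) ≤ Real.exp (-(t * (1 - t))) := by
    rw [h3]
    have := Real.add_one_le_exp (-(t * (1 - t)))
    linarith
  have h6 : 0 ≤ ∑ a, cv (nu q0) a * (if a ∉ H then 1 / 2 else 1) :=
    Finset.sum_nonneg fun a _ => mul_nonneg (hcv0 a) (by split_ifs <;> norm_num)
  rw [div_le_iff₀ (Real.exp_pos _), ← Real.exp_add]
  refine (pow_le_pow_left₀ h6 h5 n).trans ?_
  rw [← Real.exp_nat_mul]
  apply Real.exp_le_exp.2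
  have hk := KK_eq hn H q0
  rw [← ht] at hk
  have hL := hS2 q0 hq0S
  have hk0 : (0 : ℝ) ≤ KK H q0 := by positivity
  have hlog := Real.log_two_lt_d9
  have e1 : (n : ℝ) * -(t * (1 - t)) = -(KK H q0 * (1 - t)) := by rw [hk]; ring
  rw [e1]
  nlinarith [mul_nonneg hk0 (by linarith : 0 ≤ 1 - t - Real.log 2 - 1 / 5)]

end


section
variable {G : Type} [AddCommGroup G] [Fintype G] {n : ℕ}

lemma sum_cv_sq (f : G → ℝ) : ∑ a, cv f a = (∑ a, f a) ^ 2 := by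
  unfold cv
  rw [Finset.sum_comm, sq, Finset.sum_mul]
  refine Finset.sum_congr rfl fun b _ => ?_
  rw [← Finset.mul_sum]
  have h2 : ∑ a, f (-a - b) = ∑ a, f (-b - a) :=
    Finset.sum_congr rfl fun a _ => by congr 1; abel
  rw [h2, sum_refl]

/-- Deviation from uniformity on `H`. -/
def eps (H : AddSubgroup G) (ν : G → ℝ) (b : G) : ℝ :=
  if b ∈ H then ν b - (Nat.card H : ℝ)⁻¹ else 0

lemma hcard_pos (H : AddSubgroup G) : (0 : ℝ) < Nat.card H := by
  have : 0 < Nat.card H := Nat.card_pos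
  exact_mod_cast this

lemma hcard_le (H : AddSubgroup G) : (Nat.card H : ℝ) ≤ Fintype.card G := by
  rw [← card_filter_H H]
  exact_mod_cast Finset.card_le_univ _

lemma sum_eps (H : AddSubgroup G) {ν : G → ℝ} (h1 : ∑ a, ν a = 1) :
    ∑ a, eps H ν a = - off H ν := by
  have h := sum_split H ν
  have hp := hcard_pos H
  unfold eps
  rw [← Finset.sum_filter, Finset.sum_sub_distrib, Finset.sum_const, card_filter_H, nsmul_eq_mul,
    mul_inv_cancel₀ hp.ne']
  linarith

lemma refl_mem (H : AddSubgroup G) {a : G} (ha : a ∈ H) (b : G) : -a - b ∈ H ↔ b ∈ H := by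
  constructor
  · intro hb
    have := H.neg_mem (H.add_mem hb ha)
    have e : -(-a - b + a) = b := by abel
    rwa [e] at this
  · intro hb
    exact H.sub_mem (H.neg_mem ha) hb

lemma cv_on (H : AddSubgroup G) {ν : G → ℝ} (h1 : ∑ a, ν a = 1) {a : G} (ha : a ∈ H) :
    cv ν a = (Nat.card H : ℝ)⁻¹ - 2 * off H ν * (Nat.card H : ℝ)⁻¹ + cv (eps H ν) a +
      ∑ b, (if b ∉ H ∧ -a - b ∉ H then ν b * ν (-a - b) else 0) := by
  have hp := hcard_pos H
  set c : ℝ := (Nat.card H : ℝ)⁻¹ with hc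
  have e : ∀ b, ν b * ν (-a - b) = (if b ∈ H then c ^ 2 else 0) + c * eps H ν b +
      c * eps H ν (-a - b) + eps H ν b * eps H ν (-a - b) +
      (if b ∉ H ∧ -a - b ∉ H then ν b * ν (-a - b) else 0) := by
    intro b
    have := refl_mem H ha b
    by_cases hb : b ∈ H
    · simp only [eps, hb, this, if_true, ← hc, not_true_eq_false, false_and, if_false]
      ring
    · simp [eps, hb, this]
  have e2 : ∑ b, (if b ∈ H then c ^ 2 else 0) = c := by
    rw [← Finset.sum_filter, Finset.sum_const, card_filter_H, nsmul_eq_mul, hc]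
    field_simp
  unfold cv
  rw [Finset.sum_congr rfl fun b _ => e b]
  simp only [Finset.sum_add_distrib]
  rw [e2, ← Finset.mul_sum, ← Finset.mul_sum, sum_refl a (eps H ν), sum_eps H h1]
  ring

lemma eps_abs (H : AddSubgroup G) {ν : G → ℝ} {ρ : ℝ} (hρ : 0 ≤ ρ) (hN : Near H ν ρ) (a : G) :
    |eps H ν a| ≤ ρ := by
  unfold eps
  split_ifs with h
  · exact hN.1 a h
  · simpa using hρ

lemma cv_eps_abs (H : AddSubgroup G) {ν : G → ℝ} {ρ : ℝ} (hρ : 0 ≤ ρ) (hN : Near H ν ρ) (a : G) :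
    |cv (eps H ν) a| ≤ Fintype.card G * ρ ^ 2 := by
  unfold cv
  refine (Finset.abs_sum_le_sum_abs _ _).trans ?_
  refine (Finset.sum_le_card_nsmul _ _ (ρ ^ 2) fun b _ => ?_).trans (by simp)
  rw [abs_mul, sq]
  exact mul_le_mul (eps_abs H hρ hN _) (eps_abs H hρ hN _) (abs_nonneg _) hρ

lemma sum_eps_cv_abs (H : AddSubgroup G) {ν : G → ℝ} {ρ : ℝ} (hρ : 0 ≤ ρ) (hN : Near H ν ρ) :
    |∑ a, eps H ν a * cv (eps H ν) a| ≤ (Fintype.card G : ℝ) ^ 2 * ρ ^ 3 := by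
  refine (Finset.abs_sum_le_sum_abs _ _).trans ?_
  refine (Finset.sum_le_card_nsmul _ _ (ρ * (Fintype.card G * ρ ^ 2)) fun b _ => ?_).trans
    (le_of_eq ?_)
  · rw [abs_mul]
    exact mul_le_mul (eps_abs H hρ hN _) (cv_eps_abs H hρ hN _) (abs_nonneg _) hρ
  · rw [Finset.card_univ, nsmul_eq_mul]; ring

lemma cv_eps_off (H : AddSubgroup G) (ν : G → ℝ) {a : G} (ha : a ∉ H) : cv (eps H ν) a = 0 := by
  unfold cv
  refine Finset.sum_eq_zero fun b _ => ?_
  by_cases hb : b ∈ H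
  · have : -a - b ∉ H := by
      intro h
      apply ha
      have := H.neg_mem (H.add_mem h hb)
      have e : -(-a - b + b) = a := by abel
      rwa [e] at this
    simp [eps, this]
  · simp [eps, hb]

lemma sum_nu_cv_eps (H : AddSubgroup G) {ν : G → ℝ} {ρ : ℝ} (hρ : 0 ≤ ρ) (hN : Near H ν ρ)
    (h1 : ∑ a, ν a = 1) :
    ∑ a, ν a * cv (eps H ν) a ≤ off H ν ^ 2 * (Nat.card H : ℝ)⁻¹ +
      (Fintype.card G : ℝ) ^ 2 * ρ ^ 3 := by
  have e : ∀ a, ν a * cv (eps H ν) a = (Nat.card H : ℝ)⁻¹ * cv (eps H ν) a +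
      eps H ν a * cv (eps H ν) a := by
    intro a
    by_cases ha : a ∈ H
    · simp only [eps, ha, if_true]; ring
    · rw [cv_eps_off H ν ha]; ring
  rw [Finset.sum_congr rfl fun a _ => e a, Finset.sum_add_distrib, ← Finset.mul_sum, sum_cv_sq,
    sum_eps H h1]
  have := (abs_le.1 (sum_eps_cv_abs H hρ hN)).2
  linarith

/-- Pointwise bound using the determinant smallness. -/
lemma ptw (hodd : Odd (Fintype.card G)) (hn : 0 < n) (H : AddSubgroup G) (q : Fin n → G)
    (hq : ∃ i, q i ∉ H) :
    |FF q * dd (nu q)| ≤ 3 * CG G * Fintype.card G * ((KK H q : ℝ) ^ 2 / n) *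
      ∏ i, (cv (nu q) (q i) + if q i ∉ H then (n : ℝ)⁻¹ else 0) := by
  have hn' : (0 : ℝ) < n := by exact_mod_cast hn
  have hcv0 := cv_nonneg (nu_nonneg q)
  have hCG : 0 ≤ CG G := CG_nonneg
  set P : ℝ := ∏ i, (cv (nu q) (q i) + if q i ∉ H then (n : ℝ)⁻¹ else 0) with hP
  have hle : ∀ i, cv (nu q) (q i) ≤ cv (nu q) (q i) + if q i ∉ H then (n : ℝ)⁻¹ else 0 := by
    intro i
    have : (0 : ℝ) ≤ if q i ∉ H then (n : ℝ)⁻¹ else 0 := by split_ifs <;> positivity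
    linarith
  have hP0 : 0 ≤ P := Finset.prod_nonneg fun i _ => (hcv0 _).trans (hle i)
  by_cases hz : ∃ i, cv (nu q) (q i) = 0
  · obtain ⟨i, hi⟩ := hz
    have : FF q = 0 := Finset.prod_eq_zero (Finset.mem_univ i) hi
    rw [this, zero_mul, abs_zero]
    exact mul_nonneg (mul_nonneg (mul_nonneg (mul_nonneg zero_le_three hCG) (Nat.cast_nonneg _))
      (div_nonneg (sq_nonneg _) hn'.le)) hP0
  push Not at hz
  have hcv : ∀ a, nu q a ≠ 0 → cv (nu q) a ≠ 0 := by
    intro a ha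
    obtain ⟨i, rfl⟩ := exists_of_nu_pos q a ha
    exact hz i
  obtain ⟨i0, hi0⟩ := hq
  have h1 := dd_small hodd H (nu_nonneg q) hcv (q i0) hi0 (nu_pos q i0).ne'
  rw [abs_mul, abs_of_nonneg (FF_nonneg q)]
  refine (mul_le_mul_of_nonneg_left h1 (FF_nonneg q)).trans ?_
  have hk := KK_eq hn H q
  have h2 : ∀ a ∈ Finset.univ.filter (fun a => a ∉ H ∧ nu q a ≠ 0),
      3 * off H (nu q) ^ 2 / cv (nu q) a * FF q ≤ 3 * off H (nu q) ^ 2 * n * P := by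
    intro a ha
    obtain ⟨-, haH, hνa⟩ := Finset.mem_filter.1 ha
    obtain ⟨i, rfl⟩ := exists_of_nu_pos q a hνa
    have e1 : FF q = cv (nu q) (q i) * ∏ j ∈ Finset.univ.erase i, cv (nu q) (q j) := by
      rw [FF, Finset.mul_prod_erase _ (fun j => cv (nu q) (q j)) (Finset.mem_univ i)]
    have e2 : P = (cv (nu q) (q i) + (n : ℝ)⁻¹) * ∏ j ∈ Finset.univ.erase i,
        (cv (nu q) (q j) + if q j ∉ H then (n : ℝ)⁻¹ else 0) := by
      rw [hP, ← Finset.mul_prod_erase _ _ (Finset.mem_univ i), if_pos haH]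
    have e3 : ∏ j ∈ Finset.univ.erase i, cv (nu q) (q j) ≤ n * P := by
      rw [e2]
      have l1 : ∏ j ∈ Finset.univ.erase i, cv (nu q) (q j) ≤ ∏ j ∈ Finset.univ.erase i,
        (cv (nu q) (q j) + if q j ∉ H then (n : ℝ)⁻¹ else 0) :=
        Finset.prod_le_prod (fun j _ => hcv0 _) (fun j _ => hle j)
      have l2 : 0 ≤ ∏ j ∈ Finset.univ.erase i, cv (nu q) (q j) :=
        Finset.prod_nonneg fun j _ => hcv0 _
      have l3 : 1 ≤ n * (cv (nu q) (q i) + (n : ℝ)⁻¹) := by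
        rw [mul_add, mul_inv_cancel₀ hn'.ne']
        have := mul_nonneg hn'.le (hcv0 (q i))
        linarith
      calc _ ≤ 1 * ∏ j ∈ Finset.univ.erase i,
            (cv (nu q) (q j) + if q j ∉ H then (n : ℝ)⁻¹ else 0) := by rw [one_mul]; exact l1
        _ ≤ _ := by
          rw [← mul_assoc]
          exact mul_le_mul_of_nonneg_right l3 (l2.trans l1)
    rw [e1]
    have : 3 * off H (nu q) ^ 2 / cv (nu q) (q i) *
      (cv (nu q) (q i) * ∏ j ∈ Finset.univ.erase i, cv (nu q) (q j)) =
      3 * off H (nu q) ^ 2 * ∏ j ∈ Finset.univ.erase i, cv (nu q) (q j) := by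
      have := hz i
      field_simp
    rw [this, mul_assoc _ (n : ℝ)]
    exact mul_le_mul_of_nonneg_left e3 (by positivity)
  have h3 : ∑ a ∈ Finset.univ.filter (fun a => a ∉ H ∧ nu q a ≠ 0),
      3 * off H (nu q) ^ 2 / cv (nu q) a * FF q ≤
      Fintype.card G * (3 * off H (nu q) ^ 2 * n * P) := by
    refine (Finset.sum_le_card_nsmul _ _ _ h2).trans ?_
    rw [nsmul_eq_mul]
    refine mul_le_mul_of_nonneg_right ?_ (by positivity)
    exact_mod_cast Finset.card_le_univ _
  calc FF q * (CG G * ∑ a ∈ Finset.univ.filter (fun a => a ∉ H ∧ nu q a ≠ 0),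
        3 * off H (nu q) ^ 2 / cv (nu q) a)
      = CG G * ∑ a ∈ Finset.univ.filter (fun a => a ∉ H ∧ nu q a ≠ 0),
        3 * off H (nu q) ^ 2 / cv (nu q) a * FF q := by rw [← Finset.sum_mul]; ring
    _ ≤ CG G * (Fintype.card G * (3 * off H (nu q) ^ 2 * n * P)) :=
        mul_le_mul_of_nonneg_left h3 hCG
    _ = _ := by rw [hk]; field_simp

/-- The comparison weights. -/
def Wt (H : AddSubgroup G) (ρ : ℝ) (n : ℕ) (x : G → ℝ) (a : G) : ℝ :=
  if a ∈ H then (Nat.card H : ℝ)⁻¹ else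
    2 * ((Nat.card H : ℝ)⁻¹ + ρ) * (∑ b ∈ Finset.univ.filter (fun b => b ∈ H), x (-a - b)) +
      off H x ^ 2 + (n : ℝ)⁻¹

lemma Wt_nonneg (H : AddSubgroup G) {ρ : ℝ} (hρ : 0 ≤ ρ) (n : ℕ) {x : G → ℝ} (hx : ∀ a, 0 ≤ x a)
    (a : G) : 0 ≤ Wt H ρ n x a := by
  unfold Wt
  have : 0 ≤ ∑ b ∈ Finset.univ.filter (fun b => b ∈ H), x (-a - b) :=
    Finset.sum_nonneg fun b _ => hx _
  split_ifs <;> positivity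

lemma sum_Wt (H : AddSubgroup G) {ρ : ℝ} (hρ : 0 ≤ ρ) (n : ℕ) {x : G → ℝ} (hx : ∀ a, 0 ≤ x a) :
    ∑ a, Wt H ρ n x a ≤ 1 + 2 * off H x + 2 * Fintype.card G * ρ * off H x +
      Fintype.card G * (off H x ^ 2 + (n : ℝ)⁻¹) := by
  have hp := hcard_pos H
  have ht : 0 ≤ off H x := off_nonneg H hx
  rw [sum_split H]
  have e1 : ∑ a ∈ Finset.univ.filter (fun a => a ∈ H), Wt H ρ n x a = 1 := by
    rw [Finset.sum_congr rfl (g := fun _ => (Nat.card H : ℝ)⁻¹)]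
    · rw [Finset.sum_const, card_filter_H, nsmul_eq_mul, mul_inv_cancel₀ hp.ne']
    · intro a ha
      simp only [Wt, (Finset.mem_filter.1 ha).2, if_true]
  have e2 : off H (Wt H ρ n x) = 2 * ((Nat.card H : ℝ)⁻¹ + ρ) * (Nat.card H * off H x) +
      (Finset.univ.filter (fun a : G => a ∉ H)).card * (off H x ^ 2 + (n : ℝ)⁻¹) := by
    conv_lhs => unfold off
    rw [Finset.sum_congr rfl (g := fun a => 2 * ((Nat.card H : ℝ)⁻¹ + ρ) *
      (∑ b ∈ Finset.univ.filter (fun b => b ∈ H), x (-a - b)) + (off H x ^ 2 + (n : ℝ)⁻¹))]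
    · rw [Finset.sum_add_distrib, ← Finset.mul_sum, Finset.sum_comm, Finset.sum_const, nsmul_eq_mul]
      congr 2
      rw [Finset.sum_congr rfl (g := fun _ => off H x)]
      · rw [Finset.sum_const, card_filter_H, nsmul_eq_mul]
      · intro b hb
        exact sum_off_refl H x (Finset.mem_filter.1 hb).2
    · intro a ha
      simp only [Wt, (Finset.mem_filter.1 ha).2, if_false]
      ring
  have e3 : ((Finset.univ.filter (fun a : G => a ∉ H)).card : ℝ) ≤ Fintype.card G := by
    exact_mod_cast Finset.card_le_univ _
  have e4 : 2 * ((Nat.card H : ℝ)⁻¹ + ρ) * (Nat.card H * off H x) =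
      2 * off H x + 2 * Nat.card H * ρ * off H x := by
    field_simp
  have e5 := hcard_le H
  rw [e1, e2, e4]
  have e6 : ((Finset.univ.filter (fun a : G => a ∉ H)).card : ℝ) * (off H x ^ 2 + (n : ℝ)⁻¹) ≤
    Fintype.card G * (off H x ^ 2 + (n : ℝ)⁻¹) := mul_le_mul_of_nonneg_right e3 (by positivity)
  have e7 : 2 * (Nat.card H : ℝ) * ρ * off H x ≤ 2 * Fintype.card G * ρ * off H x := by
    gcongr
  linarith

/-- Comparison of the product with the weights. -/
lemma prod_le_Wt (hn : 0 < n) (H : AddSubgroup G) {ρ : ℝ} (hρ : 0 ≤ ρ) (q : Fin n → G)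
    (hN : Near H (nu q) ρ) :
    ∏ i, (cv (nu q) (q i) + if q i ∉ H then (n : ℝ)⁻¹ else 0) ≤
      Real.exp (-2 * KK H q + (3 + Fintype.card G) * ((KK H q : ℝ) ^ 2 / n) +
        (Fintype.card G : ℝ) ^ 3 * (n * ρ ^ 3)) * ∏ i, Wt H ρ n (nu q) (q i) := by
  have hn' : (0 : ℝ) < n := by exact_mod_cast hn
  have hp := hcard_pos H
  have hcv0 := cv_nonneg (nu_nonneg q)
  have hν1 := sum_nu hn q
  set ν := nu q with hν
  set t := off H ν with ht
  set h : ℝ := (Nat.card H : ℝ) with hh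
  have ht0 : 0 ≤ t := off_nonneg H (nu_nonneg q)
  set φ : G → ℝ := fun a => if a ∈ H then -2 * t + h * cv (eps H ν) a + h * t ^ 2 else 0 with hφ
  have key : ∀ a, cv ν a + (if a ∉ H then (n : ℝ)⁻¹ else 0) ≤ Wt H ρ n ν a * Real.exp (φ a) := by
    intro a
    by_cases ha : a ∈ H
    · simp only [ha, not_true_eq_false, if_false, add_zero, Wt, if_true, hφ]
      rw [cv_on H hν1 ha, ← hh, ← ht]
      have h1 := JJ_bound H (nu_nonneg q) a
      rw [← hν, ← ht] at h1
      have h2 := Real.add_one_le_exp (-2 * t + h * cv (eps H ν) a + h * t ^ 2)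
      calc _ ≤ h⁻¹ - 2 * t * h⁻¹ + cv (eps H ν) a + t ^ 2 := by linarith
        _ = h⁻¹ * (-2 * t + h * cv (eps H ν) a + h * t ^ 2 + 1) := by field_simp; ring
        _ ≤ _ := mul_le_mul_of_nonneg_left h2 (by positivity)
    · simp only [ha, not_false_eq_true, if_false, Wt, if_true, hφ, Real.exp_zero, mul_one]
      rw [cv_off H ν ha, ← hh, ← ht]
      have h1 := JJ_bound H (nu_nonneg q) a
      rw [← hν, ← ht] at h1
      have h2 : ∑ b ∈ Finset.univ.filter (fun b => b ∈ H), ν b * ν (-a - b) ≤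
          (h⁻¹ + ρ) * ∑ b ∈ Finset.univ.filter (fun b => b ∈ H), ν (-a - b) := by
        rw [Finset.mul_sum]
        refine Finset.sum_le_sum fun b hb => mul_le_mul_of_nonneg_right ?_ (nu_nonneg q _)
        have := (abs_le.1 (hN.1 b (Finset.mem_filter.1 hb).2)).2
        linarith
      linarith
  have h1 : ∏ i, (cv ν (q i) + if q i ∉ H then (n : ℝ)⁻¹ else 0) ≤
      ∏ i, (Wt H ρ n ν (q i) * Real.exp (φ (q i))) :=
    Finset.prod_le_prod (fun i _ => add_nonneg (hcv0 _) (by split_ifs <;> positivity))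
      (fun i _ => key _)
  refine h1.trans ?_
  rw [Finset.prod_mul_distrib, mul_comm, ← Real.exp_sum]
  refine mul_le_mul_of_nonneg_right (Real.exp_le_exp.2 ?_)
    (Finset.prod_nonneg fun i _ => Wt_nonneg H hρ n (nu_nonneg q) _)
  rw [sum_q q φ]
  have e1 : ∑ a, (cnt q a : ℝ) * φ a = n * ((-2 * t + h * t ^ 2) * (1 - t) +
      h * ∑ a, ν a * cv (eps H ν) a) := by
    have hs := sum_split H ν
    rw [← ht, hν1] at hs
    have hs' : 1 - t = ∑ a, if a ∈ H then ν a else 0 := by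
      rw [← Finset.sum_filter]; linarith
    rw [hs', Finset.mul_sum, Finset.mul_sum, ← Finset.sum_add_distrib, Finset.mul_sum]
    refine Finset.sum_congr rfl fun a _ => ?_
    rw [cnt_eq hn q a, ← hν]
    by_cases ha : a ∈ H
    · simp only [hφ, ha, if_true]; ring
    · simp only [hφ, ha, if_false]; rw [cv_eps_off H ν ha]; ring
  rw [e1]
  have e2 := sum_nu_cv_eps H hρ hN hν1
  rw [← ht, ← hh] at e2
  have hk := KK_eq hn H q
  rw [← hν, ← ht] at hk
  have hhg : h ≤ Fintype.card G := hcard_le H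
  have e3 : h * ∑ a, ν a * cv (eps H ν) a ≤ t ^ 2 + (Fintype.card G : ℝ) ^ 3 * ρ ^ 3 := by
    calc _ ≤ h * (t ^ 2 * h⁻¹ + (Fintype.card G : ℝ) ^ 2 * ρ ^ 3) :=
          mul_le_mul_of_nonneg_left e2 hp.le
      _ = t ^ 2 + h * ((Fintype.card G : ℝ) ^ 2 * ρ ^ 3) := by field_simp
      _ ≤ t ^ 2 + Fintype.card G * ((Fintype.card G : ℝ) ^ 2 * ρ ^ 3) := by gcongr
      _ = _ := by ring
  have e4 : (KK H q : ℝ) ^ 2 / n = n * t ^ 2 := by rw [hk]; field_simp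
  rw [e4, hk]
  have e5 : (-2 * t + h * t ^ 2) * (1 - t) ≤ -2 * t + (2 + Fintype.card G) * t ^ 2 := by
    have : 0 ≤ h * t ^ 3 := by positivity
    have : h * t ^ 2 ≤ Fintype.card G * t ^ 2 := by gcongr
    nlinarith
  calc _ ≤ n * ((-2 * t + (2 + Fintype.card G) * t ^ 2) +
        (t ^ 2 + (Fintype.card G : ℝ) ^ 3 * ρ ^ 3)) := by gcongr
    _ = _ := by ring

/-- Few outliers. -/
lemma bad3 (hodd : Odd (Fintype.card G)) (hn : 0 < n) (H : AddSubgroup G)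
    (S : Finset (Fin n → G)) {ρ M : ℝ} (hρ : 0 ≤ ρ) (L : ℕ) (hM : n * ρ ^ 3 ≤ M)
    (hL : (L : ℝ) ^ 2 ≤ n) (hLρ : L * ρ ≤ 1)
    (hS : ∀ q ∈ S, Near H (nu q) ρ) (hS2 : ∀ q ∈ S, KK H q ≤ L)
    (hS3 : ∀ q ∈ S, ∃ i, q i ∉ H) :
    ∑ q ∈ S, |FF q * dd (nu q)| ≤ ((L : ℝ) + 1) ^ Fintype.card G *
      (3 * CG G * Fintype.card G * ((L : ℝ) ^ 2 / n) *
        Real.exp (3 + 5 * Fintype.card G + (Fintype.card G : ℝ) ^ 3 * M)) := by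
  have hn' : (0 : ℝ) < n := by exact_mod_cast hn
  have hCG : 0 ≤ CG G := CG_nonneg
  refine type_sum S _ (fun q a => if a ∉ H then cnt q a else 0) L ?_ _ ?_
  · intro q hq a
    by_cases ha : a ∉ H
    · refine le_trans (le_of_eq (if_pos ha)) (le_trans ?_ (hS2 q hq))
      exact Finset.single_le_sum (f := cnt q) (fun b _ => Nat.zero_le _)
        (Finset.mem_filter.2 ⟨Finset.mem_univ _, ha⟩)
    · exact le_trans (le_of_eq (if_neg ha)) (Nat.zero_le _)
  intro τ
  set S' := S.filter (fun q => (fun a => if a ∉ H then cnt q a else 0) = τ) with hS'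
  rcases S'.eq_empty_or_nonempty with hE | ⟨q0, hq0⟩
  · rw [hE, Finset.sum_empty]; positivity
  have hνeq : ∀ q ∈ S', ∀ a, a ∉ H → nu q a = nu q0 a := by
    intro q hq a ha
    have e1 := congrFun (Finset.mem_filter.1 hq).2 a
    have e2 := congrFun (Finset.mem_filter.1 hq0).2 a
    simp only [ha, not_false_eq_true, if_true] at e1 e2
    unfold nu
    rw [e1, e2]
  have hoff : ∀ q ∈ S', off H (nu q) = off H (nu q0) := fun q hq =>
    Finset.sum_congr rfl fun a ha => hνeq q hq a (Finset.mem_filter.1 ha).2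
  have hW : ∀ q ∈ S', Wt H ρ n (nu q) = Wt H ρ n (nu q0) := by
    intro q hq
    funext a
    unfold Wt
    split_ifs with ha
    · rfl
    · rw [hoff q hq]
      congr 3
      refine Finset.sum_congr rfl fun b hb => hνeq q hq _ fun h => ha ?_
      have := H.neg_mem (H.add_mem h (Finset.mem_filter.1 hb).2)
      have e : -(-a - b + b) = a := by abel
      rwa [e] at this
  have hKeq : ∀ q ∈ S', (KK H q : ℝ) = KK H q0 := by
    intro q hq
    rw [KK_eq hn, KK_eq hn, hoff q hq]
  set k : ℝ := (KK H q0 : ℝ) with hk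
  set g : ℝ := (Fintype.card G : ℝ) with hg
  have hq0S := (Finset.mem_filter.1 hq0).1
  have hkL : k ≤ L := by
    rw [hk]; exact_mod_cast hS2 q0 hq0S
  have hk0 : 0 ≤ k := by rw [hk]; positivity
  have hg0 : 0 ≤ g := by rw [hg]; positivity
  have hk2 : k ^ 2 ≤ (L : ℝ) ^ 2 := by gcongr
  have hk2n : k ^ 2 / n ≤ 1 := by rw [div_le_one hn']; linarith
  set c1 : ℝ := 3 * CG G * g * ((L : ℝ) ^ 2 / n) with hc1
  set E1 : ℝ := -2 * k + (3 + g) + g ^ 3 * M with hE1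
  have hc10 : 0 ≤ c1 := by rw [hc1]; positivity
  have step : ∀ q ∈ S', |FF q * dd (nu q)| ≤ c1 * Real.exp E1 * ∏ i, Wt H ρ n (nu q0) (q i) := by
    intro q hq
    have hqS := (Finset.mem_filter.1 hq).1
    have l1 := ptw hodd hn H q (hS3 q hqS)
    have l2 := prod_le_Wt hn H hρ q (hS q hqS)
    rw [hW q hq, hKeq q hq] at l2
    rw [hKeq q hq] at l1
    have hprod : 0 ≤ ∏ i, Wt H ρ n (nu q0) (q i) :=
      Finset.prod_nonneg fun i _ => Wt_nonneg H hρ n (nu_nonneg q0) _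
    have l3 : Real.exp (-2 * k + (3 + g) * (k ^ 2 / n) + g ^ 3 * (n * ρ ^ 3)) ≤ Real.exp E1 := by
      apply Real.exp_le_exp.2
      have m1 : (3 + g) * (k ^ 2 / n) ≤ (3 + g) * 1 := by gcongr
      have m2 : g ^ 3 * (n * ρ ^ 3) ≤ g ^ 3 * M := by gcongr
      rw [hE1]; linarith
    have l4 : 3 * CG G * g * (k ^ 2 / n) ≤ c1 := by rw [hc1]; gcongr
    refine l1.trans ?_
    rw [mul_assoc c1]
    refine mul_le_mul l4 (l2.trans (mul_le_mul_of_nonneg_right l3 hprod)) ?_ hc10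
    refine Finset.prod_nonneg fun i _ => add_nonneg (cv_nonneg (nu_nonneg q) _) ?_
    split_ifs <;> positivity
  refine (Finset.sum_le_sum step).trans ?_
  rw [← Finset.mul_sum]
  have s1 : ∑ q ∈ S', ∏ i, Wt H ρ n (nu q0) (q i) ≤ (∑ a, Wt H ρ n (nu q0) a) ^ n := by
    rw [← sum_prod_W]
    refine Finset.sum_le_sum_of_subset_of_nonneg (Finset.subset_univ _) fun q _ _ => ?_
    exact Finset.prod_nonneg fun i _ => Wt_nonneg H hρ n (nu_nonneg q0) _
  have s2 : (∑ a, Wt H ρ n (nu q0) a) ^ n ≤ Real.exp (2 * k + 4 * g) := by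
    have m1 := sum_Wt H hρ n (nu_nonneg q0)
    set t := off H (nu q0) with ht
    have hkt : k = n * t := KK_eq hn H q0
    have m2 : ∑ a, Wt H ρ n (nu q0) a ≤
        Real.exp (2 * t + 2 * g * ρ * t + g * (t ^ 2 + (n : ℝ)⁻¹)) := by
      refine m1.trans ?_
      have := Real.add_one_le_exp (2 * t + 2 * g * ρ * t + g * (t ^ 2 + (n : ℝ)⁻¹))
      linarith
    refine (pow_le_pow_left₀ (Finset.sum_nonneg fun a _ =>
      Wt_nonneg H hρ n (nu_nonneg q0) a) m2 n).trans ?_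
    rw [← Real.exp_nat_mul]
    apply Real.exp_le_exp.2
    have m3 : (n : ℝ) * (2 * t + 2 * g * ρ * t + g * (t ^ 2 + (n : ℝ)⁻¹)) =
        2 * k + 2 * g * (k * ρ) + g * (k ^ 2 / n) + g := by
      rw [hkt]; field_simp; ring
    rw [m3]
    have m4 : k * ρ ≤ 1 := le_trans (by gcongr) hLρ
    have m5 : 2 * g * (k * ρ) ≤ 2 * g * 1 := by gcongr
    have m6 : g * (k ^ 2 / n) ≤ g * 1 := by gcongr
    linarith
  calc c1 * Real.exp E1 * ∑ q ∈ S', ∏ i, Wt H ρ n (nu q0) (q i)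
      ≤ c1 * Real.exp E1 * Real.exp (2 * k + 4 * g) :=
        mul_le_mul_of_nonneg_left (s1.trans s2) (by positivity)
    _ = c1 * Real.exp (3 + 5 * g + g ^ 3 * M) := by
        rw [mul_assoc, ← Real.exp_add]; congr 2; rw [hE1]; ring
    _ ≤ _ := le_refl _

end


section
variable {G : Type} [AddCommGroup G] [Fintype G] {n : ℕ}

lemma off_top (ν : G → ℝ) : off (⊤ : AddSubgroup G) ν = 0 := by
  simp [off]

lemma card_top_G : (Nat.card (⊤ : AddSubgroup G) : ℝ) = Fintype.card G := by
  rw [AddSubgroup.card_top, Nat.card_eq_fintype_card]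

lemma cv_top {ν : G → ℝ} (h1 : ∑ a, ν a = 1) (a : G) :
    cv ν a = (Fintype.card G : ℝ)⁻¹ + cv (eps (⊤ : AddSubgroup G) ν) a := by
  rw [cv_on (⊤ : AddSubgroup G) h1 (AddSubgroup.mem_top a), off_top, card_top_G]
  simp

lemma sum_nu_cv_top {ν : G → ℝ} {ρ : ℝ} (hρ : 0 ≤ ρ) (hN : Near (⊤ : AddSubgroup G) ν ρ)
    (h1 : ∑ a, ν a = 1) :
    |∑ a, ν a * cv (eps (⊤ : AddSubgroup G) ν) a| ≤ (Fintype.card G : ℝ) ^ 2 * ρ ^ 3 := by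
  have e : ∀ a, ν a * cv (eps (⊤ : AddSubgroup G) ν) a =
      (Nat.card (⊤ : AddSubgroup G) : ℝ)⁻¹ * cv (eps (⊤ : AddSubgroup G) ν) a +
      eps (⊤ : AddSubgroup G) ν a * cv (eps (⊤ : AddSubgroup G) ν) a := by
    intro a
    simp only [eps, AddSubgroup.mem_top, if_true]; ring
  rw [Finset.sum_congr rfl fun a _ => e a, Finset.sum_add_distrib, ← Finset.mul_sum, sum_cv_sq,
    sum_eps _ h1, off_top]
  simpa using sum_eps_cv_abs (⊤ : AddSubgroup G) hρ hN

lemma exp_le_one_add {x : ℝ} (hx : |x| ≤ 1 / 2) : Real.exp (x - 2 * x ^ 2) ≤ 1 + x := by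
  have h := abs_le.1 hx
  have hp : 0 < 1 + x := by linarith
  rw [← Real.le_log_iff_exp_le hp]
  refine le_trans ?_ (Real.one_sub_inv_le_log_of_pos hp)
  have : 1 - (1 + x)⁻¹ - (x - 2 * x ^ 2) = x ^ 2 * (1 + 2 * x) / (1 + x) := by
    field_simp; ring
  have h2 : 0 ≤ x ^ 2 * (1 + 2 * x) / (1 + x) :=
    div_nonneg (mul_nonneg (sq_nonneg _) (by linarith)) hp.le
  linarith

/-- Main term estimate. -/
lemma main_ptw (hn : 0 < n) {ρ : ℝ} (hρ : 0 ≤ ρ) (q : Fin n → G)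
    (hN : Near (⊤ : AddSubgroup G) (nu q) ρ) (hs : (Fintype.card G : ℝ) ^ 2 * ρ ^ 2 ≤ 1 / 2) :
    Real.exp (-((Fintype.card G : ℝ) ^ 3 * (n * ρ ^ 3) +
        2 * (Fintype.card G : ℝ) ^ 4 * (n * ρ ^ 4))) ≤ FF q * (Fintype.card G : ℝ) ^ n ∧
    FF q * (Fintype.card G : ℝ) ^ n ≤ Real.exp ((Fintype.card G : ℝ) ^ 3 * (n * ρ ^ 3) +
        2 * (Fintype.card G : ℝ) ^ 4 * (n * ρ ^ 4)) := by
  have hn' : (0 : ℝ) < n := by exact_mod_cast hn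
  have hg : (0 : ℝ) < Fintype.card G := by
    have : 0 < Fintype.card G := Fintype.card_pos
    exact_mod_cast this
  set g : ℝ := (Fintype.card G : ℝ) with hgdef
  have hν1 := sum_nu hn q
  set ν := nu q with hν
  set x : G → ℝ := fun a => g * cv (eps (⊤ : AddSubgroup G) ν) a with hx
  have hx1 : ∀ a, |x a| ≤ g ^ 2 * ρ ^ 2 := by
    intro a
    have := cv_eps_abs (⊤ : AddSubgroup G) hρ hN a
    rw [hx]
    dsimp only
    rw [abs_mul, abs_of_pos hg]
    calc _ ≤ g * (g * ρ ^ 2) := by gcongr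
      _ = _ := by ring
  have hFF : FF q * g ^ n = ∏ i, (1 + x (q i)) := by
    have : g ^ n = ∏ i : Fin n, g := by simp
    rw [this, FF, ← Finset.prod_mul_distrib]
    refine Finset.prod_congr rfl fun i _ => ?_
    rw [← hν, cv_top hν1, hx, ← hgdef]
    dsimp only
    field_simp
  have hsx : |∑ i, x (q i)| ≤ g ^ 3 * (n * ρ ^ 3) := by
    have e : ∑ i, x (q i) = g * n * ∑ a, ν a * cv (eps (⊤ : AddSubgroup G) ν) a := by
      rw [sum_q q x, Finset.mul_sum]
      refine Finset.sum_congr rfl fun a _ => ?_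
      rw [cnt_eq hn q a, ← hν, hx]
      ring
    rw [e, abs_mul, abs_of_pos (by positivity)]
    calc _ ≤ g * n * (g ^ 2 * ρ ^ 3) :=
          mul_le_mul_of_nonneg_left (sum_nu_cv_top hρ hN hν1) (by positivity)
      _ = _ := by ring
  have hsx2 : ∑ i, x (q i) ^ 2 ≤ g ^ 4 * (n * ρ ^ 4) := by
    refine (Finset.sum_le_card_nsmul _ _ ((g ^ 2 * ρ ^ 2) ^ 2) fun i _ => ?_).trans (le_of_eq ?_)
    · rw [← sq_abs]
      exact pow_le_pow_left₀ (abs_nonneg _) (hx1 _) 2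
    · rw [Finset.card_univ, Fintype.card_fin, nsmul_eq_mul]; ring
  have hab := abs_le.1 hsx
  rw [hFF]
  constructor
  · calc _ ≤ Real.exp (∑ i, (x (q i) - 2 * x (q i) ^ 2)) := by
          apply Real.exp_le_exp.2
          have e2 : ∑ i, 2 * x (q i) ^ 2 = 2 * ∑ i, x (q i) ^ 2 := (Finset.mul_sum _ _ _).symm
          rw [Finset.sum_sub_distrib, e2]
          linarith
      _ = ∏ i, Real.exp (x (q i) - 2 * x (q i) ^ 2) := Real.exp_sum _ _
      _ ≤ _ := Finset.prod_le_prod (fun i _ => (Real.exp_pos _).le)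
          (fun i _ => exp_le_one_add ((hx1 _).trans hs))
  · calc ∏ i, (1 + x (q i)) ≤ ∏ i, Real.exp (x (q i)) := by
          refine Finset.prod_le_prod (fun i _ => ?_) (fun i _ => ?_)
          · have := abs_le.1 ((hx1 (q i)).trans hs)
            linarith
          · have := Real.add_one_le_exp (x (q i))
            linarith
      _ = Real.exp (∑ i, x (q i)) := (Real.exp_sum _ _).symm
      _ ≤ _ := by
          apply Real.exp_le_exp.2
          have : 0 ≤ 2 * g ^ 4 * (n * ρ ^ 4) := by positivity
          linarith

/-- Typical configurations. -/
def TT (G : Type) [AddCommGroup G] [Fintype G] (n : ℕ) (ρ : ℝ) : Finset (Fin n → G) :=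
  Finset.univ.filter (fun q => Near (⊤ : AddSubgroup G) (nu q) ρ)

lemma TT_gen {ρ : ℝ} (hρ : ρ < (Fintype.card G : ℝ)⁻¹) {q : Fin n → G} (hq : q ∈ TT G n ρ) :
    Gen q := by
  apply gen_of_surj
  intro a
  apply exists_of_nu_pos
  have h := (Finset.mem_filter.1 hq).2.1 a (AddSubgroup.mem_top a)
  rw [card_top_G] at h
  have := (abs_le.1 h).1
  intro h0
  rw [h0] at this
  linarith

lemma TT_card (hn : 0 < n) {ρ : ℝ} (hρ : 0 ≤ ρ) :
    1 - ((n : ℝ) + 1) ^ Fintype.card G * Real.exp (-(n * ρ ^ 2 / 4)) ≤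
      (TT G n ρ).card * ((Fintype.card G : ℝ)⁻¹) ^ n ∧
    (TT G n ρ).card * ((Fintype.card G : ℝ)⁻¹) ^ n ≤ 1 := by
  have hg : (0 : ℝ) < Fintype.card G := by
    have : 0 < Fintype.card G := Fintype.card_pos
    exact_mod_cast this
  have h1 := conc hn (Finset.univ.filter (fun q : Fin n → G =>
    ¬ Near (⊤ : AddSubgroup G) (nu q) ρ)) ρ hρ (by
      intro q hq
      have h := (Finset.mem_filter.1 hq).2
      by_contra! hc
      apply h
      refine ⟨fun b _ => ?_, fun b hb => absurd (AddSubgroup.mem_top b) hb⟩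
      rw [card_top_G]
      exact (hc b).le)
  have h2 : ((TT G n ρ).card : ℝ) + ((Finset.univ.filter (fun q : Fin n → G =>
      ¬ Near (⊤ : AddSubgroup G) (nu q) ρ)).card : ℝ) = (Fintype.card G : ℝ) ^ n := by
    have := Finset.card_filter_add_card_filter_not (s := (Finset.univ : Finset (Fin n → G)))
      (fun q => Near (⊤ : AddSubgroup G) (nu q) ρ)
    rw [Finset.card_univ, Fintype.card_fun, Fintype.card_fin] at this
    unfold TT
    exact_mod_cast this
  have h3 : (Fintype.card G : ℝ) ^ n * ((Fintype.card G : ℝ)⁻¹) ^ n = 1 := by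
    rw [← mul_pow, mul_inv_cancel₀ hg.ne', one_pow]
  rw [← h2, add_mul] at h3
  constructor
  · linarith
  · have : (0 : ℝ) ≤ (Finset.univ.filter (fun q : Fin n → G =>
      ¬ Near (⊤ : AddSubgroup G) (nu q) ρ)).card * ((Fintype.card G : ℝ)⁻¹) ^ n := by positivity
    linarith

lemma main_bounds (hn : 0 < n) {ρ e δ κ : ℝ} (hρ : 0 ≤ ρ)
    (hs : (Fintype.card G : ℝ) ^ 2 * ρ ^ 2 ≤ 1 / 2) (he : e ≤ 1)
    (hd : ∀ ν : G → ℝ, (∀ a, |ν a - (Fintype.card G : ℝ)⁻¹| ≤ ρ) → |dd ν - 3| ≤ e)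
    (hδ : δ = (Fintype.card G : ℝ) ^ 3 * (n * ρ ^ 3) + 2 * (Fintype.card G : ℝ) ^ 4 * (n * ρ ^ 4))
    (hκ : κ = ((n : ℝ) + 1) ^ Fintype.card G * Real.exp (-(n * ρ ^ 2 / 4))) :
    Real.exp (-δ) * (3 - e) * (1 - κ) ≤ ∑ q ∈ TT G n ρ, FF q * dd (nu q) ∧
      ∑ q ∈ TT G n ρ, FF q * dd (nu q) ≤ Real.exp δ * (3 + e) := by
  have hg : (0 : ℝ) < Fintype.card G := by
    have : 0 < Fintype.card G := Fintype.card_pos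
    exact_mod_cast this
  obtain ⟨c1, c2⟩ := TT_card (G := G) hn hρ
  rw [← hκ] at c1
  have he0 : 0 ≤ e := (abs_nonneg _).trans (hd (fun _ => (Fintype.card G : ℝ)⁻¹) (by simpa using hρ))
  have hgn : (0 : ℝ) < ((Fintype.card G : ℝ)⁻¹) ^ n := by positivity
  have hFF : ∀ q : Fin n → G, FF q = FF q * (Fintype.card G : ℝ) ^ n *
      ((Fintype.card G : ℝ)⁻¹) ^ n := by
    intro q
    rw [mul_assoc, ← mul_pow, mul_inv_cancel₀ hg.ne', one_pow, mul_one]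
  have hb : ∀ q ∈ TT G n ρ, Real.exp (-δ) * (3 - e) * ((Fintype.card G : ℝ)⁻¹) ^ n ≤
      FF q * dd (nu q) ∧ FF q * dd (nu q) ≤
      Real.exp δ * (3 + e) * ((Fintype.card G : ℝ)⁻¹) ^ n := by
    intro q hq
    have hN := (Finset.mem_filter.1 hq).2
    obtain ⟨m1, m2⟩ := main_ptw hn hρ q hN hs
    rw [← hδ] at m1 m2
    have hdq := abs_le.1 (hd (nu q) (fun a => by
      have := hN.1 a (AddSubgroup.mem_top a)
      rwa [card_top_G] at this))
    have e1 : FF q * dd (nu q) = (FF q * (Fintype.card G : ℝ) ^ n) * dd (nu q) *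
        ((Fintype.card G : ℝ)⁻¹) ^ n := by
      conv_lhs => rw [hFF q]
      ring
    rw [e1]
    have p := Real.exp_pos (-δ)
    constructor
    · refine mul_le_mul_of_nonneg_right ?_ hgn.le
      exact mul_le_mul m1 (by linarith) (by linarith) (p.le.trans m1)
    · refine mul_le_mul_of_nonneg_right ?_ hgn.le
      exact mul_le_mul m2 (by linarith) (by linarith) (Real.exp_pos _).le
  constructor
  · calc _ ≤ Real.exp (-δ) * (3 - e) * ((TT G n ρ).card * ((Fintype.card G : ℝ)⁻¹) ^ n) :=
          mul_le_mul_of_nonneg_left c1 (mul_nonneg (Real.exp_pos _).le (by linarith))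
      _ = (TT G n ρ).card • (Real.exp (-δ) * (3 - e) * ((Fintype.card G : ℝ)⁻¹) ^ n) := by
          rw [nsmul_eq_mul]; ring
      _ ≤ _ := Finset.card_nsmul_le_sum _ _ _ fun q hq => (hb q hq).1
  · calc _ ≤ (TT G n ρ).card • (Real.exp δ * (3 + e) * ((Fintype.card G : ℝ)⁻¹) ^ n) :=
          Finset.sum_le_card_nsmul _ _ _ fun q hq => (hb q hq).2
      _ = Real.exp δ * (3 + e) * ((TT G n ρ).card * ((Fintype.card G : ℝ)⁻¹) ^ n) := by
          rw [nsmul_eq_mul]; ring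
      _ ≤ Real.exp δ * (3 + e) * 1 :=
          mul_le_mul_of_nonneg_left c2 (mul_nonneg (Real.exp_pos _).le (by linarith))
      _ = _ := mul_one _

lemma dd_near {e : ℝ} (he : 0 < e) : ∃ r > 0, ∀ ν : G → ℝ,
    (∀ a, |ν a - (Fintype.card G : ℝ)⁻¹| ≤ r) → |dd ν - 3| ≤ e := by
  have h := Metric.continuousAt_iff.1 (dd_cont (G := G)) e he
  obtain ⟨r, hr, h⟩ := h
  refine ⟨r / 2, by positivity, fun ν hν => ?_⟩
  have h2 := h (x := ν) (by
    rw [dist_pi_lt_iff hr]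
    intro a
    rw [Real.dist_eq]
    exact lt_of_le_of_lt (hν a) (by linarith))
  rw [dd_unif, Real.dist_eq] at h2
  exact h2.le

end


section
variable {G : Type} [AddCommGroup G] [Fintype G] {n : ℕ}

lemma sum_abs_le (S : Finset (Fin n → G)) :
    ∑ q ∈ S, |FF q * dd (nu q)| ≤ CG G * ∑ q ∈ S, FF q := by
  rw [Finset.mul_sum]
  refine Finset.sum_le_sum fun q _ => ?_
  rw [abs_mul, abs_of_nonneg (FF_nonneg q), mul_comm]
  exact mul_le_mul_of_nonneg_right (dd_bd (nu_nonneg q)) (FF_nonneg q)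

/-- The error term. -/
lemma err (hodd : Odd (Fintype.card G)) (h3 : Nat.Coprime (Fintype.card G) 3) (hn : 0 < n)
    {η ρ g : ℝ} (hη : 0 ≤ η) (hg : g = Fintype.card G) (hρ : ρ = 8 * g ^ 3 * η)
    (hsmall : 2 * g * ((2 * g + 1) * η) ≤ 1 / (2 * g)) (hgρ : g * ρ ≤ 1 / 10) (L : ℕ)
    (hM : n * ρ ^ 3 ≤ 1) (hL : (L : ℝ) ^ 2 ≤ n) (hLρ : L * ρ ≤ 1) (hρg : ρ < g⁻¹) :
    |∑ q ∈ Finset.univ.filter (fun q : Fin n → G => Gen q), FF q * dd (nu q) -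
      ∑ q ∈ TT G n ρ, FF q * dd (nu q)| ≤
    CG G * (((n : ℝ) + 1) ^ Fintype.card G * Real.exp (-(n * η ^ 2 / 4))) +
    (Nat.card (AddSubgroup G)) * (CG G * (((n : ℝ) + 1) ^ Fintype.card G *
        Real.exp (-(((L : ℝ) + 1) / 5))) +
      ((L : ℝ) + 1) ^ Fintype.card G * (3 * CG G * Fintype.card G * ((L : ℝ) ^ 2 / n) *
        Real.exp (3 + 5 * Fintype.card G + (Fintype.card G : ℝ) ^ 3 * 1))) := by
  have hg0 : 0 ≤ g := by rw [hg]; positivity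
  have hρ0 : 0 ≤ ρ := by rw [hρ]; positivity
  have hCG : 0 ≤ CG G := CG_nonneg
  let _ : Fintype (AddSubgroup G) := Fintype.ofFinite _
  set A := Finset.univ.filter (fun q : Fin n → G => Gen q) with hA
  have hsub : TT G n ρ ⊆ A := fun q hq =>
    Finset.mem_filter.2 ⟨Finset.mem_univ _, TT_gen (by rw [← hg]; exact hρg) hq⟩
  rw [← Finset.sum_sdiff hsub, add_sub_cancel_right]
  set U := A \ TT G n ρ with hU
  set U1 := U.filter (fun q => ∃ a, cv (nu q) a + η ≤ nu q a) with hU1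
  let U2 : AddSubgroup G → Finset (Fin n → G) := fun H =>
    U.filter (fun q => Near H (nu q) ρ ∧ (L : ℝ) + 1 ≤ KK H q)
  let U3 : AddSubgroup G → Finset (Fin n → G) := fun H =>
    U.filter (fun q => Near H (nu q) ρ ∧ KK H q ≤ L ∧ ∃ i, q i ∉ H)
  set F : (Fin n → G) → ℝ := fun q => |FF q * dd (nu q)| with hF
  have hF0 : ∀ q, 0 ≤ F q := fun q => abs_nonneg _
  refine (Finset.abs_sum_le_sum_abs _ _).trans ?_
  have cover : U ⊆ U1 ∪ Finset.univ.biUnion (fun H => U2 H ∪ U3 H) := by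
    intro q hq
    rw [Finset.mem_union]
    by_cases h1 : ∃ a, cv (nu q) a + η ≤ nu q a
    · exact Or.inl (Finset.mem_filter.2 ⟨hq, h1⟩)
    right
    push Not at h1
    obtain ⟨H, hH⟩ := dichotomy h3 (nu_nonneg q) (sum_nu hn q) hη g hg hsmall
      (fun a => (h1 a).le)
    rw [← hρ] at hH
    rw [Finset.mem_biUnion]
    refine ⟨H, Finset.mem_univ _, ?_⟩
    rw [Finset.mem_union]
    by_cases hK : KK H q ≤ L
    · right
      refine Finset.mem_filter.2 ⟨hq, hH, hK, ?_⟩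
      obtain ⟨hqA, hqT⟩ := Finset.mem_sdiff.1 hq
      refine gen_exists (Finset.mem_filter.1 hqA).2 H ?_
      rintro rfl
      exact hqT (Finset.mem_filter.2 ⟨Finset.mem_univ _, hH⟩)
    · left
      refine Finset.mem_filter.2 ⟨hq, hH, ?_⟩
      have : L + 1 ≤ KK H q := by omega
      exact_mod_cast this
  have hun : ∀ s t : Finset (Fin n → G), ∑ q ∈ s ∪ t, F q ≤ ∑ q ∈ s, F q + ∑ q ∈ t, F q := by
    intro s t
    have := Finset.sum_union_inter (s₁ := s) (s₂ := t) (f := F)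
    have h0 : 0 ≤ ∑ q ∈ s ∩ t, F q := Finset.sum_nonneg fun q _ => hF0 q
    linarith
  have b1 : ∑ q ∈ U1, F q ≤ CG G * (((n : ℝ) + 1) ^ Fintype.card G *
      Real.exp (-(n * η ^ 2 / 4))) :=
    (sum_abs_le U1).trans (mul_le_mul_of_nonneg_left
      (bad1 hn U1 η hη fun q hq => (Finset.mem_filter.1 hq).2) hCG)
  have b2 : ∀ H, ∑ q ∈ U2 H, F q ≤ CG G * (((n : ℝ) + 1) ^ Fintype.card G *
        Real.exp (-(((L : ℝ) + 1) / 5))) := by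
    intro H
    refine (sum_abs_le (U2 H)).trans (mul_le_mul_of_nonneg_left
      (bad2 hn H (U2 H) (L + 1) ?_ fun q hq => (Finset.mem_filter.1 hq).2.2) hCG)
    intro q hq
    have hN := (Finset.mem_filter.1 hq).2.1
    refine le_trans ?_ hgρ
    unfold off
    refine (Finset.sum_le_card_nsmul _ _ ρ fun a ha => hN.2 a (Finset.mem_filter.1 ha).2).trans ?_
    rw [nsmul_eq_mul, hg]
    refine mul_le_mul_of_nonneg_right ?_ hρ0
    exact_mod_cast Finset.card_le_univ _
  have b3 : ∀ H, ∑ q ∈ U3 H, F q ≤ ((L : ℝ) + 1) ^ Fintype.card G *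
      (3 * CG G * Fintype.card G * ((L : ℝ) ^ 2 / n) *
        Real.exp (3 + 5 * Fintype.card G + (Fintype.card G : ℝ) ^ 3 * 1)) := by
    intro H
    exact bad3 hodd hn H (U3 H) hρ0 L hM hL hLρ (fun q hq => (Finset.mem_filter.1 hq).2.1)
      (fun q hq => (Finset.mem_filter.1 hq).2.2.1) (fun q hq => (Finset.mem_filter.1 hq).2.2.2)
  refine (Finset.sum_le_sum_of_subset_of_nonneg cover fun q _ _ => hF0 q).trans ?_
  refine (hun _ _).trans (add_le_add b1 ?_)
  have hbi : ∑ q ∈ Finset.univ.biUnion (fun H => U2 H ∪ U3 H), F q ≤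
      ∑ H : AddSubgroup G, ∑ q ∈ U2 H ∪ U3 H, F q := by
    induction (Finset.univ : Finset (AddSubgroup G)) using Finset.induction_on with
    | empty => simp
    | insert H s hs ih =>
      rw [Finset.biUnion_insert, Finset.sum_insert hs]
      exact (hun _ _).trans (add_le_add le_rfl ih)
  refine hbi.trans ?_
  refine (Finset.sum_le_card_nsmul _ _ _ fun H _ => (hun _ _).trans
    (add_le_add (b2 H) (b3 H))).trans (le_of_eq ?_)
  rw [nsmul_eq_mul, Finset.card_univ, Nat.card_eq_fintype_card]

lemma expr_eq (hn : 0 < n) :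
    (1 / ((3 : ℝ) ^ (n + 1) * (n : ℝ) ^ (2 * n))) *
          ∑ K ∈ Finset.univ.filter
              (fun K : Finset (Fin n × Fin n × Fin n) => K.card = n ∧ subdet n K ≠ 0),
            (subdet n K : ℝ) ^ 2 * (numSur (cokK n K) G : ℝ) =
    1 / 3 * ∑ q ∈ Finset.univ.filter (fun q : Fin n → G => Gen q), FF q * dd (nu q) := by
  have hn' : (0 : ℝ) < n := by exact_mod_cast hn
  rw [reduction, Finset.sum_congr rfl fun q _ => det_formula hn q, ← Finset.mul_sum]
  have : (3 * (n : ℝ) ^ 2) ^ n = 3 ^ n * (n : ℝ) ^ (2 * n) := by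
    rw [mul_pow, pow_mul]
  rw [this, pow_succ]
  unfold FF
  field_simp

/-- Polynomial times stretched exponential. -/
lemma poly_exp (m : ℕ) {α c : ℝ} (hα : 0 < α) (hc : 0 < c) :
    Tendsto (fun n : ℕ => ((n : ℝ) + 1) ^ m * Real.exp (-(c * (n : ℝ) ^ α))) atTop (nhds 0) := by
  have hx : Tendsto (fun n : ℕ => (n : ℝ) ^ α) atTop atTop :=
    (tendsto_rpow_atTop hα).comp tendsto_natCast_atTop_atTop
  have h1 := ((tendsto_rpow_mul_exp_neg_mul_atTop_nhds_zero (m / α) c hc).comp hx).const_mul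
    ((2 : ℝ) ^ m)
  rw [mul_zero] at h1
  refine squeeze_zero' (Eventually.of_forall fun n => by positivity) ?_ h1
  filter_upwards [eventually_ge_atTop 1] with n hn
  have hn' : (1 : ℝ) ≤ n := by exact_mod_cast hn
  simp only [Function.comp]
  rw [← Real.rpow_mul (by linarith), mul_div_cancel₀ _ hα.ne', Real.rpow_natCast, ← mul_assoc,
    ← mul_pow, neg_mul]
  gcongr
  linarith

lemma pow_zero_lim {β : ℝ} (hβ : β < 0) :
    Tendsto (fun n : ℕ => (n : ℝ) ^ β) atTop (nhds 0) := by
  have := (tendsto_rpow_neg_atTop (y := -β) (by linarith)).comp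
    (tendsto_natCast_atTop_atTop (R := ℝ))
  simpa [Function.comp_def] using this

end


section
variable {G : Type} [AddCommGroup G] [Fintype G]

lemma npow (c : ℝ) (k : ℕ) {n : ℕ} (hn : 0 < n) :
    (n : ℝ) * (c * (n : ℝ) ^ (-(2 / 5) : ℝ)) ^ k = c ^ k * (n : ℝ) ^ (1 - 2 / 5 * k : ℝ) := by
  have hn' : (0 : ℝ) < n := by exact_mod_cast hn
  rw [mul_pow, ← Real.rpow_mul_natCast hn'.le, sub_eq_add_neg, Real.rpow_add hn', Real.rpow_one]
  rw [neg_mul]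
  ring

lemma npow_lim (c : ℝ) (k : ℕ) (hk : 3 ≤ k) :
    Tendsto (fun n : ℕ => (n : ℝ) * (c * (n : ℝ) ^ (-(2 / 5) : ℝ)) ^ k) atTop (nhds 0) := by
  have hk' : (3 : ℝ) ≤ k := by exact_mod_cast hk
  have h := (pow_zero_lim (β := 1 - 2 / 5 * k) (by linarith)).const_mul (c ^ k)
  rw [mul_zero] at h
  refine h.congr' ?_
  filter_upwards [eventually_gt_atTop 0] with n hn
  exact (npow c k hn).symm

lemma poly_exp2 (m : ℕ) {c : ℝ} (hc : 0 < c) :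
    Tendsto (fun n : ℕ => ((n : ℝ) + 1) ^ m *
      Real.exp (-(n * (c * (n : ℝ) ^ (-(2 / 5) : ℝ)) ^ 2 / 4))) atTop (nhds 0) := by
  have h := poly_exp m (α := 1 / 5) (c := c ^ 2 / 4) (by norm_num) (by positivity)
  refine h.congr' ?_
  filter_upwards [eventually_gt_atTop 0] with n hn
  rw [npow c 2 hn]
  congr 3
  norm_num
  ring

lemma main_lim {c : ℝ} (hc : 0 < c) :
    Tendsto (fun n : ℕ => ∑ q ∈ TT G n (c * (n : ℝ) ^ (-(2 / 5) : ℝ)), FF q * dd (nu q)) atTop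
      (nhds 3) := by
  set ρ : ℕ → ℝ := fun n => c * (n : ℝ) ^ (-(2 / 5) : ℝ) with hρ
  have hρ0 : ∀ n, 0 ≤ ρ n := fun n => by rw [hρ]; positivity
  have hρl : Tendsto ρ atTop (nhds 0) := by
    have := (pow_zero_lim (β := -(2 / 5)) (by norm_num)).const_mul c
    rwa [mul_zero] at this
  set g : ℝ := (Fintype.card G : ℝ) with hg
  set δ : ℕ → ℝ := fun n => g ^ 3 * (n * ρ n ^ 3) + 2 * g ^ 4 * (n * ρ n ^ 4) with hδ
  set κ : ℕ → ℝ := fun n => ((n : ℝ) + 1) ^ Fintype.card G * Real.exp (-(n * ρ n ^ 2 / 4)) with hκ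
  have hδl : Tendsto δ atTop (nhds 0) := by
    have := ((npow_lim c 3 le_rfl).const_mul (g ^ 3)).add
      ((npow_lim c 4 (by norm_num)).const_mul (2 * g ^ 4))
    simpa using this
  have hκl : Tendsto κ atTop (nhds 0) := poly_exp2 _ hc
  have hsl : ∀ᶠ n in atTop, g ^ 2 * ρ n ^ 2 ≤ 1 / 2 := by
    have : Tendsto (fun n => g ^ 2 * ρ n ^ 2) atTop (nhds 0) := by
      simpa using (hρl.pow 2).const_mul (g ^ 2)
    exact this.eventually_le_const (by norm_num)
  have key : ∀ e : ℝ, 0 < e → e ≤ 1 → ∀ᶠ n in atTop,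
      Real.exp (-δ n) * (3 - e) * (1 - κ n) ≤ ∑ q ∈ TT G n (ρ n), FF q * dd (nu q) ∧
      ∑ q ∈ TT G n (ρ n), FF q * dd (nu q) ≤ Real.exp (δ n) * (3 + e) := by
    intro e he he1
    obtain ⟨r, hr, hd⟩ := dd_near (G := G) he
    filter_upwards [hsl, hρl.eventually_le_const hr, eventually_gt_atTop 0] with n h1 h2 h3
    exact main_bounds h3 (hρ0 n) h1 he1 (fun ν hν => hd ν fun a => (hν a).trans h2) rfl rfl
  have hup : ∀ e : ℝ, Tendsto (fun n => Real.exp (δ n) * (3 + e)) atTop (nhds (3 + e)) := by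
    intro e
    have := (hδl.rexp).mul_const (3 + e)
    simpa using this
  have hlo : ∀ e : ℝ, Tendsto (fun n => Real.exp (-δ n) * (3 - e) * (1 - κ n)) atTop
      (nhds (3 - e)) := by
    intro e
    have := ((hδl.neg.rexp).mul_const (3 - e)).mul ((tendsto_const_nhds (x := (1 : ℝ))).sub hκl)
    simpa using this
  rw [tendsto_order]
  constructor
  · intro a ha
    set e := min 1 ((3 - a) / 2) with he
    have he0 : 0 < e := lt_min one_pos (by linarith)
    have he2 : e ≤ (3 - a) / 2 := min_le_right _ _
    filter_upwards [key e he0 (min_le_left _ _), (hlo e).eventually_const_lt (u := a) (by linarith)]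
      with n h1 h2
    exact lt_of_lt_of_le h2 h1.1
  · intro a ha
    set e := min 1 ((a - 3) / 2) with he
    have he0 : 0 < e := lt_min one_pos (by linarith)
    have he2 : e ≤ (a - 3) / 2 := min_le_right _ _
    filter_upwards [key e he0 (min_le_left _ _), (hup e).eventually_lt_const (u := a) (by linarith)]
      with n h1 h2
    exact lt_of_le_of_lt h1.2 h2

lemma err_lim (hodd : Odd (Fintype.card G)) (h3 : Nat.Coprime (Fintype.card G) 3) :
    Tendsto (fun n : ℕ => ∑ q ∈ Finset.univ.filter (fun q : Fin n → G => Gen q), FF q * dd (nu q) -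
      ∑ q ∈ TT G n (8 * (Fintype.card G : ℝ) ^ 3 * (n : ℝ) ^ (-(2 / 5) : ℝ)), FF q * dd (nu q))
      atTop (nhds 0) := by
  have hg1 : (1 : ℝ) ≤ Fintype.card G := by
    have : 0 < Fintype.card G := Fintype.card_pos
    exact_mod_cast this
  set m : ℕ := Fintype.card G with hm
  set g : ℝ := (m : ℝ) with hg
  have hg0 : 0 < g := by linarith
  set c : ℝ := 8 * g ^ 3 with hc
  have hc0 : 0 < c := by positivity
  set η : ℕ → ℝ := fun n => (n : ℝ) ^ (-(2 / 5) : ℝ) with hη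
  set ρ : ℕ → ℝ := fun n => c * η n with hρ
  have hηl : Tendsto η atTop (nhds 0) := pow_zero_lim (by norm_num)
  have hη0 : ∀ n, 0 ≤ η n := fun n => by rw [hη]; positivity
  have hρl : Tendsto ρ atTop (nhds 0) := by
    simpa using hηl.const_mul c
  set s : ℝ := 1 / (2 * (g + 4)) with hs
  have hs0 : 0 < s := by positivity
  have hs1 : s ≤ 1 / 10 := by
    rw [hs]; apply one_div_le_one_div_of_le <;> linarith
  have hsg : s * (g + 2) - 1 < 0 := by
    have : s * (g + 4) = 1 / 2 := by rw [hs]; field_simp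
    nlinarith
  set L : ℕ → ℕ := fun n => ⌊(n : ℝ) ^ s⌋₊ with hL
  have hLle : ∀ n : ℕ, (L n : ℝ) ≤ (n : ℝ) ^ s := fun n => Nat.floor_le (by positivity)
  have hLlt : ∀ n : ℕ, (n : ℝ) ^ s ≤ (L n : ℝ) + 1 := fun n => (Nat.lt_floor_add_one _).le
  set c3 : ℝ := 3 * CG G * m * Real.exp (3 + 5 * m + (m : ℝ) ^ 3 * 1) with hc3
  have t1 : Tendsto (fun n : ℕ => CG G * (((n : ℝ) + 1) ^ m * Real.exp (-(n * η n ^ 2 / 4)))) atTop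
      (nhds 0) := by
    have := (poly_exp2 m one_pos).const_mul (CG G)
    simpa using this
  have t2 : Tendsto (fun n : ℕ => ((n : ℝ) + 1) ^ m * Real.exp (-(((L n : ℝ) + 1) / 5))) atTop
      (nhds 0) := by
    refine squeeze_zero (fun n => by positivity) (fun n => ?_)
      (poly_exp m hs0 (c := 1 / 5) (by norm_num))
    gcongr
    have := hLlt n
    linarith
  have t3 : Tendsto (fun n : ℕ => ((L n : ℝ) + 1) ^ m * ((L n : ℝ) ^ 2 / n)) atTop (nhds 0) := by
    have h := (pow_zero_lim hsg).const_mul ((2 : ℝ) ^ m)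
    rw [mul_zero] at h
    refine squeeze_zero' (Eventually.of_forall fun n => by positivity) ?_ h
    filter_upwards [eventually_ge_atTop 1] with n hn
    have hn' : (1 : ℝ) ≤ n := by exact_mod_cast hn
    have hn0 : (0 : ℝ) < n := by linarith
    have h1 : (1 : ℝ) ≤ (n : ℝ) ^ s := Real.one_le_rpow hn' hs0.le
    have e : (n : ℝ) ^ (s * (g + 2) - 1) = ((n : ℝ) ^ s) ^ m * (((n : ℝ) ^ s) ^ 2 / n) := by
      rw [Real.rpow_sub hn0, Real.rpow_one, mul_add, Real.rpow_add hn0, hg, Real.rpow_mul_natCast hn0.le,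
        Real.rpow_mul hn0.le, Real.rpow_two]
      ring
    rw [e, ← mul_assoc, ← mul_pow]
    have := hLle n
    gcongr
    linarith
  have hE : Tendsto (fun n : ℕ => CG G * (((n : ℝ) + 1) ^ m * Real.exp (-(n * η n ^ 2 / 4))) +
    (Nat.card (AddSubgroup G)) * (CG G * (((n : ℝ) + 1) ^ m *
        Real.exp (-(((L n : ℝ) + 1) / 5))) +
      ((L n : ℝ) + 1) ^ m * (3 * CG G * m * ((L n : ℝ) ^ 2 / n) *
        Real.exp (3 + 5 * m + (m : ℝ) ^ 3 * 1)))) atTop (nhds 0) := by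
    have := t1.add (((t2.const_mul (CG G)).add (t3.const_mul c3)).const_mul
      (Nat.card (AddSubgroup G) : ℝ))
    simp only [mul_zero, add_zero] at this
    refine this.congr fun n => ?_
    rw [hc3]
    ring
  refine squeeze_zero_norm' ?_ hE
  have ev1 : ∀ᶠ n in atTop, 2 * g * ((2 * g + 1) * η n) ≤ 1 / (2 * g) := by
    have : Tendsto (fun n => 2 * g * ((2 * g + 1) * η n)) atTop (nhds 0) := by
      simpa using (hηl.const_mul (2 * g + 1)).const_mul (2 * g)
    exact this.eventually_le_const (by positivity)
  have ev2 : ∀ᶠ n in atTop, g * ρ n ≤ 1 / 10 := by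
    have : Tendsto (fun n => g * ρ n) atTop (nhds 0) := by
      simpa using hρl.const_mul g
    exact this.eventually_le_const (by norm_num)
  have ev3 : ∀ᶠ n : ℕ in atTop, n * ρ n ^ 3 ≤ 1 :=
    (npow_lim c 3 le_rfl).eventually_le_const one_pos
  have ev4 : ∀ᶠ n : ℕ in atTop, (L n : ℝ) * ρ n ≤ 1 := by
    have h := (pow_zero_lim (β := s + -(2 / 5)) (by linarith)).const_mul c
    rw [mul_zero] at h
    filter_upwards [h.eventually_le_const one_pos, eventually_gt_atTop 0] with n hn hn0
    have hn' : (0 : ℝ) < n := by exact_mod_cast hn0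
    refine le_trans ?_ hn
    rw [Real.rpow_add hn']
    have h1 := hLle n
    have h2 : 0 ≤ ρ n := mul_nonneg hc0.le (hη0 n)
    calc _ ≤ (n : ℝ) ^ s * ρ n := mul_le_mul_of_nonneg_right h1 h2
      _ = _ := by rw [hρ, hη]; ring
  have ev5 : ∀ᶠ n in atTop, ρ n < g⁻¹ := hρl.eventually_lt_const (by positivity)
  filter_upwards [ev1, ev2, ev3, ev4, ev5, eventually_ge_atTop 1] with n h1 h2 h4 h5 h6 hn
  have hn' : (1 : ℝ) ≤ n := by exact_mod_cast hn
  have hL2 : (L n : ℝ) ^ 2 ≤ n := by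
    calc (L n : ℝ) ^ 2 ≤ ((n : ℝ) ^ s) ^ 2 := by
          have := hLle n
          gcongr
      _ = (n : ℝ) ^ (s * (2 : ℕ)) := (Real.rpow_mul_natCast (by linarith) s 2).symm
      _ ≤ (n : ℝ) ^ (1 : ℝ) := Real.rpow_le_rpow_of_exponent_le hn' (by push_cast; linarith)
      _ = n := Real.rpow_one _
  rw [Real.norm_eq_abs]
  exact err hodd h3 hn (hη0 n) rfl rfl h1 h2 (L n) h4 hL2 h5 h6

end

/-- **Theorem 2.** For a finite abelian group `G` with `|G|` coprime to `6`, the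
determinantally weighted average number of surjections from the cokernel onto `G`
tends to `1`. -/
theorem moments_cokernel
    (G : Type) [AddCommGroup G] [Fintype G] (hG : Nat.Coprime (Nat.card G) 6) :
    Tendsto
      (fun n : ℕ =>
        (1 / ((3 : ℝ) ^ (n + 1) * (n : ℝ) ^ (2 * n))) *
          ∑ K ∈ Finset.univ.filter
              (fun K : Finset (Fin n × Fin n × Fin n) => K.card = n ∧ subdet n K ≠ 0),
            (subdet n K : ℝ) ^ 2 * (numSur (cokK n K) G : ℝ))
      atTop (nhds 1) := by
  rw [Nat.card_eq_fintype_card] at hG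
  have h2 : Nat.Coprime (Fintype.card G) 2 := Nat.Coprime.coprime_dvd_right (by norm_num) hG
  have h3 : Nat.Coprime (Fintype.card G) 3 := Nat.Coprime.coprime_dvd_right (by norm_num) hG
  have hodd : Odd (Fintype.card G) := Nat.coprime_two_right.1 h2
  have hg : (0 : ℝ) < Fintype.card G := by
    have : 0 < Fintype.card G := Fintype.card_pos
    exact_mod_cast this
  have hA := main_lim (G := G) (c := 8 * (Fintype.card G : ℝ) ^ 3) (by positivity)
  have hE := err_lim hodd h3
  have hS := ((hE.add hA).const_mul (1 / 3 : ℝ))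
  have e : (1 / 3 : ℝ) * (0 + 3) = 1 := by norm_num
  rw [e] at hS
  refine hS.congr' ?_
  filter_upwards [eventually_gt_atTop 0] with n hn
  rw [expr_eq hn, sub_add_cancel]
end
end

section
/- liminf_{n→∞} (1/(3^{n+1} n^{2n})) · ∑_K det(B_n[K])² · |Sur(cok(B_n[K]), ℤ/2ℤ)| ≥ 1 + 4e^{−2}, where the sum is over all n-element subsets K of [n]³ with det(B_n[K]) ≠ 0 and Sur(A, G) denotes the set of surjective group homomorphisms from A to G. In particular, the conclusion of the moment theorem (limit equal to 1) fails for G = ℤ/2ℤ. -/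
open scoped Classical

noncomputable section

open CLPaper Filter

namespace CLAux

open Matrix

/-- Determinant of the rows of `A` indexed by `K`. -/
def gsub {n : ℕ} {R : Type} [Fintype R] (A : Matrix R (Fin n) ℤ) (K : Finset R) : ℤ :=
  if h : K.card = n then
    (A.submatrix (fun i : Fin n => ((K.equivFin.symm (Fin.cast h.symm i)) : R)) id).det
  else 0

theorem det_gram_expand {n : ℕ} {R : Type} [Fintype R] (A : Matrix R (Fin n) ℤ) :
    (Aᵀ * A).det = ∑ φ : Fin n → R, (∏ i, A (φ i) i) * (A.submatrix φ id).det := by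
  rw [det_apply']
  have h1 : ∀ σ : Equiv.Perm (Fin n), ∏ i, (Aᵀ * A) (σ i) i =
      ∑ φ : Fin n → R, ∏ i, (A (φ i) (σ i) * A (φ i) i) := by
    intro σ
    simp only [mul_apply, transpose_apply]
    rw [Finset.prod_univ_sum]
    simp [Fintype.piFinset_univ]
  simp_rw [h1, Finset.mul_sum]
  rw [Finset.sum_comm]
  refine Finset.sum_congr rfl fun φ _ => ?_
  rw [← det_transpose (A.submatrix φ id), det_apply', Finset.mul_sum]
  refine Finset.sum_congr rfl fun σ _ => ?_
  simp only [transpose_apply, submatrix_apply, id, Finset.prod_mul_distrib]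
  ring

theorem cauchy_binet {n : ℕ} {R : Type} [Fintype R] (A : Matrix R (Fin n) ℤ) :
    (Aᵀ * A).det = ∑ K : Finset R, (gsub A K) ^ 2 := by
  rw [det_gram_expand, ← Finset.sum_fiberwise (s := Finset.univ)
    (g := fun φ : Fin n → R => Finset.univ.image φ)]
  refine Finset.sum_congr rfl fun K _ => ?_
  by_cases h : K.card = n
  · rw [gsub, dif_pos h]
    set e : Fin n → R := fun i => ((K.equivFin.symm (Fin.cast h.symm i)) : R) with he
    have heinj : Function.Injective e := by
      intro a b hab
      have := K.equivFin.symm.injective (Subtype.ext hab)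
      simpa [Fin.ext_iff] using this
    have heK : ∀ i, e i ∈ K := fun i => (K.equivFin.symm _).2
    have hesurj : ∀ x ∈ K, ∃ i, e i = x := by
      intro x hx
      refine ⟨Fin.cast h (K.equivFin ⟨x, hx⟩), ?_⟩
      simp [he]
    have key : ∑ τ : Equiv.Perm (Fin n), (∏ i, A (e (τ i)) i) *
        (A.submatrix (fun i => e (τ i)) id).det =
        ∑ φ : Fin n → R with Finset.univ.image φ = K,
          (∏ i, A (φ i) i) * (A.submatrix φ id).det := by
      refine Finset.sum_bij (fun τ _ => fun i => e (τ i)) ?_ ?_ ?_ ?_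
      · intro τ _
        simp only [Finset.mem_filter, Finset.mem_univ, true_and]
        ext x
        simp only [Finset.mem_image, Finset.mem_univ, true_and]
        constructor
        · rintro ⟨i, rfl⟩; exact heK _
        · intro hx
          obtain ⟨i, rfl⟩ := hesurj x hx
          exact ⟨τ.symm i, by simp⟩
      · intro τ _ τ' _ hh
        ext i
        exact congrArg Fin.val (heinj (congrFun hh i))
      · intro φ hφ
        simp only [Finset.mem_filter, Finset.mem_univ, true_and] at hφ
        have hmem : ∀ i, φ i ∈ K := fun i => by
          rw [← hφ]; exact Finset.mem_image_of_mem _ (Finset.mem_univ _)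
        choose t ht using fun i => hesurj (φ i) (hmem i)
        have hts : Function.Surjective t := by
          intro j
          have := heK j
          rw [← hφ] at this
          obtain ⟨i, _, hi⟩ := Finset.mem_image.1 this
          exact ⟨i, heinj (by rw [ht, hi])⟩
        have htb : Function.Bijective t := ⟨Finite.injective_iff_surjective.2 hts, hts⟩
        exact ⟨Equiv.ofBijective t htb, Finset.mem_univ _, funext fun i => by simp [ht]⟩
      · intro τ _; rfl
    rw [← key]
    have hperm : ∀ τ : Equiv.Perm (Fin n), (A.submatrix (fun i => e (τ i)) id).det =
        (Equiv.Perm.sign τ : ℤ) * (A.submatrix e id).det := by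
      intro τ
      have := det_permute τ (A.submatrix e id)
      simp only [submatrix_submatrix, Int.cast_id] at this
      exact this
    simp_rw [hperm]
    rw [sq]
    nth_rewrite 2 [det_apply']
    rw [Finset.sum_mul]
    refine Finset.sum_congr rfl fun τ _ => ?_
    simp only [submatrix_apply, id, Int.cast_id]
    ring
  · rw [gsub, dif_neg h]
    rw [Finset.sum_eq_zero]
    · simp
    · intro φ hφ
      simp only [Finset.mem_filter, Finset.mem_univ, true_and] at hφ
      have : ¬ Function.Injective φ := by
        intro hi
        apply h
        rw [← hφ, Finset.card_image_of_injective _ hi]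
        simp
      simp only [Function.Injective, not_forall] at this
      obtain ⟨a, b, hab, hne⟩ := this
      rw [det_zero_of_row_eq hne (by ext j; simp [hab]), mul_zero]

theorem gsub_B (n : ℕ) (K : Finset (Fin n × Fin n × Fin n)) : gsub (B n) K = subdet n K := rfl

/-- `B n` with the rows of odd weight on `S` replaced by zero. -/
def BS (n : ℕ) (S : Finset (Fin n)) : Matrix (Fin n × Fin n × Fin n) (Fin n) ℤ :=
  fun x j => if (2 : ℤ) ∣ ∑ i ∈ S, B n x i then B n x j else 0

theorem gsub_BS (n : ℕ) (S : Finset (Fin n)) (K : Finset (Fin n × Fin n × Fin n)) :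
    gsub (BS n S) K = if ∀ x ∈ K, (2 : ℤ) ∣ ∑ i ∈ S, B n x i then subdet n K else 0 := by
  by_cases h : K.card = n
  · split_ifs with hK
    · rw [← gsub_B, gsub, gsub, dif_pos h, dif_pos h]
      congr 1
      ext i j
      simp only [submatrix_apply, BS]
      rw [if_pos (hK _ (K.equivFin.symm _).2)]
    · push Not at hK
      obtain ⟨x, hx, hx2⟩ := hK
      rw [gsub, dif_pos h]
      refine det_eq_zero_of_row_eq_zero (Fin.cast h (K.equivFin ⟨x, hx⟩)) fun j => ?_
      simp [BS, hx2]
  · simp [gsub, subdet, h]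

theorem numSur_eq (n : ℕ) (K : Finset (Fin n × Fin n × Fin n)) :
    numSur (cokK n K) (ZMod 2) = (Finset.univ.filter (fun S : Finset (Fin n) =>
      S.Nonempty ∧ ∀ x ∈ K, (2 : ℤ) ∣ ∑ i ∈ S, B n x i)).card := by
  let W := Submodule.span ℤ ((fun x => B n x) '' (K : Set (Fin n × Fin n × Fin n)))
  let mk : (Fin n → ℤ) →+ cokK n K := (Submodule.mkQ W).toAddMonoidHom
  have hmks : Function.Surjective mk := Submodule.mkQ_surjective W
  let Φ : (cokK n K →+ ZMod 2) → Finset (Fin n) := fun f =>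
    Finset.univ.filter fun j => f (mk (Pi.single j 1)) ≠ 0
  have z2 : ∀ a : ZMod 2, a ≠ 0 → a = 1 := by decide
  have hf : ∀ (f : cokK n K →+ ZMod 2) (v : Fin n → ℤ),
      f (mk v) = ((∑ j ∈ Φ f, v j : ℤ) : ZMod 2) := by
    intro f v
    have hv : v = ∑ j, v j • (Pi.single j 1 : Fin n → ℤ) := by
      ext i
      simp [Finset.sum_apply, Pi.single_apply]
    conv_lhs => rw [hv]
    rw [map_sum, map_sum, Finset.sum_filter]
    push_cast
    refine Finset.sum_congr rfl fun j _ => ?_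
    rw [map_zsmul, map_zsmul]
    split_ifs with hj
    · rw [z2 _ hj]; simp
    · push Not at hj
      rw [hj]; simp
  have hrow : ∀ x ∈ K, mk (B n x) = 0 := by
    intro x hx
    exact (Submodule.Quotient.mk_eq_zero W).2 (Submodule.subset_span ⟨x, hx, rfl⟩)
  rw [numSur, ← Fintype.card_coe, ← Nat.card_eq_fintype_card]
  have hΦ : ∀ f : {f : cokK n K →+ ZMod 2 // Function.Surjective f},
      Φ f.1 ∈ (Finset.univ.filter (fun S : Finset (Fin n) =>
      S.Nonempty ∧ ∀ x ∈ K, (2 : ℤ) ∣ ∑ i ∈ S, B n x i)) := by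
    rintro ⟨f, hs⟩
    simp only [Finset.mem_filter, Finset.mem_univ, true_and]
    constructor
    · by_contra hne
      rw [Finset.not_nonempty_iff_eq_empty] at hne
      obtain ⟨y, hy⟩ := hs 1
      obtain ⟨v, rfl⟩ := hmks y
      rw [hf, hne] at hy
      simp at hy
    · intro x hx
      have := hf f (B n x)
      rw [hrow x hx, map_zero] at this
      exact (ZMod.intCast_zmod_eq_zero_iff_dvd _ 2).1 this.symm
  refine Nat.card_eq_of_bijective (fun f => ⟨Φ f.1, hΦ f⟩) ⟨?_, ?_⟩
  · rintro ⟨f, hs⟩ ⟨g, hg⟩ hfg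
    simp only [Subtype.mk.injEq] at hfg
    apply Subtype.ext
    ext y
    obtain ⟨v, rfl⟩ := hmks y
    change f (mk v) = g (mk v)
    rw [hf, hf, hfg]
  · rintro ⟨S, hS⟩
    simp only [Finset.mem_filter, Finset.mem_univ, true_and] at hS
    obtain ⟨hne, hK⟩ := hS
    let g : (Fin n → ℤ) →+ ZMod 2 :=
      { toFun := fun v => ((∑ j ∈ S, v j : ℤ) : ZMod 2)
        map_zero' := by simp
        map_add' := fun v w => by simp [Finset.sum_add_distrib] }
    have hgW : W ≤ LinearMap.ker g.toIntLinearMap := by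
      apply Submodule.span_le.2
      rintro _ ⟨x, hx, rfl⟩
      exact (ZMod.intCast_zmod_eq_zero_iff_dvd _ 2).2 (hK x hx)
    let f : cokK n K →+ ZMod 2 := (W.liftQ g.toIntLinearMap hgW).toAddMonoidHom
    have hfg : ∀ v, f (mk v) = g v := fun v => rfl
    have hsing : ∀ j, g (Pi.single j 1) = if j ∈ S then 1 else 0 := by
      intro j
      change ((∑ i ∈ S, (Pi.single j 1 : Fin n → ℤ) i : ℤ) : ZMod 2) = _
      by_cases hj : j ∈ S <;> simp [Pi.single_apply, hj]
    have hsurj : Function.Surjective f := by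
      intro a
      obtain ⟨j, hj⟩ := hne
      by_cases ha : a = 0
      · exact ⟨0, by rw [map_zero, ha]⟩
      · refine ⟨mk (Pi.single j 1), ?_⟩
        rw [hfg, hsing, if_pos hj, z2 a ha]
    refine ⟨⟨f, hsurj⟩, ?_⟩
    apply Subtype.ext
    ext j
    simp [Φ, hfg, hsing]

theorem sum_eq (n : ℕ) :
    ∑ K ∈ Finset.univ.filter
        (fun K : Finset (Fin n × Fin n × Fin n) => K.card = n ∧ subdet n K ≠ 0),
      (subdet n K : ℝ) ^ 2 * (numSur (cokK n K) (ZMod 2) : ℝ) =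
    ∑ S : Finset (Fin n) with S.Nonempty, ((((BS n S)ᵀ * BS n S).det : ℤ) : ℝ) := by
  simp_rw [cauchy_binet, gsub_BS]
  push_cast
  rw [Finset.sum_comm, Finset.sum_filter]
  refine Finset.sum_congr rfl fun K _ => ?_
  have h0 : ¬ (K.card = n ∧ subdet n K ≠ 0) → subdet n K = 0 := by
    intro h
    by_contra h2
    apply h
    refine ⟨?_, h2⟩
    by_contra h3
    exact h2 (by simp [subdet, h3])
  split_ifs with h
  · rw [numSur_eq, Finset.card_filter]
    push_cast
    rw [Finset.mul_sum, Finset.sum_filter]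
    refine Finset.sum_congr rfl fun S _ => ?_
    by_cases h1 : S.Nonempty
    · by_cases h2 : ∀ x ∈ K, (2 : ℤ) ∣ ∑ i ∈ S, B n x i
      · rw [if_pos ⟨h1, h2⟩, if_pos h1, if_pos h2, mul_one]
      · rw [if_neg (fun h => h2 h.2), if_pos h1, if_neg h2]; simp
    · rw [if_neg (fun h => h1 h.1), if_neg h1]; simp
  · rw [h0 h]; simp

end CLAux

namespace CLAux

open Matrix

/-- The sign vector of `S`. -/
def sg {n : ℕ} (S : Finset (Fin n)) (i : Fin n) : ℝ := if i ∈ S then -1 else 1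

theorem sg_sq {n : ℕ} (S : Finset (Fin n)) (i : Fin n) : sg S i * sg S i = 1 := by
  unfold sg; split_ifs <;> norm_num

theorem sum_sg {n : ℕ} (S : Finset (Fin n)) : ∑ i, sg S i = (n : ℝ) - 2 * S.card := by
  have : ∀ i, sg S i = 1 - 2 * (if i ∈ S then (1 : ℝ) else 0) := by
    intro i; unfold sg; split_ifs <;> norm_num
  simp_rw [this]
  rw [Finset.sum_sub_distrib, ← Finset.mul_sum]
  simp

theorem parity_ind {n : ℕ} (S : Finset (Fin n)) (x : Fin n × Fin n × Fin n) :
    (if (2 : ℤ) ∣ ∑ i ∈ S, B n x i then (1 : ℝ) else 0) =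
      (1 + sg S x.1 * sg S x.2.1 * sg S x.2.2) / 2 := by
  have : ∑ i ∈ S, B n x i = (if x.1 ∈ S then 1 else 0) + (if x.2.1 ∈ S then 1 else 0) +
      (if x.2.2 ∈ S then 1 else 0) := by
    simp [B, Finset.sum_add_distrib]
  rw [this]
  unfold sg
  by_cases h1 : x.1 ∈ S <;> by_cases h2 : x.2.1 ∈ S <;> by_cases h3 : x.2.2 ∈ S <;>
    simp only [h1, h2, h3, if_true, if_false] <;> norm_num

/-- Product sums. -/
def tri {n : ℕ} (u v w : Fin n → ℝ) : ℝ := ∑ a, ∑ b, ∑ c, u a * v b * w c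

theorem tri_eq {n : ℕ} (u v w : Fin n → ℝ) : tri u v w = (∑ a, u a) * (∑ a, v a) * ∑ a, w a := by
  unfold tri
  rw [Finset.sum_mul_sum, Finset.sum_mul]
  refine Finset.sum_congr rfl fun a _ => ?_
  rw [Finset.sum_mul]
  refine Finset.sum_congr rfl fun b _ => ?_
  rw [Finset.mul_sum]

theorem gram_entry (n : ℕ) (S : Finset (Fin n)) (i j : Fin n) :
    ((((BS n S)ᵀ * BS n S) i j : ℤ) : ℝ) =
      (if i = j then 3 / 2 * ((n : ℝ) ^ 2 + sg S i * ((n : ℝ) - 2 * S.card) ^ 2) else 0) +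
        3 * ((n : ℝ) + sg S i * sg S j * ((n : ℝ) - 2 * S.card)) := by
  rw [← sum_sg S]
  set s := sg S with hs
  let d : Fin n → Fin n → ℝ := fun i a => if a = i then 1 else 0
  have hBS : ∀ x, ((BS n S x i * BS n S x j : ℤ) : ℝ) =
      ((1 + s x.1 * s x.2.1 * s x.2.2) / 2) * (d i x.1 + d i x.2.1 + d i x.2.2) *
        (d j x.1 + d j x.2.1 + d j x.2.2) := by
    intro x
    rw [← parity_ind S x]
    have hB : ∀ l, (B n x l : ℝ) = d l x.1 + d l x.2.1 + d l x.2.2 := by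
      intro l; simp [B, d]
    simp only [BS]
    by_cases hp : (2 : ℤ) ∣ ∑ i ∈ S, B n x i
    · simp only [if_pos hp]
      rw [← hB, ← hB]; push_cast; ring
    · simp only [if_neg hp]; simp
  rw [mul_apply]
  simp only [transpose_apply]
  rw [Int.cast_sum]
  simp_rw [hBS]
  rw [Fintype.sum_prod_type]
  simp_rw [Fintype.sum_prod_type]
  have expand : ∑ a, ∑ b, ∑ c, ((1 + s a * s b * s c) / 2) * (d i a + d i b + d i c) *
        (d j a + d j b + d j c) =
      1 / 2 * (tri (fun a => d i a * d j a) 1 1 + tri 1 (fun a => d i a * d j a) 1 +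
        tri 1 1 (fun a => d i a * d j a) +
        tri (d i) (d j) 1 + tri (d j) (d i) 1 + tri (d i) 1 (d j) + tri (d j) 1 (d i) +
        tri 1 (d i) (d j) + tri 1 (d j) (d i)) +
      1 / 2 * (tri (fun a => s a * (d i a * d j a)) s s + tri s (fun a => s a * (d i a * d j a)) s +
        tri s s (fun a => s a * (d i a * d j a)) +
        tri (s * d i) (s * d j) s + tri (s * d j) (s * d i) s + tri (s * d i) s (s * d j) +
        tri (s * d j) s (s * d i) + tri s (s * d i) (s * d j) + tri s (s * d j) (s * d i)) := by
    simp only [tri, ← Finset.sum_add_distrib, Finset.mul_sum]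
    refine Finset.sum_congr rfl fun a _ => Finset.sum_congr rfl fun b _ =>
      Finset.sum_congr rfl fun c _ => ?_
    simp only [Pi.mul_apply, Pi.one_apply]
    ring
  rw [expand]
  simp only [tri_eq]
  have e1 : ∑ a : Fin n, (1 : Fin n → ℝ) a = n := by simp
  have e2 : ∀ i, ∑ a, d i a = 1 := by intro i; simp [d]
  have e3 : ∀ i, ∑ a, (s * d i) a = s i := by intro i; simp [d]
  have e4 : ∑ a, d i a * d j a = if i = j then 1 else 0 := by
    by_cases h : i = j
    · simp [d, h]
    · simp [d, h, Ne.symm h]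
  have e5 : ∑ a, s a * (d i a * d j a) = if i = j then s i else 0 := by
    by_cases h : i = j
    · simp [d, h]
    · simp [d, h, Ne.symm h]
  rw [e1, e4, e5]
  simp only [e2, e3]
  split_ifs <;> ring

theorem gram_det (n : ℕ) (S : Finset (Fin n)) (h1 : 1 ≤ S.card) (hn : S.card < n) :
    ((((BS n S)ᵀ * BS n S).det : ℤ) : ℝ) =
      (6 * (S.card : ℝ) * ((n : ℝ) - S.card)) ^ S.card *
      (3 * (((n : ℝ) - S.card) ^ 2 + (S.card : ℝ) ^ 2)) ^ (n - S.card) *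
      (6 * ((n : ℝ) - S.card) ^ 2 / (((n : ℝ) - S.card) ^ 2 + (S.card : ℝ) ^ 2)) := by
  have hk : (0 : ℝ) < S.card := by exact_mod_cast h1
  have hm : (0 : ℝ) < (n : ℝ) - S.card := by
    rw [sub_pos]; exact_mod_cast hn
  obtain ⟨k, hkdef⟩ : ∃ k : ℝ, k = S.card := ⟨_, rfl⟩
  obtain ⟨m, hmdef⟩ : ∃ m : ℝ, m = (n : ℝ) - S.card := ⟨_, rfl⟩
  have hnm : (n : ℝ) = m + k := by rw [hmdef, hkdef]; ring
  let d : Fin n → ℝ := fun i => if i ∈ S then 6 * k * m else 3 * (m ^ 2 + k ^ 2)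
  let U : Matrix (Fin n) (Fin 2) ℝ := fun i => ![1, sg S i]
  let V : Matrix (Fin 2) (Fin n) ℝ := ![fun _ => 3 * (m + k), fun i => 3 * (m - k) * sg S i]
  have hM : (((BS n S)ᵀ * BS n S).map (Int.cast : ℤ → ℝ)) = diagonal d + U * V := by
    ext i j
    rw [map_apply, gram_entry, Matrix.add_apply, diagonal_apply, mul_apply, Fin.sum_univ_two]
    simp only [U, V, d, cons_val_zero, cons_val_one]
    rw [← hkdef, hnm]
    congr 1
    · refine if_congr Iff.rfl ?_ rfl
      unfold sg; split_ifs <;> ring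
    · ring
  rw [← hkdef] at hk
  rw [← hmdef] at hm
  have hd : ∀ i, d i ≠ 0 := by
    intro i; simp only [d]; split_ifs <;> positivity
  have hdet : (((((BS n S)ᵀ * BS n S).det : ℤ)) : ℝ) =
      (((BS n S)ᵀ * BS n S).map (Int.cast : ℤ → ℝ)).det := by
    exact (Int.castRingHom ℝ).map_det _
  have hprod : ∏ i, d i = (6 * k * m) ^ S.card * (3 * (m ^ 2 + k ^ 2)) ^ (n - S.card) := by
    simp only [d]
    rw [Finset.prod_ite]
    simp only [Finset.prod_const]
    congr 2
    · congr 1; ext; simp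
    · rw [← Finset.compl_filter]
      simp [Finset.card_compl]
  have hdu : IsUnit (diagonal d).det := by
    rw [det_diagonal]
    exact (Finset.prod_ne_zero_iff.2 fun i _ => hd i).isUnit
  have hinv : (diagonal d)⁻¹ = diagonal fun i => (d i)⁻¹ := by
    apply inv_eq_right_inv
    rw [diagonal_mul_diagonal]
    simp [hd]
  have hs0 : ∑ i, (d i)⁻¹ = 1 / (6 * m) + m / (3 * (m ^ 2 + k ^ 2)) := by
    have : ∀ i, (d i)⁻¹ = (1 + sg S i) / 2 * (3 * (m ^ 2 + k ^ 2))⁻¹ +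
        (1 - sg S i) / 2 * (6 * k * m)⁻¹ := by
      intro i; simp only [d, sg]; split_ifs <;> ring
    simp_rw [this]
    rw [Finset.sum_add_distrib, ← Finset.sum_mul, ← Finset.sum_mul, ← Finset.sum_div,
      ← Finset.sum_div, Finset.sum_add_distrib, Finset.sum_sub_distrib, sum_sg]
    simp only [Finset.sum_const, Finset.card_univ, Fintype.card_fin, nsmul_eq_mul, mul_one]
    rw [← hkdef, hnm]
    field_simp
    ring
  have hs1 : ∑ i, sg S i * (d i)⁻¹ = - (1 / (6 * m)) + m / (3 * (m ^ 2 + k ^ 2)) := by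
    have : ∀ i, sg S i * (d i)⁻¹ = (1 + sg S i) / 2 * (3 * (m ^ 2 + k ^ 2))⁻¹ -
        (1 - sg S i) / 2 * (6 * k * m)⁻¹ := by
      intro i; simp only [d, sg]; split_ifs <;> ring
    simp_rw [this]
    rw [Finset.sum_sub_distrib, ← Finset.sum_mul, ← Finset.sum_mul, ← Finset.sum_div,
      ← Finset.sum_div, Finset.sum_add_distrib, Finset.sum_sub_distrib, sum_sg]
    simp only [Finset.sum_const, Finset.card_univ, Fintype.card_fin, nsmul_eq_mul, mul_one]
    rw [← hkdef, hnm]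
    field_simp
    ring
  rw [hdet, hM, det_add_mul _ _ hdu, det_diagonal, hprod, ← hmdef, ← hkdef]
  congr 1
  rw [hinv, det_fin_two]
  have q00 : (V * diagonal (fun i => (d i)⁻¹) * U) 0 0 = 3 * (m + k) * ∑ i, (d i)⁻¹ := by
    rw [mul_apply, Finset.mul_sum]
    refine Finset.sum_congr rfl fun i _ => ?_
    rw [mul_diagonal]; simp [U, V]
  have q01 : (V * diagonal (fun i => (d i)⁻¹) * U) 0 1 =
      3 * (m + k) * ∑ i, sg S i * (d i)⁻¹ := by
    rw [mul_apply, Finset.mul_sum]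
    refine Finset.sum_congr rfl fun i _ => ?_
    rw [mul_diagonal]; simp [U, V]; ring
  have q10 : (V * diagonal (fun i => (d i)⁻¹) * U) 1 0 =
      3 * (m - k) * ∑ i, sg S i * (d i)⁻¹ := by
    rw [mul_apply, Finset.mul_sum]
    refine Finset.sum_congr rfl fun i _ => ?_
    rw [mul_diagonal]; simp [U, V]; ring
  have q11 : (V * diagonal (fun i => (d i)⁻¹) * U) 1 1 =
      3 * (m - k) * ∑ i, (d i)⁻¹ := by
    rw [mul_apply, Finset.mul_sum]
    refine Finset.sum_congr rfl fun i _ => ?_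
    rw [mul_diagonal]
    simp only [U, V, cons_val_zero, cons_val_one]
    linear_combination (3 * (m - k) * (d i)⁻¹) * sg_sq S i
  simp only [Matrix.add_apply, q00, q01, q10, q11, hs0, hs1]
  simp only [one_apply_eq, ne_eq, zero_ne_one, not_false_eq_true, one_apply_ne, one_ne_zero]
  field_simp
  ring

theorem gram_det_top (n : ℕ) (hn : 1 ≤ n) (S : Finset (Fin n)) (h : S.card = n) :
    ((((BS n S)ᵀ * BS n S).det : ℤ) : ℝ) = 0 := by
  have hdet : (((((BS n S)ᵀ * BS n S).det : ℤ)) : ℝ) =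
      (((BS n S)ᵀ * BS n S).map (Int.cast : ℤ → ℝ)).det := by
    exact (Int.castRingHom ℝ).map_det _
  have hS : ∀ i, sg S i = -1 := by
    intro i
    have : S = Finset.univ := by
      apply Finset.eq_univ_of_card; simpa using h
    simp [sg, this]
  rw [hdet]
  refine det_eq_zero_of_row_eq_zero ⟨0, hn⟩ fun j => ?_
  rw [map_apply, gram_entry, hS, hS, h]
  split_ifs <;> ring

/-- The summand. -/
def T (n k : ℕ) : ℝ :=
  (n.choose k : ℝ) * ((2 * (k : ℝ) * ((n : ℝ) - k) / (n : ℝ) ^ 2) ^ k *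
    ((((n : ℝ) - k) ^ 2 + (k : ℝ) ^ 2) / (n : ℝ) ^ 2) ^ (n - k) *
    (2 * ((n : ℝ) - k) ^ 2 / (((n : ℝ) - k) ^ 2 + (k : ℝ) ^ 2)))

theorem seq_eq (n : ℕ) (hn : 1 ≤ n) :
    (1 / ((3 : ℝ) ^ (n + 1) * (n : ℝ) ^ (2 * n))) *
            ∑ K ∈ Finset.univ.filter
                (fun K : Finset (Fin n × Fin n × Fin n) => K.card = n ∧ subdet n K ≠ 0),
              (subdet n K : ℝ) ^ 2 * (numSur (cokK n K) (ZMod 2) : ℝ) =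
    ∑ k ∈ Finset.Ico 1 n, T n k := by
  have hn0 : (0 : ℝ) < n := by exact_mod_cast hn
  rw [sum_eq, Finset.mul_sum]
  let g : ℕ → ℝ := fun k => if k = 0 then 0 else
    ((2 * (k : ℝ) * ((n : ℝ) - k) / (n : ℝ) ^ 2) ^ k *
    ((((n : ℝ) - k) ^ 2 + (k : ℝ) ^ 2) / (n : ℝ) ^ 2) ^ (n - k) *
    (2 * ((n : ℝ) - k) ^ 2 / (((n : ℝ) - k) ^ 2 + (k : ℝ) ^ 2)))
  have h1 : ∑ S : Finset (Fin n) with S.Nonempty, 1 / ((3 : ℝ) ^ (n + 1) * (n : ℝ) ^ (2 * n)) *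
      ((((BS n S)ᵀ * BS n S).det : ℤ) : ℝ) = ∑ S ∈ (Finset.univ : Finset (Fin n)).powerset,
        g S.card := by
    rw [Finset.sum_filter, Finset.powerset_univ]
    refine Finset.sum_congr rfl fun S _ => ?_
    split_ifs with hS
    · have hc : 1 ≤ S.card := Finset.card_pos.2 hS
      have hle : S.card ≤ n := by simpa using S.card_le_univ
      simp only [g]
      rw [if_neg (by omega)]
      rcases hle.lt_or_eq with hlt | heq
      · rw [gram_det n S hc hlt]
        have hm : (0 : ℝ) < (n : ℝ) - S.card := by
          rw [sub_pos]; exact_mod_cast hlt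
        have hk : (0 : ℝ) < S.card := by exact_mod_cast hc
        obtain ⟨l, hl⟩ : ∃ l, n - S.card = l := ⟨_, rfl⟩
        have e3 : (3 : ℝ) ^ (n + 1) = 3 * 3 ^ S.card * 3 ^ l := by
          rw [mul_assoc, ← pow_add, ← pow_succ']; congr 1; omega
        have en : (n : ℝ) ^ (2 * n) = ((n : ℝ) ^ 2) ^ S.card * ((n : ℝ) ^ 2) ^ l := by
          rw [← pow_add, ← pow_mul]; congr 1; omega
        rw [hl, e3, en]
        have ea : (6 * (S.card : ℝ) * ((n : ℝ) - S.card)) =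
          3 * (2 * (S.card : ℝ) * ((n : ℝ) - S.card)) := by ring
        rw [ea, mul_pow 3, mul_pow 3, div_pow, div_pow]
        field_simp
        norm_num
      · rw [gram_det_top n hn S heq, heq]
        simp
    · rw [Finset.not_nonempty_iff_eq_empty] at hS
      simp [hS, g]
  rw [h1, Finset.sum_powerset_apply_card]
  simp only [Finset.card_univ, Fintype.card_fin, nsmul_eq_mul]
  rw [Finset.sum_range_succ, Finset.range_eq_Ico, Finset.sum_eq_sum_Ico_succ_bot (by omega)]
  have g0 : g 0 = 0 := by simp [g]
  have gn : g n = 0 := by simp [g]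
  rw [g0, gn]
  simp only [mul_zero, add_zero, zero_add]
  refine Finset.sum_congr rfl fun k hk => ?_
  have := (Finset.mem_Ico.1 hk).1
  simp only [g, T]
  rw [if_neg (by omega)]

end CLAux

namespace CLAux

/-- Binomial probability. -/
def bin (n k : ℕ) (r : ℝ) : ℝ := (n.choose k : ℝ) * (r ^ k * (1 - r) ^ (n - k))

theorem bin_nonneg (n k : ℕ) {r : ℝ} (h0 : 0 ≤ r) (h1 : r ≤ 1) : 0 ≤ bin n k r := by
  have : 0 ≤ 1 - r := by linarith
  unfold bin; positivity

theorem sum_bin (n : ℕ) (r : ℝ) : ∑ k ∈ Finset.range (n + 1), bin n k r = 1 := by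
  have := add_pow r (1 - r) n
  simp only [add_sub_cancel, one_pow] at this
  rw [this]
  refine Finset.sum_congr rfl fun k _ => ?_
  unfold bin; ring

theorem sum_bin_le (n : ℕ) {r : ℝ} (h0 : 0 ≤ r) (h1 : r ≤ 1) :
    ∑ k ∈ Finset.Ico 1 n, bin n k r ≤ 1 := by
  rw [← sum_bin n r]
  refine Finset.sum_le_sum_of_subset_of_nonneg ?_ fun k _ _ => bin_nonneg n k h0 h1
  intro k hk
  rw [Finset.mem_Ico] at hk
  rw [Finset.mem_range]; omega

theorem bin_le_one (n k : ℕ) (hk : k ≤ n) {r : ℝ} (h0 : 0 ≤ r) (h1 : r ≤ 1) : bin n k r ≤ 1 := by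
  rw [← sum_bin n r]
  exact Finset.single_le_sum (f := fun k => bin n k r) (fun k _ => bin_nonneg n k h0 h1)
    (Finset.mem_range.2 (by omega))

theorem bin_mono (n k : ℕ) (hk : k ≤ n) {q r : ℝ} (hr0 : 0 < r) (hr1 : r < 1)
    (hq0 : 0 ≤ q) (hq1 : q ≤ 1) (h : (q - r) * ((k : ℝ) - n * r) ≤ 0) :
    bin n k q ≤ bin n k r := by
  unfold bin
  apply mul_le_mul_of_nonneg_left _ (by positivity)
  have hr1' : 0 < 1 - r := by linarith
  have hq1' : 0 ≤ 1 - q := by linarith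
  have e1 : q ≤ r * Real.exp (q / r - 1) := by
    have := Real.add_one_le_exp (q / r - 1)
    rw [sub_add_cancel, div_le_iff₀ hr0] at this
    linarith
  have e2 : 1 - q ≤ (1 - r) * Real.exp ((1 - q) / (1 - r) - 1) := by
    have := Real.add_one_le_exp ((1 - q) / (1 - r) - 1)
    rw [sub_add_cancel, div_le_iff₀ hr1'] at this
    linarith
  calc q ^ k * (1 - q) ^ (n - k) ≤ (r * Real.exp (q / r - 1)) ^ k *
        ((1 - r) * Real.exp ((1 - q) / (1 - r) - 1)) ^ (n - k) := by gcongr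
    _ = (r ^ k * (1 - r) ^ (n - k)) * Real.exp (k * (q / r - 1) +
        ((n - k : ℕ) : ℝ) * ((1 - q) / (1 - r) - 1)) := by
      rw [mul_pow, mul_pow, ← Real.exp_nat_mul, ← Real.exp_nat_mul, Real.exp_add]; ring
    _ ≤ (r ^ k * (1 - r) ^ (n - k)) * 1 := by
      apply mul_le_mul_of_nonneg_left _ (by positivity)
      rw [Real.exp_le_one_iff]
      rw [Nat.cast_sub hk]
      have : (k : ℝ) * (q / r - 1) + ((n : ℝ) - k) * ((1 - q) / (1 - r) - 1) =
          ((q - r) * ((k : ℝ) - n * r)) / (r * (1 - r)) := by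
        field_simp; ring
      rw [this]
      exact div_nonpos_of_nonpos_of_nonneg h (by positivity)
    _ = _ := mul_one _

/-- The parameter. -/
def qq (n k : ℕ) : ℝ := 2 * (k : ℝ) * ((n : ℝ) - k) / (n : ℝ) ^ 2

theorem qq_eq (n k : ℕ) (hn : 1 ≤ n) : qq n k = 2 * ((k : ℝ) / n) * (1 - (k : ℝ) / n) := by
  have : (0 : ℝ) < n := by exact_mod_cast hn
  unfold qq; field_simp

theorem one_sub_qq (n k : ℕ) (hn : 1 ≤ n) :
    1 - qq n k = (((n : ℝ) - k) ^ 2 + (k : ℝ) ^ 2) / (n : ℝ) ^ 2 := by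
  have : (0 : ℝ) < n := by exact_mod_cast hn
  unfold qq; field_simp; ring

theorem qq_nonneg (n k : ℕ) (hk : k ≤ n) : 0 ≤ qq n k := by
  have : (0 : ℝ) ≤ (n : ℝ) - k := by rw [sub_nonneg]; exact_mod_cast hk
  unfold qq; positivity

theorem qq_le_half (n k : ℕ) (hn : 1 ≤ n) : qq n k ≤ 1 / 2 := by
  rw [qq_eq n k hn]
  nlinarith [sq_nonneg ((k : ℝ) / n - 1 / 2)]

theorem T_eq_bin (n k : ℕ) (hn : 1 ≤ n) : T n k = bin n k (qq n k) *
    (2 * ((n : ℝ) - k) ^ 2 / (((n : ℝ) - k) ^ 2 + (k : ℝ) ^ 2)) := by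
  unfold T bin
  rw [one_sub_qq n k hn, qq]; ring

theorem T_le (n k : ℕ) (hn : 1 ≤ n) (hk : k ≤ n) : T n k ≤ 2 * bin n k (qq n k) := by
  rw [T_eq_bin n k hn, mul_comm 2 (bin n k (qq n k))]
  have h1 := qq_nonneg n k hk
  have h2 := qq_le_half n k hn
  apply mul_le_mul_of_nonneg_left _ (bin_nonneg n k h1 (by linarith))
  apply div_le_of_le_mul₀ (by positivity) (by norm_num)
  nlinarith [sq_nonneg (k : ℝ)]

/-- The offset from one half. -/
def yy (n k : ℕ) : ℝ := 1 - 2 * ((k : ℝ) / n)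

theorem qq_yy (n k : ℕ) (hn : 1 ≤ n) : qq n k = (1 - yy n k ^ 2) / 2 := by
  rw [qq_eq n k hn, yy]; ring

theorem bin_qq (n k : ℕ) (hn : 1 ≤ n) : bin n k (qq n k) =
    bin n k (1 / 2) * ((1 - yy n k ^ 2) ^ k * (1 + yy n k ^ 2) ^ (n - k)) := by
  unfold bin
  rw [qq_yy n k hn]
  have : 1 - (1 - yy n k ^ 2) / 2 = (1 / 2) * (1 + yy n k ^ 2) := by ring
  rw [this, mul_pow]
  have : (1 - yy n k ^ 2) / 2 = (1 / 2) * (1 - yy n k ^ 2) := by ring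
  rw [this, mul_pow]
  have : (1 : ℝ) - 1 / 2 = 1 / 2 := by norm_num
  rw [this]
  ring

theorem yy_abs (n k : ℕ) (hk : k ≤ n) : |yy n k| ≤ 1 := by
  have h1 : (k : ℝ) / n ≤ 1 := div_le_one_of_le₀ (by exact_mod_cast hk) (by positivity)
  have h0 : 0 ≤ (k : ℝ) / n := by positivity
  unfold yy
  rw [abs_le]; constructor <;> linarith

/-- small `k` -/
theorem small_bound (n k : ℕ) (hn : 1 ≤ n) (hk : k ≤ n) (h : (k : ℝ) / n ≤ 1 / 16) :
    bin n k (qq n k) ≤ Real.exp (-1 / 10) ^ k := by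
  have hn0 : (0 : ℝ) < n := by exact_mod_cast hn
  obtain ⟨p, hp⟩ : ∃ p : ℝ, p = (k : ℝ) / n := ⟨_, rfl⟩
  have hp0 : 0 ≤ p := by rw [hp]; positivity
  rw [← hp] at h
  have hkp : (k : ℝ) = n * p := by rw [hp]; field_simp
  have hc : (n.choose k : ℝ) ≤ (n : ℝ) ^ k / (k.factorial : ℝ) := Nat.choose_le_pow_div k n
  have hf : (k : ℝ) ^ k / (k.factorial : ℝ) ≤ Real.exp k :=
    Real.pow_div_factorial_le_exp _ (by positivity) k
  have hq : qq n k = 2 * p * (1 - p) := by rw [qq_eq n k hn, hp]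
  have hq0 : 0 ≤ qq n k := qq_nonneg n k hk
  have hq1 : 0 ≤ 1 - qq n k := by linarith [qq_le_half n k hn]
  have e1 : (1 - qq n k) ^ (n - k) ≤ Real.exp (-(2 * k * (1 - p) ^ 2)) := by
    have : 1 - qq n k ≤ Real.exp (- qq n k) := by linarith [Real.add_one_le_exp (- qq n k)]
    calc (1 - qq n k) ^ (n - k) ≤ (Real.exp (- qq n k)) ^ (n - k) := by gcongr
      _ = _ := by
        rw [← Real.exp_nat_mul, Nat.cast_sub hk, hq, hkp]; congr 1; ring
  have e2 : (1 - p) ^ k ≤ Real.exp (-(k * p)) := by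
    have : 1 - p ≤ Real.exp (- p) := by linarith [Real.add_one_le_exp (- p)]
    calc (1 - p) ^ k ≤ (Real.exp (- p)) ^ k := by
          have : 0 ≤ 1 - p := by linarith
          gcongr
      _ = _ := by rw [← Real.exp_nat_mul]; congr 1; ring
  have e3 : (2 : ℝ) ^ k ≤ Real.exp (0.6932 * k) := by
    have : (2 : ℝ) ≤ Real.exp 0.6932 := by
      rw [← Real.log_le_iff_le_exp (by norm_num)]
      have := Real.log_two_lt_d9
      linarith
    calc (2 : ℝ) ^ k ≤ (Real.exp 0.6932) ^ k := by gcongr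
      _ = _ := by rw [← Real.exp_nat_mul]; congr 1; ring
  have hp1 : 0 ≤ 1 - p := by linarith
  calc bin n k (qq n k) ≤ ((n : ℝ) ^ k / (k.factorial : ℝ)) *
        ((qq n k) ^ k * Real.exp (-(2 * k * (1 - p) ^ 2))) := by
        unfold bin; gcongr
    _ = 2 ^ k * ((k : ℝ) ^ k / (k.factorial : ℝ)) * (1 - p) ^ k *
        Real.exp (-(2 * k * (1 - p) ^ 2)) := by
        have : (qq n k) ^ k = 2 ^ k * p ^ k * (1 - p) ^ k := by rw [hq, mul_pow, mul_pow]
        rw [this]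
        have : (k : ℝ) ^ k = (n : ℝ) ^ k * p ^ k := by
          conv_lhs => rw [hkp]
          rw [mul_pow]
        rw [this]
        ring
    _ ≤ Real.exp (0.6932 * k) * Real.exp k * Real.exp (-(k * p)) *
        Real.exp (-(2 * k * (1 - p) ^ 2)) := by gcongr
    _ = Real.exp (k * (0.6932 + 1 - p - 2 * (1 - p) ^ 2)) := by
        rw [← Real.exp_add, ← Real.exp_add, ← Real.exp_add]; congr 1; ring
    _ ≤ Real.exp (k * (-1 / 10)) := by
        gcongr
        nlinarith
    _ = _ := by rw [← Real.exp_nat_mul]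

theorem block_bound (n k : ℕ) (hn : 1 ≤ n) (hk : k ≤ n) (a r : ℝ) (ha : 0 < a) (har : a ≤ r)
    (hr : r < 1 / 2) (h2 : r ≤ 2 * a * (1 - a)) (h1 : a ≤ (k : ℝ) / n) (h3 : (k : ℝ) / n ≤ r) :
    bin n k (qq n k) ≤ bin n k r := by
  have hn0 : (0 : ℝ) < n := by exact_mod_cast hn
  have hq := qq_le_half n k hn
  apply bin_mono n k hk (by linarith) (by linarith) (qq_nonneg n k hk) (by linarith)
  have h4 : (k : ℝ) ≤ n * r := by
    rw [div_le_iff₀ hn0] at h3; linarith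
  have h5 : r ≤ qq n k := by
    rw [qq_eq n k hn]
    nlinarith
  exact mul_nonpos_of_nonneg_of_nonpos (by linarith) (by linarith)

theorem upper_half (n k : ℕ) (hn : 1 ≤ n) (hk : k ≤ n) (h : 1 / 2 ≤ (k : ℝ) / n) :
    bin n k (qq n k) ≤ bin n k (1 / 2) := by
  have hn0 : (0 : ℝ) < n := by exact_mod_cast hn
  have hq := qq_le_half n k hn
  apply bin_mono n k hk (by linarith) (by linarith) (qq_nonneg n k hk) (by linarith)
  rw [le_div_iff₀ hn0] at h
  exact mul_nonpos_of_nonpos_of_nonneg (by linarith) (by linarith)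

theorem cast_n_sub_two_k (n k : ℕ) (hn : 1 ≤ n) (h2k : 2 * k ≤ n) :
    ((n - 2 * k : ℕ) : ℝ) = n * yy n k := by
  have hn0 : (0 : ℝ) < n := by exact_mod_cast hn
  rw [Nat.cast_sub h2k, yy]
  field_simp
  push_cast
  ring

theorem near_half (n k : ℕ) (hn : 1 ≤ n) (h2k : 2 * k ≤ n) (h : n * yy n k ^ 3 ≤ 1) :
    bin n k (qq n k) ≤ Real.exp 1 * bin n k (1 / 2) := by
  have hk : k ≤ n := by omega
  rw [bin_qq n k hn, mul_comm]
  apply mul_le_mul_of_nonneg_right _ (bin_nonneg n k (by norm_num) (by norm_num))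
  have hy := yy_abs n k hk
  obtain ⟨y, hyd⟩ : ∃ y, y = yy n k := ⟨_, rfl⟩
  have hc := cast_n_sub_two_k n k hn h2k
  rw [← hyd] at hy hc h ⊢
  have hy2 : y ^ 2 ≤ 1 := by rw [sq_le_one_iff_abs_le_one]; exact hy
  have e : n - k = k + (n - 2 * k) := by omega
  rw [e, pow_add, ← mul_assoc, ← mul_pow]
  have e1 : ((1 - y ^ 2) * (1 + y ^ 2)) ^ k ≤ 1 := by
    apply pow_le_one₀
    · apply mul_nonneg <;> nlinarith [sq_nonneg y]
    · nlinarith [sq_nonneg (y ^ 2)]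
  have e2 : (1 + y ^ 2) ^ (n - 2 * k) ≤ Real.exp 1 := by
    calc (1 + y ^ 2) ^ (n - 2 * k) ≤ (Real.exp (y ^ 2)) ^ (n - 2 * k) := by
          have := Real.add_one_le_exp (y ^ 2)
          gcongr; linarith
      _ = Real.exp (n * y ^ 3) := by
          rw [← Real.exp_nat_mul, hc]; congr 1; ring
      _ ≤ _ := by gcongr
  calc _ ≤ 1 * Real.exp 1 := by gcongr
    _ = _ := one_mul _

theorem mid_bound (n k : ℕ) (hn : 1 ≤ n) (h2k : 2 * k ≤ n) (h38 : 3 / 8 ≤ (k : ℝ) / n) :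
    bin n k (qq n k) ≤ Real.exp (-(n * yy n k ^ 2 / 6)) := by
  have hk : k ≤ n := by omega
  have hn0 : (0 : ℝ) < n := by exact_mod_cast hn
  have hc := cast_n_sub_two_k n k hn h2k
  obtain ⟨y, hyd⟩ : ∃ y, y = yy n k := ⟨_, rfl⟩
  obtain ⟨p, hp⟩ : ∃ p : ℝ, p = (k : ℝ) / n := ⟨_, rfl⟩
  have hy0 : 0 ≤ y := by
    have : 0 ≤ n * y := by rw [hyd, ← hc]; positivity
    exact nonneg_of_mul_nonneg_right this hn0
  have hpy : p = (1 - y) / 2 := by rw [hyd, hp, yy]; ring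
  have hy4 : y ≤ 1 / 4 := by rw [← hp] at h38; linarith
  have hq : qq n k = p * (1 + y) := by rw [qq_eq n k hn, ← hp, hpy]; ring
  have hq2 : 1 - qq n k = (1 - p) * ((1 + y ^ 2) / (1 + y)) := by
    rw [hq, hpy]; field_simp; ring
  have e0 : bin n k (qq n k) = bin n k p * ((1 + y) ^ k * ((1 + y ^ 2) / (1 + y)) ^ (n - k)) := by
    unfold bin
    rw [hq2, hq, mul_pow, mul_pow]; ring
  have hb := bin_le_one n k hk (r := p) (by linarith) (by linarith)
  have hnk : ((n - k : ℕ) : ℝ) = n * (1 + y) / 2 := by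
    rw [Nat.cast_sub hk]
    have : (k : ℝ) = n * p := by rw [hp]; field_simp
    rw [this, hpy]; ring
  have e1 : (1 + y ^ 2) ^ (n - k) ≤ Real.exp (n * (1 + y) / 2 * y ^ 2) := by
    rw [← hnk, Real.exp_nat_mul]
    have := Real.add_one_le_exp (y ^ 2)
    gcongr; linarith
  have e2 : ((1 + y)⁻¹) ^ (n - 2 * k) ≤ Real.exp (n * y * (-(y / (1 + y)))) := by
    rw [hyd, ← hc, ← hyd, Real.exp_nat_mul]
    have := Real.add_one_le_exp (-(y / (1 + y)))
    have h3 : (1 + y)⁻¹ = -(y / (1 + y)) + 1 := by field_simp; ring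
    rw [← h3] at this
    gcongr
  have e3 : (1 + y) ^ k * ((1 + y ^ 2) / (1 + y)) ^ (n - k) =
      (1 + y ^ 2) ^ (n - k) * ((1 + y)⁻¹) ^ (n - 2 * k) := by
    have : n - k = k + (n - 2 * k) := by omega
    rw [div_eq_mul_inv, mul_pow]
    nth_rewrite 2 [this]
    rw [pow_add, inv_pow _ k]
    field_simp
  rw [e0, e3, ← hyd]
  calc _ ≤ 1 * (Real.exp (n * (1 + y) / 2 * y ^ 2) * Real.exp (n * y * (-(y / (1 + y))))) := by
        gcongr
    _ = Real.exp ((n * y ^ 2) * ((1 + y) / 2 - 1 / (1 + y))) := by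
        rw [one_mul, ← Real.exp_add]; congr 1; ring
    _ ≤ _ := by
        gcongr
        have : (1 + y) / 2 - 1 / (1 + y) ≤ - (1 / 6) := by
          have h1y : 0 < 1 + y := by linarith
          rw [div_sub_div _ _ (by norm_num) h1y.ne', div_le_iff₀ (by positivity)]
          nlinarith
        have h4 : 0 ≤ n * y ^ 2 := by positivity
        nlinarith

theorem upper_bound (s : ℕ) (hs : 1 ≤ s) (n : ℕ) (hns : n = s ^ 3) :
    ∑ k ∈ Finset.Ico 1 n, T n k ≤
      2 * (1 + Real.exp 1 + 4 + (1 - Real.exp (-1 / 10))⁻¹ + 1296) := by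
  have hn : 1 ≤ n := by rw [hns]; exact Nat.one_le_pow _ _ hs
  have hn0 : (0 : ℝ) < n := by exact_mod_cast hn
  have hs0 : (0 : ℝ) < s := by exact_mod_cast hs
  have key : ∀ k ∈ Finset.Ico 1 n, T n k ≤ 2 * (bin n k (1 / 2) + Real.exp 1 * bin n k (1 / 2) +
      (bin n k 0.11 + bin n k 0.19 + bin n k 0.3 + bin n k 0.4) + Real.exp (-1 / 10) ^ k +
      Real.exp (-(s / 6))) := by
    intro k hk
    rw [Finset.mem_Ico] at hk
    have hkn : k ≤ n := by omega
    refine (T_le n k hn hkn).trans ?_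
    apply mul_le_mul_of_nonneg_left _ (by norm_num)
    have z1 := bin_nonneg n k (r := 1 / 2) (by norm_num) (by norm_num)
    have z2 := bin_nonneg n k (r := 0.11) (by norm_num) (by norm_num)
    have z3 := bin_nonneg n k (r := 0.19) (by norm_num) (by norm_num)
    have z4 := bin_nonneg n k (r := 0.3) (by norm_num) (by norm_num)
    have z5 := bin_nonneg n k (r := 0.4) (by norm_num) (by norm_num)
    have z6 : 0 ≤ Real.exp 1 * bin n k (1 / 2) := by positivity
    have z7 : 0 ≤ Real.exp (-1 / 10) ^ k := by positivity
    have z8 : 0 ≤ Real.exp (-(s / 6)) := by positivity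
    rcases le_total (1 / 2) ((k : ℝ) / n) with h | h
    · have := upper_half n k hn hkn h; linarith
    rcases le_total ((k : ℝ) / n) (1 / 16) with h1 | h1
    · have := small_bound n k hn hkn h1; linarith
    rcases le_total ((k : ℝ) / n) 0.11 with h2 | h2
    · have := block_bound n k hn hkn (1 / 16) 0.11 (by norm_num) (by norm_num) (by norm_num)
        (by norm_num) h1 h2
      linarith
    rcases le_total ((k : ℝ) / n) 0.19 with h3 | h3
    · have := block_bound n k hn hkn 0.11 0.19 (by norm_num) (by norm_num) (by norm_num)
        (by norm_num) h2 h3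
      linarith
    rcases le_total ((k : ℝ) / n) 0.3 with h4 | h4
    · have := block_bound n k hn hkn 0.19 0.3 (by norm_num) (by norm_num) (by norm_num)
        (by norm_num) h3 h4
      linarith
    rcases le_total ((k : ℝ) / n) 0.4 with h5 | h5
    · have := block_bound n k hn hkn 0.3 0.4 (by norm_num) (by norm_num) (by norm_num)
        (by norm_num) h4 h5
      linarith
    have h2k : 2 * k ≤ n := by
      rw [div_le_iff₀ hn0] at h
      have : (2 : ℝ) * k ≤ n := by linarith
      exact_mod_cast this
    rcases le_total (n * yy n k ^ 3) 1 with h6 | h6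
    · have := near_half n k hn h2k h6; linarith
    have h7 := mid_bound n k hn h2k (by norm_num at h5 ⊢; linarith)
    have hns' : (n : ℝ) = s ^ 3 := by rw [hns]; push_cast; ring
    have h8 : 1 ≤ s * yy n k := by
      rw [hns', ← mul_pow] at h6
      by_contra hlt
      push Not at hlt
      have hy0 : 0 ≤ yy n k := by unfold yy; linarith
      have : (s * yy n k) ^ 3 < 1 := pow_lt_one₀ (by positivity) hlt (by norm_num)
      linarith
    have h9 : Real.exp (-(n * yy n k ^ 2 / 6)) ≤ Real.exp (-(s / 6)) := by
      gcongr
      rw [hns']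
      have : (1 : ℝ) ≤ (s * yy n k) ^ 2 := one_le_pow₀ h8
      nlinarith
    linarith
  refine (Finset.sum_le_sum key).trans ?_
  rw [← Finset.mul_sum]
  apply mul_le_mul_of_nonneg_left _ (by norm_num)
  simp only [Finset.sum_add_distrib, ← Finset.mul_sum]
  have s1 := sum_bin_le n (r := 1 / 2) (by norm_num) (by norm_num)
  have s2 := sum_bin_le n (r := 0.11) (by norm_num) (by norm_num)
  have s3 := sum_bin_le n (r := 0.19) (by norm_num) (by norm_num)
  have s4 := sum_bin_le n (r := 0.3) (by norm_num) (by norm_num)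
  have s5 := sum_bin_le n (r := 0.4) (by norm_num) (by norm_num)
  have s6 : Real.exp 1 * ∑ k ∈ Finset.Ico 1 n, bin n k (1 / 2) ≤ Real.exp 1 * 1 := by gcongr
  have s7 : ∑ k ∈ Finset.Ico 1 n, Real.exp (-1 / 10) ^ k ≤ (1 - Real.exp (-1 / 10))⁻¹ := by
    have hlt : Real.exp (-1 / 10) < 1 := by rw [Real.exp_lt_one_iff]; norm_num
    have h0 : 0 ≤ Real.exp (-1 / 10) := by positivity
    rw [← tsum_geometric_of_lt_one h0 hlt]
    exact (summable_geometric_of_lt_one h0 hlt).sum_le_tsum _ (fun _ _ => by positivity)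
  have s8 : ∑ k ∈ Finset.Ico 1 n, Real.exp (-((s : ℝ) / 6)) ≤ 1296 := by
    rw [Finset.sum_const, Nat.card_Ico, nsmul_eq_mul]
    have hle : ((n - 1 : ℕ) : ℝ) ≤ n := by exact_mod_cast Nat.sub_le n 1
    have hns' : (n : ℝ) = s ^ 3 := by rw [hns]; push_cast; ring
    have := Real.pow_div_factorial_le_exp ((s : ℝ) / 6) (by positivity) 3
    norm_num [Nat.factorial] at this
    have h2 : (n : ℝ) ≤ 1296 * Real.exp (s / 6) := by rw [hns']; nlinarith
    calc _ ≤ (n : ℝ) * Real.exp (-((s : ℝ) / 6)) := by gcongr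
      _ ≤ 1296 * Real.exp (s / 6) * Real.exp (-((s : ℝ) / 6)) := by gcongr
      _ = 1296 := by rw [mul_assoc, ← Real.exp_add]; simp
  linarith

end CLAux

namespace CLAux

/-- Binomial moments. -/
def mom (n : ℕ) (h : ℝ → ℝ) : ℝ :=
  ∑ k ∈ Finset.range (n + 1), (n.choose k : ℝ) * h ((n : ℝ) - 2 * k)

theorem mom_succ (n : ℕ) (h : ℝ → ℝ) :
    mom (n + 1) h = mom n (fun x => h (x + 1)) + mom n (fun x => h (x - 1)) := by
  unfold mom
  have := Finset.sum_choose_succ_mul (R := ℝ) (fun i j => h ((j : ℝ) - i)) n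
  have e : ∀ k ∈ Finset.range (n + 1 + 1), ((n + 1).choose k : ℝ) *
      h (((n + 1 : ℕ) : ℝ) - 2 * k) =
      ((n + 1).choose k : ℝ) * h (((n + 1 - k : ℕ) : ℝ) - k) := by
    intro k hk
    rw [Finset.mem_range] at hk
    rw [Nat.cast_sub (by omega)]
    congr 2; ring
  rw [Finset.sum_congr rfl e, this]
  congr 1
  · refine Finset.sum_congr rfl fun k hk => ?_
    rw [Finset.mem_range] at hk
    rw [Nat.cast_sub (by omega)]
    push_cast
    congr 2; ring
  · refine Finset.sum_congr rfl fun k hk => ?_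
    rw [Finset.mem_range] at hk
    rw [Nat.cast_sub (by omega)]
    push_cast
    congr 2; ring

theorem mom_add (n : ℕ) (f g : ℝ → ℝ) : mom n (fun x => f x + g x) = mom n f + mom n g := by
  simp [mom, mul_add, Finset.sum_add_distrib]

theorem mom_smul (n : ℕ) (c : ℝ) (f : ℝ → ℝ) : mom n (fun x => c * f x) = c * mom n f := by
  simp only [mom, Finset.mul_sum]
  refine Finset.sum_congr rfl fun k _ => by ring

theorem mom0 (n : ℕ) : mom n (fun _ => 1) = 2 ^ n := by
  simp only [mom, mul_one]
  exact_mod_cast Nat.sum_range_choose n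

theorem mom2 (n : ℕ) : mom n (fun x => x ^ 2) = n * 2 ^ n := by
  induction n with
  | zero => simp [mom]
  | succ n ih =>
    rw [mom_succ, ← mom_add]
    have : (fun x : ℝ => (x + 1) ^ 2 + (x - 1) ^ 2) = fun x => 2 * x ^ 2 + 2 * 1 := by
      ext x; ring
    rw [this, mom_add, mom_smul, mom_smul, ih, mom0]
    push_cast; ring

theorem mom4 (n : ℕ) : mom n (fun x => x ^ 4) = (3 * (n : ℝ) ^ 2 - 2 * n) * 2 ^ n := by
  induction n with
  | zero => simp [mom]
  | succ n ih =>
    rw [mom_succ, ← mom_add]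
    have : (fun x : ℝ => (x + 1) ^ 4 + (x - 1) ^ 4) =
        fun x => 2 * x ^ 4 + (12 * x ^ 2 + 2 * 1) := by
      ext x; ring
    rw [this, mom_add, mom_add, mom_smul, mom_smul, mom_smul, ih, mom0, mom2]
    push_cast; ring

theorem F_lower (n k : ℕ) (hn : 1 ≤ n) (hk : k ≤ n) :
    1 - 2 * n * |yy n k| ^ 3 ≤ (1 - yy n k ^ 2) ^ k * (1 + yy n k ^ 2) ^ (n - k) := by
  have hn0 : (0 : ℝ) < n := by exact_mod_cast hn
  have hy := yy_abs n k hk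
  obtain ⟨y, hyd⟩ : ∃ y, y = yy n k := ⟨_, rfl⟩
  have hyn : (n : ℝ) * y = n - 2 * k := by
    rw [hyd, yy]; field_simp
  rw [← hyd] at hy ⊢
  have hy2 : y ^ 2 ≤ 1 := by rw [sq_le_one_iff_abs_le_one]; exact hy
  have hy4 : y ^ 4 ≤ |y| ^ 3 := by
    have : y ^ 4 = |y| ^ 3 * |y| := by rw [← pow_succ, Even.pow_abs ⟨2, rfl⟩]
    rw [this]
    exact mul_le_of_le_one_right (by positivity) hy
  have hy40 : 0 ≤ y ^ 4 := by positivity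
  have hy41 : y ^ 4 ≤ 1 := by nlinarith [sq_nonneg y]
  have hprod : (1 - y ^ 2) * (1 + y ^ 2) = 1 - y ^ 4 := by ring
  have bern : ∀ (a : ℝ) (l : ℕ), 0 ≤ a → a ≤ 1 → 1 - l * a ≤ (1 - a) ^ l := by
    intro a l h0 h1
    have := one_add_mul_le_pow (a := -a) (by linarith) l
    have e : (1 - a) = 1 + -a := by ring
    rw [e]; linarith
  have b1 : ∀ l : ℕ, l ≤ n → 1 - n * |y| ^ 3 ≤ (1 - y ^ 4) ^ l := by
    intro l hl
    refine le_trans ?_ (bern (y ^ 4) l hy40 hy41)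
    have : (l : ℝ) * y ^ 4 ≤ n * |y| ^ 3 := by gcongr
    linarith
  have hz : 0 ≤ n * |y| ^ 3 := by positivity
  rcases le_total (2 * k) n with h | h
  · have e : n - k = k + (n - 2 * k) := by omega
    rw [e, pow_add, ← mul_assoc, ← mul_pow, hprod]
    have h1 := b1 k hk
    have h2 : 1 ≤ (1 + y ^ 2) ^ (n - 2 * k) := one_le_pow₀ (by nlinarith [sq_nonneg y])
    have h3 : 0 ≤ (1 - y ^ 4) ^ k := pow_nonneg (by linarith) _
    nlinarith
  · have e : k = (2 * k - n) + (n - k) := by omega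
    nth_rewrite 1 [e]
    rw [pow_add, mul_assoc ((1 - y ^ 2) ^ (2 * k - n)), ← mul_pow, hprod]
    have h1 := b1 (n - k) (by omega)
    have h2 := bern (y ^ 2) (2 * k - n) (by positivity) hy2
    have h3 : 0 ≤ (1 - y ^ 4) ^ (n - k) := pow_nonneg (by linarith) _
    have h5 : 0 ≤ (1 - y ^ 2) ^ (2 * k - n) := pow_nonneg (by linarith) _
    have hc : ((2 * k - n : ℕ) : ℝ) = n * |y| := by
      rw [Nat.cast_sub h]
      have hneg : y ≤ 0 := by
        have : (n : ℝ) ≤ 2 * k := by exact_mod_cast h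
        have : (n : ℝ) * y ≤ 0 := by linarith
        exact nonpos_of_mul_nonpos_right this hn0
      rw [abs_of_nonpos hneg]
      push_cast; linarith
    have h4 : ((2 * k - n : ℕ) : ℝ) * y ^ 2 = n * |y| ^ 3 := by
      rw [hc, ← sq_abs y]; ring
    rw [h4] at h2
    by_cases hneg : 1 - n * |y| ^ 3 ≤ 0
    · have : 0 ≤ (1 - y ^ 2) ^ (2 * k - n) * (1 - y ^ 4) ^ (n - k) := by positivity
      linarith
    · push Not at hneg
      have : (1 - n * |y| ^ 3) * (1 - n * |y| ^ 3) ≤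
        (1 - y ^ 2) ^ (2 * k - n) * (1 - y ^ 4) ^ (n - k) := by gcongr
      nlinarith

theorem T_lower (n k : ℕ) (hn : 1 ≤ n) (hk : k ≤ n) :
    bin n k (1 / 2) * (1 - 2 * n * |yy n k| ^ 3 - 2 * |yy n k|) ≤ T n k := by
  have hn0 : (0 : ℝ) < n := by exact_mod_cast hn
  rw [T_eq_bin n k hn, bin_qq n k hn, mul_assoc (bin n k (1 / 2))]
  apply mul_le_mul_of_nonneg_left _ (bin_nonneg n k (by norm_num) (by norm_num))
  have hF := F_lower n k hn hk
  have hy := yy_abs n k hk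
  have hG : 2 * ((n : ℝ) - k) ^ 2 / (((n : ℝ) - k) ^ 2 + (k : ℝ) ^ 2) =
      (1 + yy n k) ^ 2 / (1 + yy n k ^ 2) := by
    have h1 : (k : ℝ) = n * ((1 - yy n k) / 2) := by unfold yy; field_simp; ring
    have h2 : (n : ℝ) - k = n * ((1 + yy n k) / 2) := by unfold yy; field_simp; ring
    generalize yy n k = y at h1 h2
    rw [h2, h1]
    have e : (n * ((1 + y) / 2)) ^ 2 + (n * ((1 - y) / 2)) ^ 2 = (n : ℝ) ^ 2 * (1 + y ^ 2) / 2 := by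
      ring
    rw [e]
    field_simp
  rw [hG]
  obtain ⟨y, hyd⟩ : ∃ y, y = yy n k := ⟨_, rfl⟩
  rw [← hyd] at hF hy ⊢
  have hy2 : y ^ 2 ≤ 1 := by rw [sq_le_one_iff_abs_le_one]; exact hy
  have hG0 : 0 ≤ (1 + y) ^ 2 / (1 + y ^ 2) := by positivity
  have hG1 : 1 - 2 * |y| ≤ (1 + y) ^ 2 / (1 + y ^ 2) := by
    rw [le_div_iff₀ (by positivity)]
    have := neg_abs_le y
    have : 0 ≤ |y| * y ^ 2 := by positivity
    nlinarith
  have hF0 : 0 ≤ (1 - y ^ 2) ^ k * (1 + y ^ 2) ^ (n - k) := by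
    have : 0 ≤ 1 - y ^ 2 := by linarith
    positivity
  have ha : 0 ≤ 2 * n * |y| ^ 3 := by positivity
  have hb : 0 ≤ 2 * |y| := by positivity
  by_cases h1 : 1 - 2 * n * |y| ^ 3 - 2 * |y| ≤ 0
  · exact h1.trans (mul_nonneg hF0 hG0)
  · push Not at h1
    have h2 : 0 ≤ 1 - 2 * |y| := by linarith
    have : (1 - 2 * n * |y| ^ 3) * (1 - 2 * |y|) ≤
      ((1 - y ^ 2) ^ k * (1 + y ^ 2) ^ (n - k)) * ((1 + y) ^ 2 / (1 + y ^ 2)) := by gcongr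
    nlinarith

theorem T_lower2 (n k : ℕ) (hn : 1 ≤ n) (hk : k ≤ n) :
    bin n k (1 / 2) * (1 - 1 / √n - 2 * √n * yy n k ^ 2 - n * √n * yy n k ^ 4) ≤ T n k := by
  refine le_trans ?_ (T_lower n k hn hk)
  apply mul_le_mul_of_nonneg_left _ (bin_nonneg n k (by norm_num) (by norm_num))
  have hn0 : (0 : ℝ) < n := by exact_mod_cast hn
  have hs : 0 < √(n : ℝ) := Real.sqrt_pos.2 hn0
  have hss : √(n : ℝ) * √(n : ℝ) = n := Real.mul_self_sqrt hn0.le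
  generalize yy n k = y
  rw [← sq_abs y]
  have e4 : y ^ 4 = |y| ^ 4 := by rw [Even.pow_abs ⟨2, rfl⟩]
  rw [e4]
  have ha := abs_nonneg y
  generalize |y| = a at ha
  generalize √(n : ℝ) = r at hs hss
  rw [← hss]
  have h1 : 2 * a ≤ 1 / r + r * a ^ 2 := by
    rw [← sub_nonneg]
    have : 1 / r + r * a ^ 2 - 2 * a = (1 - r * a) ^ 2 / r := by field_simp; ring
    rw [this]; positivity
  have h2 : 2 * (r * r) * a ^ 3 ≤ r * a ^ 2 + r * r * r * a ^ 4 := by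
    have : 0 ≤ r * a ^ 2 * (1 - r * a) ^ 2 := by positivity
    nlinarith
  linarith

theorem bin_half (n k : ℕ) (hk : k ≤ n) : bin n k (1 / 2) = (n.choose k : ℝ) / 2 ^ n := by
  unfold bin
  have : (1 : ℝ) - 1 / 2 = 1 / 2 := by norm_num
  rw [this, ← pow_add, Nat.add_sub_cancel' hk]
  rw [one_div, inv_pow]; rfl

theorem center_lower (n : ℕ) (hn : 3 ≤ n) :
    1 - 6 / √n - (n + 2) / 2 ^ n ≤ ∑ k ∈ Finset.Ico 2 n, T n k := by
  have hn0 : (0 : ℝ) < n := by exact_mod_cast (by omega : 0 < n)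
  have hs : 0 < √(n : ℝ) := Real.sqrt_pos.2 hn0
  have hss : √(n : ℝ) * √(n : ℝ) = n := Real.mul_self_sqrt hn0.le
  let g : ℕ → ℝ := fun k =>
    bin n k (1 / 2) * (1 - 1 / √n - 2 * √n * yy n k ^ 2 - n * √n * yy n k ^ 4)
  have hfull : 1 - 6 / √n ≤ ∑ k ∈ Finset.range (n + 1), g k := by
    have e : ∑ k ∈ Finset.range (n + 1), g k = (1 / 2 ^ n) *
        mom n (fun x => (1 - 1 / √n) * 1 + ((- (2 * √n / n ^ 2)) * x ^ 2 +
          (- (n * √n / n ^ 4)) * x ^ 4)) := by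
      unfold mom
      rw [Finset.mul_sum]
      refine Finset.sum_congr rfl fun k hk => ?_
      rw [Finset.mem_range] at hk
      simp only [g]
      rw [bin_half n k (by omega)]
      have : yy n k = ((n : ℝ) - 2 * k) / n := by unfold yy; field_simp
      rw [this]
      field_simp
      ring
    rw [e, mom_add, mom_add, mom_smul, mom_smul, mom_smul, mom0, mom2, mom4]
    have h2 : (1 / 2 ^ n : ℝ) * ((1 - 1 / √n) * 2 ^ n + (-(2 * √n / n ^ 2) * (n * 2 ^ n) +
        -(n * √n / n ^ 4) * ((3 * (n : ℝ) ^ 2 - 2 * n) * 2 ^ n))) =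
        1 - 1 / √n - 5 * (√n / n) + 2 * √n / n ^ 2 := by
      field_simp
      ring
    rw [h2]
    have h3 : √(n : ℝ) / n = 1 / √n := by
      rw [div_eq_div_iff hn0.ne' hs.ne']; linarith
    rw [h3]
    have h4 : 0 ≤ 2 * √(n : ℝ) / n ^ 2 := by positivity
    have h5 : 6 / √(n : ℝ) = 1 / √n + 5 * (1 / √n) := by ring
    linarith
  have hle : ∀ k, g k ≤ bin n k (1 / 2) := by
    intro k
    apply mul_le_of_le_one_right (bin_nonneg n k (by norm_num) (by norm_num))
    have a1 : 0 ≤ 1 / √(n : ℝ) := by positivity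
    have a2 : 0 ≤ 2 * √n * yy n k ^ 2 := by positivity
    have a3 : 0 ≤ n * √n * yy n k ^ 4 := by positivity
    linarith
  have hsplit : ∑ k ∈ Finset.range (n + 1), g k = g 0 + g 1 + ∑ k ∈ Finset.Ico 2 n, g k + g n := by
    rw [Finset.sum_range_succ, Finset.range_eq_Ico, Finset.sum_eq_sum_Ico_succ_bot (by omega),
      Finset.sum_eq_sum_Ico_succ_bot (by omega)]
    ring
  have hT : ∑ k ∈ Finset.Ico 2 n, g k ≤ ∑ k ∈ Finset.Ico 2 n, T n k := by
    refine Finset.sum_le_sum fun k hk => ?_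
    rw [Finset.mem_Ico] at hk
    exact T_lower2 n k (by omega) (by omega)
  have h0 := hle 0
  have h1 := hle 1
  have h2 := hle n
  rw [bin_half n _ (by omega)] at h0 h1 h2
  simp only [Nat.choose_zero_right, Nat.choose_one_right, Nat.choose_self, Nat.cast_one] at h0 h1 h2
  have : ((n : ℝ) + 2) / 2 ^ n = 1 / 2 ^ n + n / 2 ^ n + 1 / 2 ^ n := by ring
  linarith

theorem T_one_tendsto : Tendsto (fun n : ℕ => T n 1) atTop (nhds (4 * Real.exp (-2))) := by
  have hinv : Tendsto (fun n : ℕ => ((n : ℝ))⁻¹) atTop (nhds 0) := tendsto_inv_atTop_nhds_zero_nat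
  let g : ℕ → ℝ := fun n => -2 * (n : ℝ)⁻¹ + 2 * (n : ℝ)⁻¹ * (n : ℝ)⁻¹
  have hg0 : Tendsto g atTop (nhds 0) := by
    have := (hinv.const_mul (-2)).add ((hinv.const_mul 2).mul hinv)
    simpa [g] using this
  have hng : Tendsto (fun n : ℕ => (n : ℝ) * g n) atTop (nhds (-2)) := by
    have : Tendsto (fun n : ℕ => -2 + 2 * (n : ℝ)⁻¹) atTop (nhds (-2)) := by
      have := (hinv.const_mul 2).const_add (-2)
      simpa using this
    refine this.congr' ?_
    filter_upwards [eventually_ge_atTop 1] with n hn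
    have hn0 : (0 : ℝ) < n := by exact_mod_cast hn
    simp only [g]; field_simp
  have hpow := Real.tendsto_one_add_pow_exp_of_tendsto hng
  have h1g : Tendsto (fun n => 1 + g n) atTop (nhds 1) := by
    simpa using hg0.const_add 1
  have h1i : Tendsto (fun n : ℕ => 1 - (n : ℝ)⁻¹) atTop (nhds 1) := by
    simpa using hinv.const_sub 1
  have hall : Tendsto (fun n : ℕ => 2 * (1 - (n : ℝ)⁻¹) * ((1 + g n) ^ n / (1 + g n)) *
      (2 * (1 - (n : ℝ)⁻¹) ^ 2 / (1 + g n))) atTop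
      (nhds (2 * 1 * (Real.exp (-2) / 1) * (2 * 1 ^ 2 / 1))) :=
    ((h1i.const_mul 2).mul (hpow.div h1g one_ne_zero)).mul
      (((h1i.pow 2).const_mul 2).div h1g one_ne_zero)
  have e : (2 * 1 * (Real.exp (-2) / 1) * (2 * 1 ^ 2 / 1) : ℝ) = 4 * Real.exp (-2) := by ring
  rw [e] at hall
  refine hall.congr' ?_
  filter_upwards [eventually_ge_atTop 1] with n hn
  have hn0 : (0 : ℝ) < n := by exact_mod_cast hn
  have hx : (((n : ℝ) - 1) ^ 2 + 1) / (n : ℝ) ^ 2 = 1 + g n := by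
    simp only [g]; field_simp; ring
  have hpos : 0 < 1 + g n := by rw [← hx]; positivity
  unfold T
  simp only [Nat.choose_one_right, Nat.cast_one, one_pow, pow_one]
  rw [hx, pow_sub₀ _ hpos.ne' hn, pow_one]
  have hx2 : ((n : ℝ) - 1) ^ 2 + 1 = (1 + g n) * (n : ℝ) ^ 2 := by
    rw [← hx]; field_simp
  rw [hx2]
  generalize 1 + g n = z at hpos
  generalize z ^ n = w
  field_simp

end CLAux

/-- The liminf of the determinantally weighted average number of surjections from the
cokernel onto `ℤ/2ℤ` is at least `1 + 4e^{-2}`; in particular the moment theorem fails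
for `G = ℤ/2ℤ`. -/
theorem liminf_surjections_zmod_two :
    1 + 4 * Real.exp (-2) ≤
      Filter.liminf
        (fun n : ℕ =>
          (1 / ((3 : ℝ) ^ (n + 1) * (n : ℝ) ^ (2 * n))) *
            ∑ K ∈ Finset.univ.filter
                (fun K : Finset (Fin n × Fin n × Fin n) => K.card = n ∧ subdet n K ≠ 0),
              (subdet n K : ℝ) ^ 2 * (numSur (cokK n K) (ZMod 2) : ℝ))
        atTop := by
  have hlow : Tendsto (fun n : ℕ => CLAux.T n 1 + (1 - 6 / √(n : ℝ) - ((n : ℝ) + 2) / 2 ^ n)) atTop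
      (nhds (4 * Real.exp (-2) + (1 - 0 - 0))) := by
    refine CLAux.T_one_tendsto.add ((tendsto_const_nhds.sub ?_).sub ?_)
    · have h1 : Tendsto (fun n : ℕ => √(n : ℝ)) atTop atTop :=
        Real.tendsto_sqrt_atTop.comp tendsto_natCast_atTop_atTop
      exact h1.const_div_atTop 6
    · have h1 : Tendsto (fun n : ℕ => (n : ℝ) ^ 1 / (2 : ℝ) ^ n) atTop (nhds 0) :=
        tendsto_pow_const_div_const_pow_of_one_lt 1 (by norm_num)
      have h2 : Tendsto (fun n : ℕ => (n : ℝ) ^ 0 / (2 : ℝ) ^ n) atTop (nhds 0) :=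
        tendsto_pow_const_div_const_pow_of_one_lt 0 (by norm_num)
      have h3 := h1.add (h2.const_mul 2)
      rw [mul_zero, add_zero] at h3
      refine h3.congr fun n => ?_
      ring
  have e : (4 * Real.exp (-2) + (1 - 0 - 0) : ℝ) = 1 + 4 * Real.exp (-2) := by ring
  rw [e] at hlow
  rw [← hlow.liminf_eq]
  refine liminf_le_liminf ?_ hlow.isBoundedUnder_ge ?_
  · filter_upwards [eventually_ge_atTop 3] with n hn
    rw [CLAux.seq_eq n (by omega), Finset.sum_eq_sum_Ico_succ_bot (by omega)]
    have := CLAux.center_lower n hn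
    have h2 : (1 + 1 : ℕ) = 2 := rfl
    rw [h2]
    linarith
  · refine IsCoboundedUnder.of_frequently_le
      (a := 2 * (1 + Real.exp 1 + 4 + (1 - Real.exp (-1 / 10))⁻¹ + 1296)) ?_
    rw [frequently_atTop]
    intro a
    refine ⟨(a + 1) ^ 3, ?_, ?_⟩
    · have : a + 1 ≤ (a + 1) ^ 3 := Nat.le_self_pow (by norm_num) _
      omega
    · rw [CLAux.seq_eq _ (Nat.one_le_pow _ _ (by omega))]
      exact CLAux.upper_bound (a + 1) (by omega) _ rfl
end
end
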